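/- arXiv:1601.07359 — 2 statements merged into one kernel-verified Lean document; each statement's English description precedes it below -/
import Mathlib

section
/- For all integers p, q ≥ 1, the irreducible symmetric space SL(p+q,ℂ)/SU(p,q) does not admit a compact Clifford–Klein form; that is, there is no discrete subgroup Γ of SL(p+q,ℂ) whose left-translation action on SL(p+q,ℂ)/SU(p,q) is properly discontinuous and free and has compact quotient. -/
/-! Statement 4: For all integers `p, q ≥ 1`, the irreducible symmetric space
`SL(p+q,ℂ)/SU(p,q)` does not admit a compact Clifford–Klein form. -/

open Matrix

noncomputable section

/-- A homogeneous space `G/H` admits a compact Clifford–Klein form if there is a discrete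
subgroup `Γ` of `G` acting properly discontinuously and freely on `G/H` by left translations
with compact quotient `Γ\G/H`. -/
def AdmitsCompactCliffordKleinForm {G : Type*} [Group G] [TopologicalSpace G]
    (H : Subgroup G) : Prop :=
  ∃ Γ : Subgroup G, DiscreteTopology Γ ∧
    ProperlyDiscontinuousSMul Γ (G ⧸ H) ∧
    (∀ γ : Γ, γ ≠ 1 → ∀ x : G ⧸ H, γ • x ≠ x) ∧
    CompactSpace (Quotient (MulAction.orbitRel Γ (G ⧸ H)))

/-- The matrix `I_{p,q} = diag(1,…,1,−1,…,−1)` (`p` ones, `q` minus ones) over `ℂ`. -/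
def formMatC (p q : ℕ) : Matrix (Fin (p + q)) (Fin (p + q)) ℂ :=
  Matrix.diagonal fun i => if (i : ℕ) < p then (1 : ℂ) else -1

/-- The indefinite special unitary group `SU(p,q)`: the subgroup of `SL(p+q,ℂ)` of matrices
`A` with `Aᴴ I_{p,q} A = I_{p,q}`, where `Aᴴ` is the conjugate transpose. -/
def SU (p q : ℕ) : Subgroup (GL (Fin (p + q)) ℂ) where
  carrier := {A | (A : Matrix (Fin (p + q)) (Fin (p + q)) ℂ).det = 1 ∧
    (A : Matrix (Fin (p + q)) (Fin (p + q)) ℂ)ᴴ * formMatC p q * A = formMatC p q}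
  one_mem' := by constructor <;> simp
  mul_mem' := by
    intro a b ha hb
    obtain ⟨ha1, ha2⟩ := ha
    obtain ⟨hb1, hb2⟩ := hb
    refine ⟨?_, ?_⟩
    · show ((a * b : GL (Fin (p + q)) ℂ) : Matrix (Fin (p + q)) (Fin (p + q)) ℂ).det = 1
      rw [Units.val_mul, Matrix.det_mul, ha1, hb1, mul_one]
    · have h : ((a * b : GL (Fin (p + q)) ℂ) : Matrix (Fin (p + q)) (Fin (p + q)) ℂ)ᴴ *
          formMatC p q * ((a * b : GL (Fin (p + q)) ℂ) : Matrix (Fin (p + q)) (Fin (p + q)) ℂ) =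
          (b : Matrix (Fin (p + q)) (Fin (p + q)) ℂ)ᴴ *
            ((a : Matrix (Fin (p + q)) (Fin (p + q)) ℂ)ᴴ * formMatC p q *
              (a : Matrix (Fin (p + q)) (Fin (p + q)) ℂ)) *
            (b : Matrix (Fin (p + q)) (Fin (p + q)) ℂ) := by
        rw [Units.val_mul, Matrix.conjTranspose_mul]
        simp only [mul_assoc]
      show _ = _
      rw [h, ha2, hb2]
  inv_mem' := by
    intro a ha
    obtain ⟨ha1, ha2⟩ := ha
    refine ⟨?_, ?_⟩
    · have h1 : (a : Matrix (Fin (p + q)) (Fin (p + q)) ℂ).det *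
          ((a⁻¹ : GL (Fin (p + q)) ℂ) : Matrix (Fin (p + q)) (Fin (p + q)) ℂ).det = 1 := by
        rw [← Matrix.det_mul, ← Units.val_mul, mul_inv_cancel, Units.val_one, Matrix.det_one]
      show ((a⁻¹ : GL (Fin (p + q)) ℂ) : Matrix (Fin (p + q)) (Fin (p + q)) ℂ).det = 1
      rw [ha1, one_mul] at h1
      exact h1
    · have h1 : (a : Matrix (Fin (p + q)) (Fin (p + q)) ℂ) *
          ((a⁻¹ : GL (Fin (p + q)) ℂ) : Matrix (Fin (p + q)) (Fin (p + q)) ℂ) = 1 := by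
        rw [← Units.val_mul, mul_inv_cancel, Units.val_one]
      have key : ((a⁻¹ : GL (Fin (p + q)) ℂ) : Matrix (Fin (p + q)) (Fin (p + q)) ℂ)ᴴ *
          ((a : Matrix (Fin (p + q)) (Fin (p + q)) ℂ)ᴴ * formMatC p q *
            (a : Matrix (Fin (p + q)) (Fin (p + q)) ℂ)) *
          ((a⁻¹ : GL (Fin (p + q)) ℂ) : Matrix (Fin (p + q)) (Fin (p + q)) ℂ) = formMatC p q := by
        have h2 : ((a⁻¹ : GL (Fin (p + q)) ℂ) : Matrix (Fin (p + q)) (Fin (p + q)) ℂ)ᴴ *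
            ((a : Matrix (Fin (p + q)) (Fin (p + q)) ℂ)ᴴ * formMatC p q *
              (a : Matrix (Fin (p + q)) (Fin (p + q)) ℂ)) *
            ((a⁻¹ : GL (Fin (p + q)) ℂ) : Matrix (Fin (p + q)) (Fin (p + q)) ℂ) =
            ((a : Matrix (Fin (p + q)) (Fin (p + q)) ℂ) *
              ((a⁻¹ : GL (Fin (p + q)) ℂ) : Matrix (Fin (p + q)) (Fin (p + q)) ℂ))ᴴ *
              formMatC p q *
              ((a : Matrix (Fin (p + q)) (Fin (p + q)) ℂ) *
                ((a⁻¹ : GL (Fin (p + q)) ℂ) : Matrix (Fin (p + q)) (Fin (p + q)) ℂ)) := by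
          rw [Matrix.conjTranspose_mul]
          simp only [mul_assoc]
        rw [h2, h1]
        simp
      rw [ha2] at key
      exact key

/-- The special linear group `SL(n,ℂ)`, as a subgroup of `GL(n,ℂ)`. -/
def SLC (n : ℕ) : Subgroup (GL (Fin n) ℂ) where
  carrier := {A | (A : Matrix (Fin n) (Fin n) ℂ).det = 1}
  one_mem' := by simp
  mul_mem' := by
    intro a b ha hb
    replace ha : (a : Matrix (Fin n) (Fin n) ℂ).det = 1 := ha
    replace hb : (b : Matrix (Fin n) (Fin n) ℂ).det = 1 := hb
    show ((a * b : GL (Fin n) ℂ) : Matrix (Fin n) (Fin n) ℂ).det = 1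
    rw [Units.val_mul, Matrix.det_mul, ha, hb, mul_one]
  inv_mem' := by
    intro a ha
    replace ha : (a : Matrix (Fin n) (Fin n) ℂ).det = 1 := ha
    have h1 : (a : Matrix (Fin n) (Fin n) ℂ).det *
        ((a⁻¹ : GL (Fin n) ℂ) : Matrix (Fin n) (Fin n) ℂ).det = 1 := by
      rw [← Matrix.det_mul, ← Units.val_mul, mul_inv_cancel, Units.val_one, Matrix.det_one]
    show ((a⁻¹ : GL (Fin n) ℂ) : Matrix (Fin n) (Fin n) ℂ).det = 1
    rw [ha, one_mul] at h1
    exact h1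

section
open MeasureTheory
theorem integral_det_large {E : Type*} [NormedAddCommGroup E] [NormedSpace ℝ E] [FiniteDimensional ℝ E]
    [MeasurableSpace E] [BorelSpace E] (μ : Measure E) [μ.IsAddHaarMeasure]
    (Φ : E → E) (h1 : ContDiff ℝ 1 Φ) (r : ℝ) (hr : ∀ x, x ∉ Metric.closedBall (0:E) r → Φ x = 0)
    (h2 : HasCompactSupport Φ) :
    ∃ c0 : ℝ, ∀ c > c0, ∫ x in Metric.closedBall (0:E) r,
      (c • ContinuousLinearMap.id ℝ E - fderiv ℝ Φ x).det ∂μ =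
       c ^ (Module.finrank ℝ E) * μ.real (Metric.closedBall (0:E) r) := by
  obtain ⟨L, hL⟩ := ContDiff.lipschitzWith_of_hasCompactSupport h2 h1 (by simp)
  have hdet : ∀ᶠ T : E →L[ℝ] E in nhds (ContinuousLinearMap.id ℝ E), 0 < T.det := by
    have : Continuous (fun T : E →L[ℝ] E => T.det) := ContinuousLinearMap.continuous_det
    apply this.continuousAt.eventually (lt_mem_nhds _)
    simp [ContinuousLinearMap.det]
  obtain ⟨ε, hε, hdet⟩ := Metric.eventually_nhds_iff.1 hdet
  refine ⟨max 1 (max (L+1) ((L+1) / ε)), fun c hc => ?_⟩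
  have hc1 : 1 < c := lt_of_le_of_lt (le_max_left _ _) hc
  have hc2 : (L:ℝ)+1 < c := lt_of_le_of_lt ((le_max_left _ _).trans (le_max_right _ _)) hc
  have hc3 : ((L:ℝ)+1)/ε < c := lt_of_le_of_lt ((le_max_right _ _).trans (le_max_right _ _)) hc
  have hc0 : 0 < c := by linarith
  set B := Metric.closedBall (0:E) r
  let g : E → E := fun x => x - c⁻¹ • Φ x
  have hlip : ∀ x y, ‖Φ x - Φ y‖ ≤ L * ‖x - y‖ := fun x y => by
    simpa [dist_eq_norm] using hL.dist_le_mul x y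
  have ginj : Function.Injective g := by
    intro x y hxy
    by_contra hne
    have h3 : x - y = c⁻¹ • (Φ x - Φ y) := by
      have : x - c⁻¹ • Φ x = y - c⁻¹ • Φ y := hxy
      rw [smul_sub, sub_eq_sub_iff_sub_eq_sub.1 this]
    have h4 : ‖x - y‖ ≤ c⁻¹ * (L * ‖x-y‖) := by
      conv_lhs => rw [h3]
      rw [norm_smul, Real.norm_of_nonneg (by positivity)]
      gcongr; exact hlip x y
    have h5 : 0 < ‖x - y‖ := norm_pos_iff.2 (sub_ne_zero.2 hne)
    have h6 : c * ‖x - y‖ ≤ L * ‖x - y‖ := by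
      calc c * ‖x-y‖ ≤ c * (c⁻¹ * (L * ‖x-y‖)) := by gcongr
        _ = _ := by field_simp
    nlinarith
  have gout : ∀ x, x ∉ B → g x = x := fun x hx => by simp [g, hr x hx]
  have gsurj : Function.Surjective g := by
    intro y
    have hcon : ContractingWith (L / (L+1)) (fun x => y + c⁻¹ • Φ x) := by
      refine ⟨?_, ?_⟩
      · rw [div_lt_one (by positivity)]; exact lt_add_one L
      · apply LipschitzWith.of_dist_le_mul
        intro a b
        simp only [dist_eq_norm, add_sub_add_left_eq_sub, ← smul_sub, norm_smul,
          Real.norm_of_nonneg (inv_nonneg.2 hc0.le)]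
        calc c⁻¹ * ‖Φ a - Φ b‖ ≤ ((L:ℝ)+1)⁻¹ * (L * ‖a - b‖) := by
              gcongr
              exact hlip a b
          _ = _ := by push_cast; ring
    refine ⟨hcon.fixedPoint, ?_⟩
    have := hcon.fixedPoint_isFixedPt
    have h' : y + c⁻¹ • Φ hcon.fixedPoint = hcon.fixedPoint := this
    show hcon.fixedPoint - c⁻¹ • Φ hcon.fixedPoint = y
    rw [sub_eq_iff_eq_add]; exact h'.symm
  have gB : g '' B = B := by
    ext y
    constructor
    · rintro ⟨x, hx, rfl⟩
      by_contra hy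
      have := ginj (gout _ hy)
      rw [this] at hy; exact hy hx
    · intro hy
      obtain ⟨x, rfl⟩ := gsurj y
      refine ⟨x, ?_, rfl⟩
      by_contra hx
      rw [gout x hx] at hy; exact hx hy
  have hgd : ∀ x, HasFDerivAt g (ContinuousLinearMap.id ℝ E - c⁻¹ • fderiv ℝ Φ x) x := fun x =>
    (hasFDerivAt_id x).sub (((h1.differentiable (by simp)) x).hasFDerivAt.const_smul c⁻¹)
  have key := integral_image_eq_integral_abs_det_fderiv_smul μ (s := B) (f := g)
    (Metric.isClosed_closedBall.measurableSet) (fun x _ => (hgd x).hasFDerivWithinAt)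
    ginj.injOn (fun _ => (1:ℝ))
  rw [gB] at key
  simp only [smul_eq_mul, mul_one, integral_const, MeasurableSet.univ, measureReal_restrict_apply,
    Set.univ_inter] at key
  rw [key, ← integral_const_mul]
  congr 1
  ext x
  have e1 : c • ContinuousLinearMap.id ℝ E - fderiv ℝ Φ x =
      c • (ContinuousLinearMap.id ℝ E - c⁻¹ • fderiv ℝ Φ x) := by
    rw [smul_sub, smul_smul, mul_inv_cancel₀ hc0.ne', one_smul]
  have hpos : 0 < (ContinuousLinearMap.id ℝ E - c⁻¹ • fderiv ℝ Φ x).det := by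
    apply hdet
    rw [dist_eq_norm, sub_sub_cancel_left, norm_neg, norm_smul, Real.norm_of_nonneg (by positivity)]
    have : ‖fderiv ℝ Φ x‖ ≤ L := norm_fderiv_le_of_lipschitz ℝ hL
    rw [div_lt_iff₀ hε] at hc3
    rw [inv_mul_lt_iff₀ hc0]; linarith
  rw [e1, abs_of_pos hpos]
  simp [ContinuousLinearMap.det]

theorem integral_det_eq_zero {E : Type*} [NormedAddCommGroup E] [NormedSpace ℝ E] [FiniteDimensional ℝ E]
    [MeasurableSpace E] [BorelSpace E] (μ : Measure E) [μ.IsAddHaarMeasure] [Nontrivial E]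
    (Φ : E → E) (h1 : ContDiff ℝ 1 Φ) (h2 : HasCompactSupport Φ) :
    ∫ x, (fderiv ℝ Φ x).det ∂μ = 0 := by
  obtain ⟨r, hr⟩ := h2.isCompact.isBounded.subset_closedBall (0:E)
  have hr' : ∀ x, x ∉ Metric.closedBall (0:E) r → Φ x = 0 := fun x hx =>
    image_eq_zero_of_notMem_tsupport (fun h => hx (hr h))
  have hcd : Continuous (fderiv ℝ Φ) := h1.continuous_fderiv (by simp)
  have hd0 : ∀ x, x ∉ Metric.closedBall (0:E) r → (fderiv ℝ Φ x).det = 0 := fun x hx => by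
    have : fderiv ℝ Φ x = 0 := by
      apply image_eq_zero_of_notMem_tsupport
      intro h
      exact hx (hr (tsupport_fderiv_subset ℝ h))
    rw [this]
    simp [ContinuousLinearMap.det]
  rw [← setIntegral_eq_integral_of_forall_compl_eq_zero hd0]
  obtain ⟨c0, hc0⟩ := integral_det_large μ Φ h1 r hr' h2
  set N := Module.finrank ℝ E
  have hN : 0 < N := Module.finrank_pos
  let v : ℕ → ℝ := fun j => c0 + 1 + j
  have hv : Set.InjOn v (Finset.range (N+1) : Finset ℕ) := by
    intro a _ b _ hab; simpa [v] using hab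
  have hpoly : ∀ P : Polynomial ℝ, P.natDegree ≤ N → P.eval 0 =
     ∑ j ∈ Finset.range (N+1), P.eval (v j) * (Lagrange.basis (Finset.range (N+1)) v j).eval 0 := by
    intro P hP
    conv_lhs => rw [Lagrange.eq_interpolate (f := P) hv (by
      rw [Finset.card_range]
      exact lt_of_le_of_lt Polynomial.degree_le_natDegree (by exact_mod_cast Nat.lt_succ_of_le hP))]
    simp [Lagrange.interpolate_apply, Polynomial.eval_finsetSum]
  have hch : ∀ x c, ((fderiv ℝ Φ x : E →ₗ[ℝ] E).charpoly).eval c =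
      (c • ContinuousLinearMap.id ℝ E - fderiv ℝ Φ x).det := by
    intro x c
    rw [LinearMap.eval_charpoly]
    simp [ContinuousLinearMap.det, Algebra.algebraMap_eq_smul_one]
    rfl
  have hx : ∀ x, (0 • ContinuousLinearMap.id ℝ E - fderiv ℝ Φ x).det =
     ∑ j ∈ Finset.range (N+1), (v j • ContinuousLinearMap.id ℝ E - fderiv ℝ Φ x).det *
       (Lagrange.basis (Finset.range (N+1)) v j).eval 0 := by
    intro x
    have := hpoly ((fderiv ℝ Φ x : E →ₗ[ℝ] E).charpoly) (LinearMap.charpoly_natDegree _).le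
    simp only [hch] at this
    simpa using this
  have hX := hpoly (Polynomial.X ^ N) (by simp)
  simp only [Polynomial.eval_pow, Polynomial.eval_X, zero_pow hN.ne'] at hX
  have hneg : ∀ x, (fderiv ℝ Φ x).det = (-1)^N * (0 • ContinuousLinearMap.id ℝ E - fderiv ℝ Φ x).det := by
    intro x
    have : (0 • ContinuousLinearMap.id ℝ E - fderiv ℝ Φ x) = (-1:ℝ) • fderiv ℝ Φ x := by simp
    rw [this, ContinuousLinearMap.det, ContinuousLinearMap.det, ContinuousLinearMap.toLinearMap_smul,
      LinearMap.det_smul, ← mul_assoc, ← mul_pow]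
    simp
  simp_rw [hneg, hx]
  rw [integral_const_mul, integral_finsetSum]
  · simp_rw [integral_mul_const]
    have : ∀ j ∈ Finset.range (N+1), (∫ x in Metric.closedBall (0:E) r,
      (v j • ContinuousLinearMap.id ℝ E - fderiv ℝ Φ x).det ∂μ) * (Lagrange.basis (Finset.range (N+1)) v j).eval 0
       = ((v j)^N * (Lagrange.basis (Finset.range (N+1)) v j).eval 0) * μ.real (Metric.closedBall (0:E) r) := by
      intro j _
      rw [hc0 (v j) (by simp only [v]; have : (0:ℝ) ≤ j := j.cast_nonneg
                        linarith)]
      ring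
    rw [Finset.sum_congr rfl this, ← Finset.sum_mul, ← hX]
    simp
  · intro j _
    apply Integrable.mul_const
    apply ContinuousOn.integrableOn_compact (isCompact_closedBall _ _)
    apply Continuous.continuousOn
    exact ContinuousLinearMap.continuous_det.comp (continuous_const.sub hcd)
theorem exists_theta (ε : ℝ) (hε : 0 < ε) : ∃ θ b : ℝ → ℝ, Continuous b ∧ (∀ x, HasDerivAt θ (b x) x) ∧
    (∀ x, 0 ≤ b x) ∧ (∀ x, ε ≤ |x| → b x = 0) ∧ (∀ x, |x| < ε → 0 < b x) := by
  let f : ContDiffBump (0:ℝ) := ⟨ε/2, ε, by linarith, by linarith⟩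
  have hf : Continuous f := f.continuous
  refine ⟨fun x => ∫ t in (0:ℝ)..x, f t, f, hf, fun x => ?_, fun x => f.nonneg, fun x hx => ?_, fun x hx => ?_⟩
  · exact intervalIntegral.integral_hasDerivAt_right (hf.intervalIntegrable _ _)
      (hf.stronglyMeasurableAtFilter _ _) hf.continuousAt
  · apply f.zero_of_le_dist; simpa using hx
  · apply f.pos_of_mem_ball; simpa using hx

theorem degree_lemma {ι : Type*} [Fintype ι] [Nonempty ι] (W W' : (ι → ℝ) → (ι → ℝ))
    (hW : ContDiff ℝ 1 W) (hW' : ContDiff ℝ 1 W') (s : Set (ι → ℝ)) (hs : Bornology.IsBounded s)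
    (heq : ∀ x ∉ s, W x = W' x) (hne : ∀ x ∈ closure s, W' x ≠ 0)
    (hdet : ∀ x ∈ closure s, 0 ≤ (fderiv ℝ W x).det)
    (hpos : ∀ ε > 0, ∃ x ∈ s, ‖W x‖ < ε ∧ 0 < (fderiv ℝ W x).det) : False := by
  classical
  have hK : IsCompact (closure s) := hs.isCompact_closure
  obtain ⟨ε, hε, hε'⟩ : ∃ ε > 0, ∀ x ∈ closure s, ε ≤ ‖W' x‖ := by
    rcases (closure s).eq_empty_or_nonempty with h | h
    · exact ⟨1, one_pos, by simp [h]⟩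
    · obtain ⟨x, hx, hmin⟩ := hK.exists_isMinOn h (hW'.continuous.norm.continuousOn)
      exact ⟨‖W' x‖, norm_pos_iff.2 (hne x hx), fun y hy => hmin hy⟩
  obtain ⟨θ, b, hb, hθ, hb0, hb1, hb2⟩ := exists_theta ε hε
  have hθC : ContDiff ℝ 1 θ := by
    rw [contDiff_one_iff_deriv]
    refine ⟨fun x => (hθ x).differentiableAt, ?_⟩
    have : deriv θ = b := funext fun x => (hθ x).deriv
    rwa [this]
  let R : (ι → ℝ) → (ι → ℝ) := fun w i => θ (w i)
  have hR : ContDiff ℝ 1 R := contDiff_pi.2 fun i => hθC.comp (contDiff_apply ℝ ℝ i)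
  let DR : (ι → ℝ) → ((ι → ℝ) →L[ℝ] (ι → ℝ)) := fun w =>
    ContinuousLinearMap.pi fun i => (b (w i) • ContinuousLinearMap.id ℝ ℝ).comp (ContinuousLinearMap.proj i)
  have hDR : ∀ w, HasFDerivAt R (DR w) w := by
    intro w
    rw [hasFDerivAt_pi']
    intro i
    have h1 : HasFDerivAt θ (b (w i) • ContinuousLinearMap.id ℝ ℝ) (w i) := by
      have e : b (w i) • ContinuousLinearMap.id ℝ ℝ =
          ContinuousLinearMap.toSpanSingleton ℝ (b (w i)) := by ext; simp
      rw [e]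
      exact (hθ (w i)).hasFDerivAt
    have h2 : HasFDerivAt (fun x : ι → ℝ => x i)
        (ContinuousLinearMap.proj (R := ℝ) (φ := fun _ : ι => ℝ) i) w :=
      (ContinuousLinearMap.proj (R := ℝ) (φ := fun _ : ι => ℝ) i).hasFDerivAt
    exact HasFDerivAt.comp (g := θ) w h1 h2
  have hDRdet : ∀ w, (DR w).det = ∏ i, b (w i) := by
    intro w
    rw [ContinuousLinearMap.det_pi]
    simp [ContinuousLinearMap.det]
  obtain ⟨r, hr0, hr⟩ := hs.closure.subset_ball_lt 0 (0:ι → ℝ)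
  let η : ContDiffBump (0:ι → ℝ) := ⟨r, r+1, hr0, by linarith⟩
  let mk : ((ι → ℝ) → (ι → ℝ)) → (ι → ℝ) → (ι → ℝ) := fun w x => η x • R (w x)
  have mkC : ∀ w, ContDiff ℝ 1 w → ContDiff ℝ 1 (mk w) := fun w hw => η.contDiff.smul (hR.comp hw)
  have mkS : ∀ w, HasCompactSupport (mk w) := fun w => η.hasCompactSupport.smul_right
  have mkD : ∀ w, ContDiff ℝ 1 w → ∀ x ∈ closure s, (fderiv ℝ (mk w) x).det =
      (∏ i, b (w x i)) * (fderiv ℝ w x).det := by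
    intro w hw x hx
    have h1 : mk w =ᶠ[nhds x] fun y => R (w y) := by
      filter_upwards [Metric.isOpen_ball.mem_nhds (hr hx)] with y hy
      have : η y = 1 := η.one_of_mem_closedBall (Metric.ball_subset_closedBall hy)
      simp [mk, this]
    rw [h1.fderiv_eq]
    have h2 := ((hDR (w x)).comp x ((hw.differentiable (by simp)) x).hasFDerivAt).fderiv
    have h3 : (fun y => R (w y)) = R ∘ w := rfl
    rw [h3, h2, ← hDRdet]
    simp [ContinuousLinearMap.det]
  have iC : ∀ w, ContDiff ℝ 1 w → Continuous fun x => (fderiv ℝ (mk w) x).det := fun w hw =>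
    ContinuousLinearMap.continuous_det.comp ((mkC w hw).continuous_fderiv (by simp))
  have iS : ∀ w, HasCompactSupport fun x => (fderiv ℝ (mk w) x).det := fun w =>
    ((mkS w).fderiv (𝕜 := ℝ)).comp_left (g := ContinuousLinearMap.det) (by simp [ContinuousLinearMap.det])
  have I1 := integral_det_eq_zero MeasureTheory.volume (mk W) (mkC W hW) (mkS W)
  have I2 := integral_det_eq_zero MeasureTheory.volume (mk W') (mkC W' hW') (mkS W')
  have I3 : ∫ x, ((fderiv ℝ (mk W) x).det - (fderiv ℝ (mk W') x).det) = 0 := by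
    rw [MeasureTheory.integral_sub ((iC W hW).integrable_of_hasCompactSupport (iS W))
      ((iC W' hW').integrable_of_hasCompactSupport (iS W')), I1, I2, sub_zero]
  have hout : ∀ x ∉ closure s, (fderiv ℝ (mk W) x).det = (fderiv ℝ (mk W') x).det := by
    intro x hx
    have h1 : mk W =ᶠ[nhds x] mk W' := by
      filter_upwards [isClosed_closure.isOpen_compl.mem_nhds hx] with y hy
      simp only [mk]
      rw [heq y (fun h => hy (subset_closure h))]
    rw [h1.fderiv_eq]
  have hin : ∀ x ∈ closure s, (fderiv ℝ (mk W') x).det = 0 := by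
    intro x hx
    rw [mkD W' hW' x hx]
    have h1 := hε' x hx
    have : ∃ i, ε ≤ |W' x i| := by
      by_contra hcon
      push Not at hcon
      have := (pi_norm_lt_iff (x := W' x) hε).2 (fun i => by simpa using hcon i)
      linarith
    obtain ⟨i, hi⟩ := this
    rw [Finset.prod_eq_zero (Finset.mem_univ i) (hb1 _ hi), zero_mul]
  obtain ⟨x0, hx0, hx1, hx2⟩ := hpos ε hε
  have := Continuous.integral_pos_of_hasCompactSupport_nonneg_nonzero
    (μ := (MeasureTheory.volume : MeasureTheory.Measure (ι → ℝ)))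
    (f := fun x => (fderiv ℝ (mk W) x).det - (fderiv ℝ (mk W') x).det) (x := x0)
    ((iC W hW).sub (iC W' hW')) ?_ ?_ ?_
  · rw [I3] at this; exact lt_irrefl _ this
  · exact (iS W).sub (iS W')
  · intro x
    by_cases hx : x ∈ closure s
    · simp only [hin x hx, mkD W hW x hx, sub_zero]
      exact mul_nonneg (Finset.prod_nonneg fun i _ => hb0 _) (hdet x hx)
    · simp [hout x hx]
  · have hx := subset_closure hx0
    simp only [hin x0 hx, mkD W hW x0 hx, sub_zero]
    refine (mul_pos (Finset.prod_pos fun i _ => hb2 _ ?_) hx2).ne'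
    have := norm_le_pi_norm (W x0) i
    rw [Real.norm_eq_abs] at this
    linarith

end

/-- the Hermitian matrix with real coordinates `A` -/
def Hm {n : ℕ} : (Fin n × Fin n → ℝ) →ₗ[ℝ] Matrix (Fin n) (Fin n) ℂ where
  toFun A := Matrix.of fun i j => (⟨(A (i,j) + A (j,i)) / 2, (A (i,j) - A (j,i)) / 2⟩ : ℂ)
  map_add' A B := by
    ext i j
    apply Complex.ext <;> simp <;> ring
  map_smul' c A := by
    ext i j
    apply Complex.ext <;> simp <;> ring

/-- the real coordinates of a matrix, a left inverse of `Hm` -/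
def rh {n : ℕ} : Matrix (Fin n) (Fin n) ℂ →ₗ[ℝ] (Fin n × Fin n → ℝ) where
  toFun M := fun ij => (M ij.1 ij.2).re + (M ij.1 ij.2).im
  map_add' A B := by
    ext ij
    simp; ring
  map_smul' c A := by
    ext ij
    simp; ring

theorem rh_apply {n : ℕ} (M : Matrix (Fin n) (Fin n) ℂ) (i j : Fin n) :
    rh M (i,j) = (M i j).re + (M i j).im := rfl

theorem Hm_apply {n : ℕ} (A : Fin n × Fin n → ℝ) (i j : Fin n) :
    Hm A i j = (⟨(A (i,j) + A (j,i)) / 2, (A (i,j) - A (j,i)) / 2⟩ : ℂ) := rfl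

theorem rh_Hm {n : ℕ} (A : Fin n × Fin n → ℝ) : rh (Hm A) = A := by
  ext ⟨i, j⟩
  rw [rh_apply, Hm_apply]
  simp; ring

theorem Hm_herm {n : ℕ} (A : Fin n × Fin n → ℝ) : (Hm A)ᴴ = Hm A := by
  ext i j
  rw [Matrix.conjTranspose_apply, Hm_apply, Hm_apply]
  apply Complex.ext <;> simp <;> ring

theorem Hm_rh {n : ℕ} (M : Matrix (Fin n) (Fin n) ℂ) (hM : Mᴴ = M) : Hm (rh M) = M := by
  ext i j
  rw [Hm_apply, rh_apply, rh_apply]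
  have h : star (M j i) = M i j := by
    rw [← Matrix.conjTranspose_apply, hM]
  rw [← h]
  apply Complex.ext <;> simp <;> ring

theorem spectral {n : ℕ} (h : Matrix (Fin n) (Fin n) ℂ) (hh : hᴴ = h) :
    ∃ (U : Matrix (Fin n) (Fin n) ℂ) (l : Fin n → ℝ), U * Uᴴ = 1 ∧ Uᴴ * U = 1 ∧
      h = U * Matrix.diagonal (fun i => (l i : ℂ)) * Uᴴ := by
  have hA : h.IsHermitian := hh
  refine ⟨hA.eigenvectorUnitary, hA.eigenvalues, ?_, ?_, ?_⟩
  · exact (Matrix.mem_unitaryGroup_iff).1 hA.eigenvectorUnitary.2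
  · exact (Matrix.mem_unitaryGroup_iff').1 hA.eigenvectorUnitary.2
  · conv_lhs => rw [hA.spectral_theorem]
    rw [Unitary.conjStarAlgAut_apply]
    rfl

/-- derivative of `h ↦ h^3 - h` -/
def cub {n : ℕ} (h k : Matrix (Fin n) (Fin n) ℂ) : Matrix (Fin n) (Fin n) ℂ :=
  k * h * h + h * k * h + h * h * k - k

def Lop {n : ℕ} (h : Matrix (Fin n) (Fin n) ℂ) : (Fin n × Fin n → ℝ) →ₗ[ℝ] (Fin n × Fin n → ℝ) where
  toFun A := rh (cub h (Hm A))
  map_add' A B := by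
    rw [← map_add, map_add Hm]; congr 1; simp only [cub]; noncomm_ring
  map_smul' c A := by
    rw [RingHom.id_apply, ← map_smul, map_smul Hm]; congr 1; simp only [cub]
    simp only [smul_mul_assoc, mul_smul_comm, smul_add, smul_sub]

def Cop {n : ℕ} (U : Matrix (Fin n) (Fin n) ℂ) : (Fin n × Fin n → ℝ) →ₗ[ℝ] (Fin n × Fin n → ℝ) where
  toFun A := rh (U * Hm A * Uᴴ)
  map_add' A B := by
    rw [← map_add, map_add Hm]; congr 1; noncomm_ring
  map_smul' c A := by
    rw [RingHom.id_apply, ← map_smul, map_smul Hm]; congr 1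
    simp only [smul_mul_assoc, mul_smul_comm]

theorem Hm_Cop {n : ℕ} (U : Matrix (Fin n) (Fin n) ℂ) (A) : Hm (Cop U A) = U * Hm A * Uᴴ := by
  apply Hm_rh
  simp [Matrix.conjTranspose_mul, Hm_herm, mul_assoc]

theorem Hm_Lop {n : ℕ} (h : Matrix (Fin n) (Fin n) ℂ) (hh : hᴴ = h) (A) : Hm (Lop h A) = cub h (Hm A) := by
  apply Hm_rh
  simp only [cub, Matrix.conjTranspose_sub, Matrix.conjTranspose_add, Matrix.conjTranspose_mul, Hm_herm, hh]
  noncomm_ring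

theorem Hm_inj {n : ℕ} {A B : Fin n × Fin n → ℝ} (h : Hm A = Hm B) : A = B := by
  rw [← rh_Hm A, h, rh_Hm]

theorem det_Lop_diag {n : ℕ} (l : Fin n → ℝ) :
    LinearMap.det (Lop (Matrix.diagonal (fun i => (l i : ℂ)))) =
      ∏ ij : Fin n × Fin n, (l ij.1 ^ 2 + l ij.1 * l ij.2 + l ij.2 ^ 2 - 1) := by
  have : Lop (Matrix.diagonal (fun i => (l i : ℂ))) = LinearMap.pi fun ij : Fin n × Fin n =>
      ((l ij.1 ^ 2 + l ij.1 * l ij.2 + l ij.2 ^ 2 - 1) • (LinearMap.id : ℝ →ₗ[ℝ] ℝ)).comp (LinearMap.proj ij) := by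
    apply LinearMap.ext
    intro A
    funext ⟨i, j⟩
    have : cub (Matrix.diagonal (fun i => (l i : ℂ))) (Hm A) i j =
        ((l i ^ 2 + l i * l j + l j ^ 2 - 1 : ℝ) : ℂ) * Hm A i j := by
      simp [cub]; ring
    show rh (cub _ (Hm A)) (i,j) = _
    rw [rh_apply, this, Hm_apply, Complex.re_ofReal_mul, Complex.im_ofReal_mul]
    simp
    ring
  rw [this, LinearMap.det_pi]
  simp

theorem det_Lop {n : ℕ} (U : Matrix (Fin n) (Fin n) ℂ) (l : Fin n → ℝ) (h1 : U * Uᴴ = 1) (h2 : Uᴴ * U = 1) :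
    LinearMap.det (Lop (U * Matrix.diagonal (fun i => (l i : ℂ)) * Uᴴ)) =
      ∏ ij : Fin n × Fin n, (l ij.1 ^ 2 + l ij.1 * l ij.2 + l ij.2 ^ 2 - 1) := by
  rw [← det_Lop_diag]
  generalize hD : Matrix.diagonal (fun i => (l i : ℂ)) = D
  have hDh : Dᴴ = D := by
    rw [← hD, Matrix.diagonal_conjTranspose]; congr 1; ext i; simp
  have hUh : (U * D * Uᴴ)ᴴ = U * D * Uᴴ := by
    simp [Matrix.conjTranspose_mul, hDh, mul_assoc]
  have e1 : Cop U ∘ₗ Cop Uᴴ = LinearMap.id := by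
    refine LinearMap.ext fun A => ?_
    refine Hm_inj ?_
    show Hm (Cop U (Cop Uᴴ A)) = _
    rw [Hm_Cop, Hm_Cop, Matrix.conjTranspose_conjTranspose]
    calc U * (Uᴴ * Hm A * U) * Uᴴ = (U * Uᴴ) * Hm A * (U * Uᴴ) := by noncomm_ring
      _ = _ := by rw [h1]; simp
  have e2 : Lop (U * D * Uᴴ) ∘ₗ Cop U = Cop U ∘ₗ Lop D := by
    refine LinearMap.ext fun A => ?_
    refine Hm_inj ?_
    rw [LinearMap.comp_apply, LinearMap.comp_apply]
    change Hm (Lop _ (Cop U A)) = Hm (Cop U (Lop D A))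
    rw [Hm_Lop _ hUh, Hm_Cop, Hm_Cop, Hm_Lop _ hDh]
    have c1 : ∀ X Y : Matrix (Fin n) (Fin n) ℂ, (U * X * Uᴴ) * (U * Y * Uᴴ) = U * (X * Y) * Uᴴ := by
      intro X Y
      calc (U * X * Uᴴ) * (U * Y * Uᴴ) = U * X * (Uᴴ * U) * Y * Uᴴ := by noncomm_ring
        _ = _ := by rw [h2]; noncomm_ring
    simp only [cub, c1]
    simp only [Matrix.mul_add, Matrix.add_mul, Matrix.mul_sub, Matrix.sub_mul]
  have d1 := congrArg LinearMap.det e1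
  have d2 := congrArg LinearMap.det e2
  rw [LinearMap.det_comp, LinearMap.det_id] at d1
  rw [LinearMap.det_comp, LinearMap.det_comp, mul_comm] at d2
  exact mul_left_cancel₀ (left_ne_zero_of_mul_eq_one d1) d2

theorem prod_sym_nonneg {n : ℕ} (m : Fin n → Fin n → ℝ) (hs : ∀ i j, m i j = m j i) (hd : 0 ≤ ∏ i, m i i) :
    0 ≤ ∏ ij : Fin n × Fin n, m ij.1 ij.2 := by
  have h1 : ∏ ij : Fin n × Fin n, m ij.1 ij.2 =
     (∏ ij : Fin n × Fin n, if ij.1 = ij.2 then m ij.1 ij.2 else 1) *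
     ((∏ ij : Fin n × Fin n, if ij.1 < ij.2 then m ij.1 ij.2 else 1) *
      (∏ ij : Fin n × Fin n, if ij.2 < ij.1 then m ij.1 ij.2 else 1)) := by
    rw [← Finset.prod_mul_distrib, ← Finset.prod_mul_distrib]
    apply Finset.prod_congr rfl
    rintro ⟨i, j⟩ _
    rcases lt_trichotomy i j with h | h | h
    · simp [h, h.ne, h.not_gt]
    · simp [h]
    · simp [h, h.ne', h.not_gt]
  have h2 : (∏ ij : Fin n × Fin n, if ij.2 < ij.1 then m ij.1 ij.2 else 1) =
      (∏ ij : Fin n × Fin n, if ij.1 < ij.2 then m ij.1 ij.2 else 1) := by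
    apply Fintype.prod_equiv (Equiv.prodComm _ _)
    rintro ⟨i, j⟩
    simp only [Equiv.prodComm_apply, Prod.swap_prod_mk, hs i j]
    by_cases h : j < i <;> simp [h]
  have h3 : (∏ ij : Fin n × Fin n, if ij.1 = ij.2 then m ij.1 ij.2 else 1) = ∏ i, m i i := by
    rw [Fintype.prod_prod_type]
    simp
  rw [h1, h2, h3]
  exact mul_nonneg hd (mul_self_nonneg _)

theorem det_Lop_nonneg {n : ℕ} (h : Matrix (Fin n) (Fin n) ℂ) (hh : hᴴ = h)
    (hp : 0 < (3 * (h * h) - 1 : Matrix (Fin n) (Fin n) ℂ).det.re) : 0 ≤ LinearMap.det (Lop h) := by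
  obtain ⟨U, l, h1, h2, rfl⟩ := spectral h hh
  rw [det_Lop U l h1 h2]
  apply prod_sym_nonneg (fun i j => l i ^ 2 + l i * l j + l j ^ 2 - 1)
  · intro i j; ring
  set D := Matrix.diagonal (fun i => (l i : ℂ)) with hD
  have e : (3 * ((U * D * Uᴴ) * (U * D * Uᴴ)) - 1 : Matrix (Fin n) (Fin n) ℂ) =
     U * (3 * (D * D) - 1) * Uᴴ := by
    calc (3 * ((U * D * Uᴴ) * (U * D * Uᴴ)) - 1 : Matrix (Fin n) (Fin n) ℂ)
       = 3 * (U * D * (Uᴴ * U) * D * Uᴴ) - U * Uᴴ := by rw [h1]; noncomm_ring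
      _ = _ := by rw [h2]; noncomm_ring
  have e2 : (3 * (D * D) - 1 : Matrix (Fin n) (Fin n) ℂ) =
      Matrix.diagonal (fun i => ((l i ^ 2 + l i * l i + l i ^ 2 - 1 : ℝ) : ℂ)) := by
    have : (3 : Matrix (Fin n) (Fin n) ℂ) = Matrix.diagonal (fun _ => 3) := rfl
    rw [hD, Matrix.diagonal_mul_diagonal, this, Matrix.diagonal_mul_diagonal, ← Matrix.diagonal_one, Matrix.diagonal_sub]
    congr 1; ext i; push_cast; ring
  have hU : U.det * Uᴴ.det = 1 := by rw [← Matrix.det_mul, h1, Matrix.det_one]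
  rw [e, Matrix.det_mul, Matrix.det_mul, mul_right_comm, hU, one_mul, e2, Matrix.det_diagonal,
    ← Complex.ofReal_prod, Complex.ofReal_re] at hp
  exact hp.le

theorem normSq_entry_le {n : ℕ} (M : Matrix (Fin n) (Fin n) ℂ) (i j : Fin n) :
    Complex.normSq (M i j) ≤ ((M * Mᴴ) i i).re := by
  rw [Matrix.mul_apply, Complex.re_sum]
  have : ∀ k, (M i k * Mᴴ k i).re = Complex.normSq (M i k) := by
    intro k
    rw [Matrix.conjTranspose_apply, Complex.star_def, Complex.mul_conj, Complex.ofReal_re]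
  simp only [this]
  exact Finset.single_le_sum (f := fun k => Complex.normSq (M i k)) (fun k _ => Complex.normSq_nonneg _)
    (Finset.mem_univ j)

theorem abs_re_im_le {z : ℂ} {C : ℝ} (hC : 0 ≤ C) (h : Complex.normSq z ≤ C ^ 2) : |z.re + z.im| ≤ 2 * C := by
  have h1 : ‖z‖ ≤ C := by
    rw [← Complex.sq_norm] at h
    exact abs_le_of_sq_le_sq' h hC |>.2
  have := Complex.abs_re_le_norm z
  have := Complex.abs_im_le_norm z
  calc |z.re + z.im| ≤ |z.re| + |z.im| := abs_add_le _ _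
    _ ≤ 2 * C := by linarith

theorem hm_continuous {n : ℕ} : Continuous (Hm (n := n)) :=
  LinearMap.continuous_of_finiteDimensional _

theorem rh_continuous {n : ℕ} : Continuous (rh (n := n)) :=
  LinearMap.continuous_of_finiteDimensional _

/-- the Hermitian involutions of signature `(p,q)` -/
def Grass (n : ℕ) (c : ℂ) : Set (Fin n × Fin n → ℝ) := {A | Hm A * Hm A = 1 ∧ (Hm A).trace = c}

theorem Grass_compact (n : ℕ) (c : ℂ) : IsCompact (Grass n c) := by
  have hc := hm_continuous (n := n)
  apply Metric.isCompact_of_isClosed_isBounded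
  · apply IsClosed.inter
    · exact isClosed_eq (hc.mul hc) continuous_const
    · exact isClosed_eq hc.matrix_trace continuous_const
  · rw [isBounded_iff_forall_norm_le]
    refine ⟨2, fun A hA => ?_⟩
    rw [pi_norm_le_iff_of_nonneg (by norm_num)]
    rintro ⟨i, j⟩
    have h1 := normSq_entry_le (Hm A) i j
    rw [Hm_herm, hA.1, Matrix.one_apply_eq, Complex.one_re] at h1
    have h2 := abs_re_im_le (C := 1) (by norm_num) (by simpa using h1)
    rw [← rh_apply, rh_Hm] at h2
    simpa using h2

section
attribute [local instance] Matrix.linftyOpNormedRing Matrix.linftyOpNormedAlgebra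

theorem Hm_contDiff {n : ℕ} : ContDiff ℝ 1 (Hm (n := n)) :=
  (LinearMap.toContinuousLinearMap (Hm (n := n))).contDiff

theorem rh_contDiff {n : ℕ} : ContDiff ℝ 1 (rh (n := n)) :=
  (LinearMap.toContinuousLinearMap (rh (n := n))).contDiff

theorem W0_contDiff {n : ℕ} : ContDiff ℝ 1 (fun A : Fin n × Fin n → ℝ => rh (Hm A * Hm A * Hm A - Hm A)) :=
  rh_contDiff.comp (((Hm_contDiff.mul Hm_contDiff).mul Hm_contDiff).sub Hm_contDiff)

theorem g_contDiff {n : ℕ} (F : (Fin n × Fin n → ℝ) → (Fin n × Fin n → ℝ)) (hF : ContDiff ℝ 1 F) :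
    ContDiff ℝ 1 (fun A : Fin n × Fin n → ℝ => rh (Complex.I • (Hm A * Hm (F A) - Hm (F A) * Hm A))) := by
  have h1 := (Hm_contDiff (n := n)).comp hF
  have h2 := ((Hm_contDiff (n := n)).mul h1).sub (h1.mul Hm_contDiff)
  have h3 : ContDiff ℝ 1 (fun M : Matrix (Fin n) (Fin n) ℂ => rh (Complex.I • M)) :=
    (LinearMap.toContinuousLinearMap
      ((rh (n := n)).comp (LinearMap.lsmul ℂ (Matrix (Fin n) (Fin n) ℂ) Complex.I |>.restrictScalars ℝ))).contDiff
  exact h3.comp h2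

theorem W0_hasFDerivAt {n : ℕ} (A : Fin n × Fin n → ℝ) :
    HasFDerivAt (fun A : Fin n × Fin n → ℝ => rh (Hm A * Hm A * Hm A - Hm A))
      (LinearMap.toContinuousLinearMap (Lop (Hm A))) A := by
  have h0 : HasFDerivAt (fun A => Hm (n := n) A) (LinearMap.toContinuousLinearMap (Hm (n := n))) A :=
    (LinearMap.toContinuousLinearMap (Hm (n := n))).hasFDerivAt
  have h1 := ((h0.mul' h0).mul' h0).sub h0
  have h2 := (LinearMap.toContinuousLinearMap (rh (n := n))).hasFDerivAt.comp A h1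
  refine h2.congr_fderiv ?_
  refine ContinuousLinearMap.ext fun k => ?_
  change rh _ = rh _
  congr 1
  change Hm A * Hm A * Hm k + (Hm A * Hm k + Hm k * Hm A) * Hm A - Hm k = cub _ _
  simp only [cub]
  noncomm_ring
end

theorem trace_comm_zero {n : ℕ} (h f : Matrix (Fin n) (Fin n) ℂ) :
    ((h * h * h - h) * (h * f - f * h)).trace = 0 := by
  have e : (h * h * h - h) * (h * f - f * h) = h * ((h * h * h - h) * f) - (h * h * h - h) * f * h := by
    noncomm_ring
  rw [e, Matrix.trace_sub, Matrix.trace_mul_comm, sub_self]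

theorem sum_sq_one {n : ℕ} (A : Fin n × Fin n → ℝ) (hA : Hm A * Hm A = 1) :
    ∃ m : ℤ, (Hm A).trace = m := by
  obtain ⟨U, l, h1, h2, h3⟩ := spectral (Hm A) (Hm_herm A)
  have hD : (Matrix.diagonal (fun i => (l i : ℂ))) * (Matrix.diagonal (fun i => (l i : ℂ))) = 1 := by
    rw [h3] at hA
    generalize Matrix.diagonal (fun i => (l i : ℂ)) = D at *
    calc D * D = (Uᴴ * U) * D * (Uᴴ * U) * D * (Uᴴ * U) := by rw [h2]; simp
      _ = Uᴴ * (U * D * Uᴴ * (U * D * Uᴴ)) * U := by simp only [mul_assoc]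
      _ = 1 := by rw [hA]; simp [h2]
  have hl : ∀ i, ∃ m : ℤ, l i = m := by
    intro i
    have := congrFun (congrFun hD i) i
    rw [Matrix.diagonal_mul_diagonal, Matrix.diagonal_apply_eq, Matrix.one_apply_eq] at this
    have h5 : l i * l i = 1 := by exact_mod_cast this
    rcases mul_self_eq_one_iff.1 h5 with h | h
    · exact ⟨1, by simp [h]⟩
    · exact ⟨-1, by simp [h]⟩
  choose m hm using hl
  refine ⟨∑ i, m i, ?_⟩
  rw [h3, Matrix.trace_mul_comm, ← mul_assoc, h2, one_mul, Matrix.trace_diagonal]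
  push_cast
  apply Finset.sum_congr rfl
  intro i _
  rw [hm]; simp

theorem formMatC_eq (p q : ℕ) : formMatC p q =
    Matrix.diagonal (fun i : Fin (p+q) => (((if (i : ℕ) < p then 1 else -1 : ℝ)) : ℂ)) := by
  unfold formMatC
  congr 1
  ext i
  split_ifs <;> simp

theorem formMatC_sq (p q : ℕ) : formMatC p q * formMatC p q = 1 := by
  unfold formMatC
  rw [Matrix.diagonal_mul_diagonal, ← Matrix.diagonal_one]
  congr 1
  ext i
  split_ifs <;> simp

theorem formMatC_herm (p q : ℕ) : (formMatC p q)ᴴ = formMatC p q := by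
  unfold formMatC
  rw [Matrix.diagonal_conjTranspose]
  congr 1
  ext i
  simp only [Pi.star_apply]
  split_ifs <;> simp

theorem formMatC_trace (p q : ℕ) : (formMatC p q).trace = (p : ℂ) - q := by
  unfold formMatC
  rw [Matrix.trace_diagonal, Fin.sum_univ_add]
  simp
  ring

theorem commute_exists (p q : ℕ) (hp : 1 ≤ p) (F : (Fin (p+q) × Fin (p+q) → ℝ) → (Fin (p+q) × Fin (p+q) → ℝ))
    (hF : ContDiff ℝ 1 F) :
    ∃ A ∈ Grass (p+q) ((p : ℂ) - q), Hm A * Hm (F A) = Hm (F A) * Hm A := by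
  by_contra hcon
  push Not at hcon
  let W0 : (Fin (p+q) × Fin (p+q) → ℝ) → (Fin (p+q) × Fin (p+q) → ℝ) :=
    fun A => rh (Hm A * Hm A * Hm A - Hm A)
  let g : (Fin (p+q) × Fin (p+q) → ℝ) → (Fin (p+q) × Fin (p+q) → ℝ) :=
    fun A => rh (Complex.I • (Hm A * Hm (F A) - Hm (F A) * Hm A))
  have hW0 : ContDiff ℝ 1 W0 := W0_contDiff
  have hg : ContDiff ℝ 1 g := g_contDiff F hF
  have hHg : ∀ A, Hm (g A) = Complex.I • (Hm A * Hm (F A) - Hm (F A) * Hm A) := by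
    intro A
    apply Hm_rh
    rw [Matrix.conjTranspose_smul, Matrix.conjTranspose_sub, Matrix.conjTranspose_mul, Matrix.conjTranspose_mul,
      Hm_herm, Hm_herm]
    ext i j
    simp
    ring
  have hHW : ∀ A, Hm (W0 A) = Hm A * Hm A * Hm A - Hm A := by
    intro A
    apply Hm_rh
    simp only [Matrix.conjTranspose_sub, Matrix.conjTranspose_mul, Hm_herm]
    noncomm_ring
  have hc := hm_continuous (n := p + q)
  let N : Set (Fin (p+q) × Fin (p+q) → ℝ) :=
    {A | 0 < ((3 * (Hm A * Hm A) - 1 : Matrix (Fin (p+q)) (Fin (p+q)) ℂ).det).re ∧ (Hm A).det ≠ 0 ∧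
      |(Hm A).trace.re - ((p:ℝ) - q)| < 1 ∧ g A ≠ 0}
  have hN : IsOpen N := by
    refine IsOpen.inter ?_ (IsOpen.inter ?_ (IsOpen.inter ?_ ?_))
    · exact isOpen_lt continuous_const (Complex.continuous_re.comp
        (((continuous_const.mul (hc.mul hc)).sub continuous_const).matrix_det))
    · exact isOpen_ne_fun hc.matrix_det continuous_const
    · exact isOpen_lt ((Complex.continuous_re.comp hc.matrix_trace).sub continuous_const).abs continuous_const
    · exact isOpen_ne_fun hg.continuous continuous_const
  have hGN : Grass (p+q) ((p : ℂ) - q) ⊆ N := by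
    intro A hA
    refine ⟨?_, ?_, ?_, ?_⟩
    · rw [hA.1]
      have : (3 * 1 - 1 : Matrix (Fin (p+q)) (Fin (p+q)) ℂ) = Matrix.diagonal (fun _ => ((2:ℝ):ℂ)) := by
        have h3 : (3 : Matrix (Fin (p+q)) (Fin (p+q)) ℂ) = Matrix.diagonal (fun _ => 3) := rfl
        rw [mul_one, h3, ← Matrix.diagonal_one, Matrix.diagonal_sub]
        congr 1; ext i; norm_num
      rw [this, Matrix.det_diagonal, ← Complex.ofReal_prod, Complex.ofReal_re]
      positivity
    · intro h0
      have := congrArg Matrix.det hA.1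
      rw [Matrix.det_mul, h0] at this
      simp at this
    · rw [hA.2]; simp
    · intro h0
      apply hcon A hA
      have h1 := hHg A
      rw [h0, map_zero] at h1
      have h2 := (smul_eq_zero.1 h1.symm).resolve_left Complex.I_ne_zero
      exact sub_eq_zero.1 h2
  obtain ⟨s, hs, hGs, hsN, hscomp⟩ := exists_open_between_and_isCompact_closure
    (Grass_compact (p+q) ((p : ℂ) - q)) hN hGN
  obtain ⟨χ, hχ, hχ1, -⟩ := IsOpen.exists_contDiff_support_eq (n := 1) hs
  have : NeZero (p + q) := ⟨by omega⟩
  refine degree_lemma W0 (fun A => W0 A + χ A • g A) hW0 (hW0.add (hχ1.smul hg)) s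
    (hscomp.isBounded.subset subset_closure) ?_ ?_ ?_ ?_
  · intro x hx
    have : χ x = 0 := by
      rw [← hχ] at hx
      exact Function.notMem_support.1 hx
    simp [this]
  · intro A hA h0
    obtain ⟨-, hN2, hN3, hN4⟩ := hsN hA
    have h1 : Hm (W0 A) + (χ A) • Hm (g A) = 0 := by
      rw [← map_smul, ← map_add]
      have h0' : W0 A + χ A • g A = 0 := h0
      rw [h0', map_zero]
    have h2 : ((Hm (W0 A))ᴴ * Hm (W0 A)).trace = 0 := by
      rw [Hm_herm]
      have h3 : Hm (W0 A) * Hm (W0 A) = - (χ A • (Hm (W0 A) * Hm (g A))) := by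
        rw [← mul_smul_comm, ← mul_neg]
        congr 1
        exact eq_neg_of_add_eq_zero_left h1
      rw [h3, hHW, hHg, mul_smul_comm, Matrix.trace_neg, Matrix.trace_smul, Matrix.trace_smul, trace_comm_zero]
      simp
    have h4 : Hm (W0 A) = 0 := by
      open ComplexOrder in exact Matrix.trace_conjTranspose_mul_self_eq_zero_iff.1 h2
    have h5 : Hm A * Hm A = 1 := by
      rw [hHW] at h4
      have hu : IsUnit (Hm A) := (Matrix.isUnit_iff_isUnit_det _).2 (isUnit_iff_ne_zero.2 hN2)
      apply hu.mul_right_cancel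
      rw [one_mul]
      exact sub_eq_zero.1 h4
    have h6 : A ∈ Grass (p+q) ((p : ℂ) - q) := by
      refine ⟨h5, ?_⟩
      obtain ⟨m, hm⟩ := sum_sq_one A h5
      rw [hm] at hN3 ⊢
      have h7 : |m - ((p:ℤ) - q)| < 1 := by
        rw [Complex.intCast_re] at hN3
        exact_mod_cast hN3
      have h8 : m = (p:ℤ) - q := by
        rw [Int.abs_lt_one_iff] at h7; omega
      rw [h8]; push_cast; rfl
    have h7 : χ A ≠ 0 := by
      have : A ∈ Function.support χ := by rw [hχ]; exact hGs h6
      exact this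
    rw [h4, zero_add] at h1
    have h8 := (smul_eq_zero.1 h1).resolve_left h7
    apply hN4
    rw [← rh_Hm (g A), h8, map_zero]
  · intro A hA
    rw [(W0_hasFDerivAt A).fderiv]
    exact det_Lop_nonneg _ (Hm_herm A) (hsN hA).1
  · intro ε hε
    set A0 := rh (formMatC p q) with hA0
    have hHA0 : Hm A0 = formMatC p q := Hm_rh _ (formMatC_herm p q)
    have hA0s : A0 ∈ s := by
      apply hGs
      refine ⟨?_, ?_⟩
      · rw [hHA0, formMatC_sq]
      · rw [hHA0, formMatC_trace]
    have hW00 : W0 A0 = 0 := by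
      apply Hm_inj
      rw [hHW, hHA0, formMatC_sq, one_mul, sub_self, map_zero]
    have hcont : Continuous (fun c : ℝ => c • A0) := continuous_id.smul continuous_const
    have ev1 : ∀ᶠ c : ℝ in nhds 1, c • A0 ∈ s :=
      hcont.continuousAt.eventually (hs.mem_nhds (by simpa using hA0s))
    have ev2 : ∀ᶠ c : ℝ in nhds 1, ‖W0 (c • A0)‖ < ε := by
      apply (hW0.continuous.comp hcont).norm.continuousAt.eventually (gt_mem_nhds _)
      simpa [hW00] using hε
    have ev3 : ∀ᶠ c : ℝ in nhdsWithin 1 (Set.Ioi 1), 1 < c := self_mem_nhdsWithin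
    obtain ⟨c, hc1, hc2, hc3⟩ := (((ev1.and ev2).filter_mono nhdsWithin_le_nhds).and ev3).exists.imp
      (fun c h => (⟨h.1.1, h.1.2, h.2⟩ : _ ∧ _ ∧ _))
    refine ⟨c • A0, hc1, hc2, ?_⟩
    rw [(W0_hasFDerivAt _).fderiv]
    change 0 < LinearMap.det (Lop (Hm (c • A0)))
    have : Hm (c • A0) = Matrix.diagonal (fun i : Fin (p+q) => ((c * (if (i : ℕ) < p then 1 else -1 : ℝ) : ℝ) : ℂ)) := by
      rw [map_smul, hHA0, formMatC_eq]
      ext i j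
      by_cases hij : i = j
      · subst hij; simp only [Matrix.smul_apply, Matrix.diagonal_apply_eq, Complex.real_smul]; push_cast; rfl
      · simp [hij]
    rw [this, det_Lop_diag]
    apply Finset.prod_pos
    intro ij _
    split_ifs <;> nlinarith

/-- the Hermitian form of a matrix -/
def qf {n : ℕ} (M : Matrix (Fin n) (Fin n) ℂ) (x : Fin n → ℂ) : ℝ := (star x ⬝ᵥ M *ᵥ x).re

theorem qf_add {n : ℕ} (M N : Matrix (Fin n) (Fin n) ℂ) (x) : qf (M + N) x = qf M x + qf N x := by
  simp [qf, Matrix.add_mulVec, dotProduct_add]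

theorem qf_sub {n : ℕ} (M N : Matrix (Fin n) (Fin n) ℂ) (x) : qf (M - N) x = qf M x - qf N x := by
  simp [qf, Matrix.sub_mulVec, dotProduct_sub]

theorem qf_smul {n : ℕ} (c : ℝ) (M : Matrix (Fin n) (Fin n) ℂ) (x) : qf (c • M) x = c * qf M x := by
  simp [qf, Matrix.smul_mulVec, dotProduct_smul]

theorem qf_sum {n : ℕ} {ι : Type*} (s : Finset ι) (M : ι → Matrix (Fin n) (Fin n) ℂ) (x) :
    qf (∑ i ∈ s, M i) x = ∑ i ∈ s, qf (M i) x := by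
  classical
  induction s using Finset.induction_on with
  | empty => simp [qf]
  | insert a s ha ih => rw [Finset.sum_insert ha, Finset.sum_insert ha, qf_add, ih]

theorem qf_conj {n : ℕ} (a M : Matrix (Fin n) (Fin n) ℂ) (x) : qf (a * M * aᴴ) x = qf M (aᴴ *ᵥ x) := by
  unfold qf
  rw [Matrix.star_mulVec, Matrix.conjTranspose_conjTranspose, ← Matrix.dotProduct_mulVec, Matrix.mulVec_mulVec,
    Matrix.mulVec_mulVec]

theorem qf_diag {n : ℕ} (l : Fin n → ℝ) (x : Fin n → ℂ) :
    qf (Matrix.diagonal (fun i => (l i : ℂ))) x = ∑ i, l i * Complex.normSq (x i) := by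
  unfold qf
  simp only [dotProduct, Matrix.mulVec_diagonal, Complex.re_sum]
  apply Finset.sum_congr rfl
  intro i _
  have : star x i * ((l i : ℂ) * x i) = ((l i * Complex.normSq (x i) : ℝ) : ℂ) := by
    rw [Complex.ofReal_mul, Complex.normSq_eq_conj_mul_self, Pi.star_apply, Complex.star_def]; ring
  rw [this, Complex.ofReal_re]

theorem qf_one {n : ℕ} (x : Fin n → ℂ) : qf 1 x = ∑ i, Complex.normSq (x i) := by
  have := qf_diag (fun _ => 1) x
  simpa using this

theorem qf_one_nonneg {n : ℕ} (x : Fin n → ℂ) : 0 ≤ qf 1 x := by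
  rw [qf_one]
  exact Finset.sum_nonneg fun i _ => Complex.normSq_nonneg _

theorem qf_mul_self {n : ℕ} (a : Matrix (Fin n) (Fin n) ℂ) (x) : qf (a * aᴴ) x = qf 1 (aᴴ *ᵥ x) := by
  rw [← qf_conj, mul_one]

theorem qf_bound {n : ℕ} (M : Matrix (Fin n) (Fin n) ℂ) (K : ℝ) (hK : ∀ i j, ‖M i j‖ ≤ K) (x) :
    |qf M x| ≤ K * n * qf 1 x := by
  have h1 : |qf M x| ≤ ∑ i, ∑ j, K * ((Complex.normSq (x i) + Complex.normSq (x j)) / 2) := by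
    unfold qf
    refine (Complex.abs_re_le_norm _).trans ?_
    unfold dotProduct
    refine (norm_sum_le _ _).trans (Finset.sum_le_sum fun i _ => ?_)
    unfold Matrix.mulVec dotProduct
    rw [Finset.mul_sum]
    refine (norm_sum_le _ _).trans (Finset.sum_le_sum fun j _ => ?_)
    rw [norm_mul, norm_mul, Pi.star_apply, norm_star, Complex.normSq_eq_norm_sq, Complex.normSq_eq_norm_sq]
    have h2 := hK i j
    have h0 := (norm_nonneg _).trans h2
    calc ‖x i‖ * (‖M i j‖ * ‖x j‖) = ‖M i j‖ * (‖x i‖ * ‖x j‖) := by ring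
      _ ≤ K * (‖x i‖ * ‖x j‖) := by gcongr
      _ ≤ _ := by
        apply mul_le_mul_of_nonneg_left _ h0
        nlinarith [sq_nonneg (‖x i‖ - ‖x j‖)]
  refine h1.trans (le_of_eq ?_)
  rw [qf_one]
  simp only [← Finset.mul_sum, ← Finset.sum_div, Finset.sum_add_distrib, Finset.sum_const, Finset.card_univ,
    Fintype.card_fin, nsmul_eq_mul]
  ring

theorem Hm_norm_le {n : ℕ} (A : Fin n × Fin n → ℝ) (i j) : ‖Hm A i j‖ ≤ 2 * ‖A‖ := by
  rw [Hm_apply]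
  refine (Complex.norm_le_abs_re_add_abs_im _).trans ?_
  have h1 : |A (i,j)| ≤ ‖A‖ := norm_le_pi_norm A (i,j)
  have h2 : |A (j,i)| ≤ ‖A‖ := norm_le_pi_norm A (j,i)
  simp only [abs_div, abs_two]
  have := abs_add_le (A (i,j)) (A (j,i))
  have := abs_sub (A (i,j)) (A (j,i))
  linarith

theorem rh_norm_le {n : ℕ} (M : Matrix (Fin n) (Fin n) ℂ) (K : ℝ) (h0 : 0 ≤ K) (hK : ∀ i j, ‖M i j‖ ≤ K) :
    ‖rh M‖ ≤ 2 * K := by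
  rw [pi_norm_le_iff_of_nonneg (by linarith)]
  rintro ⟨i, j⟩
  rw [rh_apply, Real.norm_eq_abs]
  apply abs_re_im_le h0
  rw [Complex.normSq_eq_norm_sq]
  have := hK i j
  gcongr

theorem alg_bound {n : ℕ} (a b J f : Matrix (Fin n) (Fin n) ℂ) (hab : a * b = 1) (hba : b * a = 1)
    (hJ : Jᴴ = J) (hJ2 : J * J = 1) (hf : J * f = f * J) (C R : ℝ) (hR : 0 ≤ R)
    (hlow : ∀ x, qf (a * aᴴ) x ≤ qf f x) (hup : ∀ x, qf f x ≤ C * qf (a * aᴴ) x)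
    (hB : ∀ x, |qf (b * J * bᴴ) x| ≤ R * qf 1 x) (i j : Fin n) : Complex.normSq (b i j) ≤ R * C := by
  have hJ' : ∀ x, |qf J x| ≤ R * qf f x := by
    intro x
    have e : J = a * (b * J * bᴴ) * aᴴ := by
      calc J = (a * b) * J * (a * b)ᴴ := by rw [hab]; simp
        _ = _ := by rw [Matrix.conjTranspose_mul]; simp only [mul_assoc]
    calc |qf J x| = |qf (b * J * bᴴ) (aᴴ *ᵥ x)| := by rw [← qf_conj, ← e]
      _ ≤ R * qf 1 (aᴴ *ᵥ x) := hB _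
      _ = R * qf (a * aᴴ) x := by rw [qf_mul_self]
      _ ≤ _ := by have := hlow x; gcongr
  have key : ∀ x, qf 1 x ≤ R * qf f x := by
    intro x
    set P : Matrix (Fin n) (Fin n) ℂ := (1/2 : ℝ) • (1 + J) with hP
    set N : Matrix (Fin n) (Fin n) ℂ := (1/2 : ℝ) • (1 - J) with hN
    have hPh : Pᴴ = P := by simp [hP, Matrix.conjTranspose_smul, hJ]
    have hNh : Nᴴ = N := by simp [hN, Matrix.conjTranspose_smul, hJ]
    have e1 : f = P * f * Pᴴ + N * f * Nᴴ := by
      rw [hPh, hNh, hP, hN]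
      simp only [smul_mul_assoc, mul_smul_comm, smul_smul, ← smul_add]
      have : (1 + J) * f * (1 + J) + (1 - J) * f * (1 - J) = (4 : ℝ) • f := by
        have h1 : J * f * J = f := by rw [hf, mul_assoc, hJ2, mul_one]
        calc (1 + J) * f * (1 + J) + (1 - J) * f * (1 - J) = 2 • f + 2 • (J * f * J) := by noncomm_ring
          _ = _ := by rw [h1]; module
      rw [this, smul_smul]; norm_num
    have e2 : 1 = P * J * Pᴴ - N * J * Nᴴ := by
      rw [hPh, hNh, hP, hN]
      simp only [smul_mul_assoc, mul_smul_comm, smul_smul, ← smul_sub]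
      have : (1 + J) * J * (1 + J) - (1 - J) * J * (1 - J) = (4 : ℝ) • 1 := by
        calc (1 + J) * J * (1 + J) - (1 - J) * J * (1 - J) = 4 • (J * J) := by noncomm_ring
          _ = _ := by rw [hJ2]; module
      rw [this, smul_smul]; norm_num
    have h1 : qf 1 x = qf J (Pᴴ *ᵥ x) - qf J (Nᴴ *ᵥ x) := by
      rw [← qf_conj, ← qf_conj, ← qf_sub, ← e2]
    have h2 : qf f x = qf f (Pᴴ *ᵥ x) + qf f (Nᴴ *ᵥ x) := by
      rw [← qf_conj, ← qf_conj, ← qf_add, ← e1]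
    have h3 := (abs_le.1 (hJ' (Pᴴ *ᵥ x))).2
    have h4 := (abs_le.1 (hJ' (Nᴴ *ᵥ x))).1
    rw [h1, h2]; linarith
  have key2 : ∀ x, qf 1 x ≤ R * C * qf 1 (aᴴ *ᵥ x) := by
    intro x
    rw [← qf_mul_self, mul_assoc]
    refine (key x).trans ?_
    have := hup x
    gcongr
  have h5 := key2 (bᴴ *ᵥ Pi.single i 1)
  rw [Matrix.mulVec_mulVec, ← Matrix.conjTranspose_mul, hba, Matrix.conjTranspose_one, Matrix.one_mulVec] at h5
  have h6 : qf 1 (Pi.single i (1:ℂ)) = 1 := by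
    rw [qf_one, Finset.sum_eq_single i]
    · simp
    · intro k _ hk; simp [hk]
    · simp
  rw [h6, mul_one] at h5
  refine le_trans ?_ h5
  rw [qf_one]
  have h7 : Complex.normSq (b i j) = Complex.normSq ((bᴴ *ᵥ Pi.single i 1) j) := by
    rw [Matrix.mulVec_single_one, Matrix.col_apply, Matrix.conjTranspose_apply, Complex.star_def,
      Complex.normSq_conj]
  rw [h7]
  exact Finset.single_le_sum (f := fun k => Complex.normSq ((bᴴ *ᵥ Pi.single i 1) k))
    (fun k _ => Complex.normSq_nonneg _) (Finset.mem_univ j)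

theorem sylvester_le {n : ℕ} (l m : Fin n → ℝ) (B : Matrix (Fin n) (Fin n) ℂ)
    (h : Matrix.diagonal (fun i => (l i : ℂ)) = B * Matrix.diagonal (fun i => (m i : ℂ)) * Bᴴ) :
    Fintype.card {i // 0 < l i} ≤ Fintype.card {i // 0 < m i} := by
  classical
  let E : ({i // 0 < l i} → ℂ) →ₗ[ℂ] (Fin n → ℂ) :=
    Function.ExtendByZero.linearMap ℂ (Subtype.val : {i // 0 < l i} → Fin n)
  let f : ({i // 0 < l i} → ℂ) →ₗ[ℂ] ({i // 0 < m i} → ℂ) :=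
    LinearMap.funLeft ℂ ℂ (Subtype.val : {i // 0 < m i} → Fin n) ∘ₗ Matrix.toLin' Bᴴ ∘ₗ E
  have hf : Function.Injective f := by
    rw [← LinearMap.ker_eq_bot, LinearMap.ker_eq_bot']
    intro v hv
    set x : Fin n → ℂ := E v with hx
    have h1 : ∀ i, 0 < m i → (Bᴴ *ᵥ x) i = 0 := fun i hi => congrFun hv ⟨i, hi⟩
    have h2 : qf (Matrix.diagonal (fun i => (l i : ℂ))) x ≤ 0 := by
      rw [h, qf_conj, qf_diag]
      apply Finset.sum_nonpos
      intro i _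
      by_cases hi : 0 < m i
      · simp [h1 i hi]
      · exact mul_nonpos_of_nonpos_of_nonneg (not_lt.1 hi) (Complex.normSq_nonneg _)
    have hxi : ∀ i : {i // 0 < l i}, x i = v i := fun i => by
      rw [hx]
      exact Subtype.val_injective.extend_apply v 0 i
    have hx0 : ∀ i, ¬ 0 < l i → x i = 0 := fun i hi => by
      rw [hx]
      apply Function.extend_apply'
      rintro ⟨a, rfl⟩
      exact hi a.2
    rw [qf_diag] at h2
    have h3 : ∀ i ∈ Finset.univ, 0 ≤ l i * Complex.normSq (x i) := by
      intro i _
      by_cases hi : 0 < l i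
      · exact mul_nonneg hi.le (Complex.normSq_nonneg _)
      · simp [hx0 i hi]
    have h4 := (Finset.sum_eq_zero_iff_of_nonneg h3).1 (le_antisymm h2 (Finset.sum_nonneg h3))
    ext i
    have h5 := h4 i (Finset.mem_univ _)
    rw [hxi] at h5
    exact Complex.normSq_eq_zero.1 ((mul_eq_zero.1 h5).resolve_left i.2.ne')
  have := LinearMap.finrank_le_finrank_of_injective hf
  simpa using this

theorem card_lt_p (p q : ℕ) : Fintype.card {i : Fin (p+q) // (i:ℕ) < p} = p := by
  let e : {i : Fin (p+q) // (i:ℕ) < p} ≃ Fin p :=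
    { toFun := fun i => ⟨i.1, i.2⟩
      invFun := fun i => ⟨⟨i.1, by omega⟩, i.2⟩
      left_inv := fun i => rfl
      right_inv := fun i => rfl }
  rw [Fintype.card_congr e, Fintype.card_fin]

theorem norm_det_form (p q : ℕ) : ‖(formMatC p q).det‖ = 1 := by
  have h := congrArg Matrix.det (formMatC_sq p q)
  rw [Matrix.det_mul, Matrix.det_one] at h
  have h2 := congrArg norm h
  rw [norm_mul, norm_one] at h2
  rcases mul_self_eq_one_iff.1 h2 with h3 | h3
  · exact h3
  · have := norm_nonneg (formMatC p q).det
    linarith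

theorem normal_form (p q : ℕ) (hp : 1 ≤ p) (U : Matrix (Fin (p+q)) (Fin (p+q)) ℂ) (l : Fin (p+q) → ℝ)
    (h1 : U * Uᴴ = 1) (hcard : Fintype.card {i // 0 < l i} = p) (hl : ∏ i, |l i| = 1) :
    ∃ y : Matrix (Fin (p+q)) (Fin (p+q)) ℂ, y.det = 1 ∧
      y * formMatC p q * yᴴ = U * Matrix.diagonal (fun i => (l i : ℂ)) * Uᴴ ∧
      ∀ i j, Complex.normSq (y i j) ≤ ∑ k, |l k| := by
  have hl0 : ∀ i, l i ≠ 0 := by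
    intro i h0
    rw [Finset.prod_eq_zero (Finset.mem_univ i) (by simp [h0])] at hl
    exact zero_ne_one hl
  let e : {i : Fin (p+q) // (i:ℕ) < p} ≃ {i // 0 < l i} :=
    Fintype.equivOfCardEq (by rw [hcard, card_lt_p])
  let σ := e.extendSubtype
  have hσ : ∀ i, l (σ i) = |l (σ i)| * (if (i:ℕ) < p then 1 else -1 : ℝ) := by
    intro i
    split_ifs with hi
    · have h := e.extendSubtype_mem i hi
      rw [abs_of_pos h, mul_one]
    · have h := not_lt.1 (e.extendSubtype_not_mem i hi)
      rw [abs_of_nonpos h]; ring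
  set D' : Matrix (Fin (p+q)) (Fin (p+q)) ℂ := Matrix.diagonal (fun i => ((√|l i| : ℝ) : ℂ)) with hD'
  set y0 := (U * D').submatrix id σ with hy0
  have hD'h : D'ᴴ = D' := by
    rw [hD', Matrix.diagonal_conjTranspose]; congr 1; ext i; simp
  have e1 : y0 * formMatC p q * y0ᴴ = U * Matrix.diagonal (fun i => (l i : ℂ)) * Uᴴ := by
    have ef : formMatC p q = (Matrix.diagonal (fun i : Fin (p+q) =>
        (((if ((σ.symm i : Fin (p+q)) : ℕ) < p then 1 else -1 : ℝ)) : ℂ))).submatrix σ σ := by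
      rw [formMatC_eq, Matrix.submatrix_diagonal_equiv]
      congr 1
      ext i
      simp
    rw [ef, hy0, Matrix.conjTranspose_submatrix, Matrix.submatrix_mul_equiv, Matrix.submatrix_mul_equiv,
      Matrix.submatrix_id_id, Matrix.conjTranspose_mul, hD'h]
    have ed : D' * Matrix.diagonal (fun i : Fin (p+q) =>
        (((if ((σ.symm i : Fin (p+q)) : ℕ) < p then 1 else -1 : ℝ)) : ℂ)) * D' =
        Matrix.diagonal (fun i => (l i : ℂ)) := by
      rw [hD', Matrix.diagonal_mul_diagonal, Matrix.diagonal_mul_diagonal]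
      congr 1
      ext i
      have := hσ (σ.symm i)
      rw [Equiv.apply_symm_apply] at this
      rw [← Complex.ofReal_mul, ← Complex.ofReal_mul]
      congr 1
      conv_rhs => rw [this]
      rw [mul_right_comm, Real.mul_self_sqrt (abs_nonneg _)]
    rw [← ed]
    simp only [mul_assoc]
  have hUd : ‖U.det‖ * ‖Uᴴ.det‖ = 1 := by
    rw [← norm_mul, ← Matrix.det_mul, h1, Matrix.det_one, norm_one]
  have hdet : ‖y0.det‖ = 1 := by
    have h2 := congrArg (fun M => ‖Matrix.det M‖) e1
    simp only [Matrix.det_mul, norm_mul, norm_det_form, Matrix.det_diagonal, Matrix.det_conjTranspose, norm_star,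
      norm_prod, Complex.norm_real, Real.norm_eq_abs, hl] at h2
    rw [Matrix.det_conjTranspose, norm_star] at hUd
    rw [mul_one, mul_one, hUd] at h2
    rcases mul_self_eq_one_iff.1 h2 with h3 | h3
    · exact h3
    · have := norm_nonneg y0.det
      linarith
  obtain ⟨θ, hθ⟩ := IsAlgClosed.exists_pow_nat_eq (y0.det)⁻¹ (n := p + q) (by omega)
  have hθn : ‖θ‖ = 1 := by
    have := congrArg norm hθ
    rw [norm_pow, norm_inv, hdet, inv_one] at this
    exact (pow_eq_one_iff_of_nonneg (norm_nonneg _) (by omega)).1 this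
  have hθs : θ * star θ = 1 := by
    rw [Complex.star_def, Complex.mul_conj, Complex.normSq_eq_norm_sq, hθn]; simp
  refine ⟨θ • y0, ?_, ?_, ?_⟩
  · rw [Matrix.det_smul, Fintype.card_fin, hθ, inv_mul_cancel₀]
    intro h0
    rw [h0, norm_zero] at hdet
    exact zero_ne_one hdet
  · rw [← e1, Matrix.conjTranspose_smul, smul_mul_assoc, smul_mul_assoc, mul_smul_comm, smul_smul, hθs, one_smul]
  · intro i j
    have hU1 := normSq_entry_le U i (σ j)
    rw [h1, Matrix.one_apply_eq, Complex.one_re] at hU1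
    have : (θ • y0) i j = θ * (U i (σ j) * ((√|l (σ j)| : ℝ) : ℂ)) := by
      simp [hy0, hD']
    rw [this, Complex.normSq_mul, Complex.normSq_mul, Complex.normSq_eq_norm_sq θ, hθn, Complex.normSq_ofReal,
      Real.mul_self_sqrt (abs_nonneg _), one_pow, one_mul]
    calc Complex.normSq (U i (σ j)) * |l (σ j)| ≤ 1 * |l (σ j)| := by gcongr
      _ = |l (σ j)| := one_mul _
      _ ≤ _ := Finset.single_le_sum (f := fun k => |l k|) (fun k _ => abs_nonneg _) (Finset.mem_univ (σ j))

theorem nf_bounded (p q : ℕ) (hp : 1 ≤ p) (R : ℝ) : ∃ C : ℝ, ∀ x : Matrix (Fin (p+q)) (Fin (p+q)) ℂ, x.det = 1 →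
    ‖rh (x * formMatC p q * xᴴ)‖ ≤ R → ∃ y : Matrix (Fin (p+q)) (Fin (p+q)) ℂ, y.det = 1 ∧
      y * formMatC p q * yᴴ = x * formMatC p q * xᴴ ∧ ∀ i j, ‖y i j‖ ≤ C := by
  refine ⟨√(∑ k : Fin (p+q), (2 * R) * (p+q : ℕ)), fun x hx hR => ?_⟩
  have hh : (x * formMatC p q * xᴴ)ᴴ = x * formMatC p q * xᴴ := by
    simp only [Matrix.conjTranspose_mul, formMatC_herm, Matrix.conjTranspose_conjTranspose, mul_assoc]
  obtain ⟨U, l, h1, h2, h3⟩ := spectral _ hh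
  have hbd : ∀ k, |l k| ≤ (2 * R) * (p+q : ℕ) := by
    intro k
    have ed : Matrix.diagonal (fun i => (l i : ℂ)) = Uᴴ * (x * formMatC p q * xᴴ) * Uᴴᴴ := by
      rw [h3, Matrix.conjTranspose_conjTranspose]
      calc _ = (Uᴴ * U) * Matrix.diagonal (fun i => (l i : ℂ)) * (Uᴴ * U) := by rw [h2]; simp
        _ = _ := by simp only [mul_assoc]
    have e2 : qf (Matrix.diagonal (fun i => (l i : ℂ))) (Pi.single k 1) = l k := by
      rw [qf_diag, Finset.sum_eq_single k]
      · simp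
      · intro j _ hj; simp [hj]
      · simp
    have e3 : qf 1 (Uᴴᴴ *ᵥ Pi.single k 1) = 1 := by
      rw [← qf_conj, Matrix.conjTranspose_conjTranspose, mul_one, h2, qf_one, Finset.sum_eq_single k]
      · simp
      · intro j _ hj; simp [hj]
      · simp
    rw [← e2, ed, qf_conj]
    refine (qf_bound _ (2 * R) ?_ _).trans ?_
    · intro i j
      rw [← Hm_rh _ hh]
      refine (Hm_norm_le _ i j).trans ?_
      linarith
    · rw [e3, mul_one]
  have hB : Matrix.diagonal (fun i => (l i : ℂ)) =
      (Uᴴ * x) * Matrix.diagonal (fun i : Fin (p+q) => (((if (i : ℕ) < p then 1 else -1 : ℝ)) : ℂ)) * (Uᴴ * x)ᴴ := by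
    rw [← formMatC_eq, Matrix.conjTranspose_mul, Matrix.conjTranspose_conjTranspose]
    calc _ = Uᴴ * (U * Matrix.diagonal (fun i => (l i : ℂ)) * Uᴴ) * U := by
            calc _ = (Uᴴ * U) * Matrix.diagonal (fun i => (l i : ℂ)) * (Uᴴ * U) := by rw [h2]; simp
              _ = _ := by simp only [mul_assoc]
      _ = _ := by rw [← h3]; simp only [mul_assoc]
  have hxu : IsUnit x.det := by rw [hx]; exact isUnit_one
  have hB' : Matrix.diagonal (fun i : Fin (p+q) => (((if (i : ℕ) < p then 1 else -1 : ℝ)) : ℂ)) =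
      (x⁻¹ * U) * Matrix.diagonal (fun i => (l i : ℂ)) * (x⁻¹ * U)ᴴ := by
    rw [← formMatC_eq, Matrix.conjTranspose_mul]
    calc formMatC p q = (x⁻¹ * x) * formMatC p q * (x⁻¹ * x)ᴴ := by rw [Matrix.nonsing_inv_mul _ hxu]; simp
      _ = x⁻¹ * (x * formMatC p q * xᴴ) * (x⁻¹)ᴴ := by rw [Matrix.conjTranspose_mul]; simp only [mul_assoc]
      _ = _ := by rw [h3]; simp only [mul_assoc]
  have hc1 := sylvester_le _ _ _ hB
  have hc2 := sylvester_le _ _ _ hB'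
  have hc3 : Fintype.card {i : Fin (p+q) // 0 < (if (i : ℕ) < p then 1 else -1 : ℝ)} = p := by
    refine Eq.trans ?_ (card_lt_p p q)
    apply Fintype.card_congr
    apply Equiv.subtypeEquivRight
    intro i
    split_ifs with h <;> simp [h]
  have hdet : ∏ i, |l i| = 1 := by
    have h4 := congrArg (fun M => ‖Matrix.det M‖) h3
    have hUd : ‖U.det‖ * ‖Uᴴ.det‖ = 1 := by
      rw [← norm_mul, ← Matrix.det_mul, h1, Matrix.det_one, norm_one]
    simp only [Matrix.det_mul, norm_mul, norm_det_form, Matrix.det_diagonal, Matrix.det_conjTranspose, norm_star,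
      norm_prod, Complex.norm_real, Real.norm_eq_abs, hx, norm_one, mul_one] at h4 hUd
    rw [mul_right_comm, hUd, one_mul] at h4
    exact h4.symm
  obtain ⟨y, hy1, hy2, hy3⟩ := normal_form p q hp U l h1 (by omega) hdet
  refine ⟨y, hy1, by rw [hy2, h3], fun i j => ?_⟩
  apply Real.le_sqrt_of_sq_le
  rw [← Complex.normSq_eq_norm_sq]
  exact (hy3 i j).trans (Finset.sum_le_sum fun k _ => hbd k)

theorem nf_grass (p q : ℕ) (hp : 1 ≤ p) (A) (hA : A ∈ Grass (p+q) ((p:ℂ) - q)) :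
    ∃ y : Matrix (Fin (p+q)) (Fin (p+q)) ℂ, y.det = 1 ∧ y * formMatC p q * yᴴ = Hm A := by
  obtain ⟨U, l, h1, h2, h3⟩ := spectral (Hm A) (Hm_herm A)
  have hD : (Matrix.diagonal (fun i => (l i : ℂ))) * (Matrix.diagonal (fun i => (l i : ℂ))) = 1 := by
    have hA := hA.1
    rw [h3] at hA
    generalize Matrix.diagonal (fun i => (l i : ℂ)) = D at *
    calc D * D = (Uᴴ * U) * D * (Uᴴ * U) * D * (Uᴴ * U) := by rw [h2]; simp
      _ = Uᴴ * (U * D * Uᴴ * (U * D * Uᴴ)) * U := by simp only [mul_assoc]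
      _ = 1 := by rw [hA]; simp [h2]
  have hl : ∀ i, l i = 1 ∨ l i = -1 := by
    intro i
    have := congrFun (congrFun hD i) i
    rw [Matrix.diagonal_mul_diagonal, Matrix.diagonal_apply_eq, Matrix.one_apply_eq] at this
    have h5 : l i * l i = 1 := by exact_mod_cast this
    exact mul_self_eq_one_iff.1 h5
  have htr : ∑ i, l i = (p:ℝ) - q := by
    have h4 := hA.2
    rw [h3, Matrix.trace_mul_comm, ← mul_assoc, h2, one_mul, Matrix.trace_diagonal] at h4
    exact_mod_cast h4
  have hcard : Fintype.card {i // 0 < l i} = p := by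
    rw [Fintype.card_subtype]
    have h5 : ∀ i, l i = 2 * (if 0 < l i then 1 else 0) - 1 := by
      intro i
      rcases hl i with h | h <;> rw [h] <;> norm_num
    rw [Finset.sum_congr rfl (fun i _ => h5 i), Finset.sum_sub_distrib, ← Finset.mul_sum, Finset.sum_boole] at htr
    simp only [Finset.sum_const, Finset.card_univ, Fintype.card_fin, nsmul_eq_mul, mul_one] at htr
    push_cast at htr
    have : ((Finset.univ.filter (fun i => 0 < l i)).card : ℝ) = p := by linarith
    exact_mod_cast this
  obtain ⟨y, hy1, hy2, -⟩ := normal_form p q hp U l h1 hcard (by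
    apply Finset.prod_eq_one
    intro i _
    rcases hl i with h | h <;> simp [h])
  exact ⟨y, hy1, by rw [hy2, h3]⟩

/-- the underlying matrix of an element of `SL(n,ℂ)` -/
def mx {n : ℕ} (x : SLC n) : Matrix (Fin n) (Fin n) ℂ := ((x : GL (Fin n) ℂ) : Matrix (Fin n) (Fin n) ℂ)

theorem mx_mul {n : ℕ} (x y : SLC n) : mx (x * y) = mx x * mx y := rfl

theorem mx_one {n : ℕ} : mx (1 : SLC n) = 1 := rfl

theorem mx_det {n : ℕ} (x : SLC n) : (mx x).det = 1 := x.2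

theorem mx_inv_mul {n : ℕ} (x : SLC n) : mx x⁻¹ * mx x = 1 := by rw [← mx_mul, inv_mul_cancel, mx_one]

theorem mx_mul_inv {n : ℕ} (x : SLC n) : mx x * mx x⁻¹ = 1 := by rw [← mx_mul, mul_inv_cancel, mx_one]

theorem mx_continuous {n : ℕ} : Continuous (mx (n := n)) :=
  Units.continuous_val.comp continuous_subtype_val

/-- an element of `SL(n,ℂ)` from a matrix -/
def mkSL {n : ℕ} (M : Matrix (Fin n) (Fin n) ℂ) (h : M.det = 1) : SLC n :=
  ⟨⟨M, M.adjugate, by rw [Matrix.mul_adjugate, h, one_smul], by rw [Matrix.adjugate_mul, h, one_smul]⟩, h⟩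

theorem mx_mkSL {n : ℕ} (M : Matrix (Fin n) (Fin n) ℂ) (h : M.det = 1) : mx (mkSL M h) = M := rfl

theorem mkSL_mx {n : ℕ} (x : SLC n) : mkSL (mx x) (mx_det x) = x := by
  apply Subtype.ext
  apply Units.ext
  rfl

theorem compact_bdd (n : ℕ) (C : ℝ) : IsCompact {g : SLC n | ∀ i j, ‖mx g i j‖ ≤ C} := by
  let S : Set (Matrix (Fin n) (Fin n) ℂ) := {M | M.det = 1} ∩ {M | ∀ i j, ‖M i j‖ ≤ C}
  have hS : IsCompact S := by
    apply IsCompact.inter_left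
    · have : IsCompact (Set.pi Set.univ (fun _ : Fin n => Set.pi Set.univ (fun _ : Fin n =>
          Metric.closedBall (0:ℂ) C))) :=
        isCompact_univ_pi fun _ => isCompact_univ_pi fun _ => isCompact_closedBall _ _
      have e : {M : Matrix (Fin n) (Fin n) ℂ | ∀ i j, ‖M i j‖ ≤ C} = (Set.pi Set.univ
          (fun _ : Fin n => Set.pi Set.univ (fun _ : Fin n => Metric.closedBall (0:ℂ) C))) := by
        ext M
        constructor
        · intro h i _ j _
          exact mem_closedBall_zero_iff.2 (h i j)
        · intro h i j
          exact mem_closedBall_zero_iff.1 (h i trivial j trivial)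
      rw [e]
      exact this
    · exact isClosed_eq (continuous_id.matrix_det) continuous_const
  have : CompactSpace S := isCompact_iff_compactSpace.1 hS
  let f : S → SLC n := fun M => mkSL M.1 M.2.1
  have hf : Continuous f := by
    apply Continuous.subtype_mk
    rw [Units.continuous_iff]
    exact ⟨continuous_subtype_val, continuous_subtype_val.matrix_adjugate⟩
  convert isCompact_range hf
  ext g
  constructor
  · intro hg
    exact ⟨⟨mx g, mx_det g, hg⟩, mkSL_mx g⟩
  · rintro ⟨M, rfl⟩
    exact M.2.2

theorem form_flip (p q : ℕ) (A : Matrix (Fin (p+q)) (Fin (p+q)) ℂ)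
    (h : Aᴴ * formMatC p q * A = formMatC p q) : A * formMatC p q * Aᴴ = formMatC p q := by
  have h1 : (formMatC p q * Aᴴ * formMatC p q) * A = 1 := by
    rw [mul_assoc, mul_assoc, ← mul_assoc Aᴴ, h, formMatC_sq]
  have h2 := mul_eq_one_comm.1 h1
  calc A * formMatC p q * Aᴴ = A * formMatC p q * Aᴴ * (formMatC p q * formMatC p q) := by
        rw [formMatC_sq, mul_one]
    _ = (A * (formMatC p q * Aᴴ * formMatC p q)) * formMatC p q := by simp only [mul_assoc]
    _ = _ := by rw [h2, one_mul]

/-- the homogeneous space -/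
abbrev XX (p q : ℕ) : Type := (SLC (p+q)) ⧸ ((SU p q).subgroupOf (SLC (p + q)))

theorem mem_H (p q : ℕ) (x : SLC (p+q)) : x ∈ (SU p q).subgroupOf (SLC (p + q)) ↔
    mx x * formMatC p q * (mx x)ᴴ = formMatC p q := by
  rw [Subgroup.mem_subgroupOf]
  constructor
  · intro h
    exact form_flip p q _ h.2
  · intro h
    refine ⟨x.2, ?_⟩
    have := form_flip p q (mx x)ᴴ (by rw [Matrix.conjTranspose_conjTranspose]; exact h)
    rw [Matrix.conjTranspose_conjTranspose] at this
    exact this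

theorem mk_eq_iff (p q : ℕ) (x y : SLC (p+q)) : (QuotientGroup.mk x : XX p q) = QuotientGroup.mk y ↔
    mx x * formMatC p q * (mx x)ᴴ = mx y * formMatC p q * (mx y)ᴴ := by
  rw [QuotientGroup.eq, mem_H, mx_mul, Matrix.conjTranspose_mul]
  constructor
  · intro h
    conv_lhs => rw [← h]
    calc _ = (mx x * mx x⁻¹) * (mx y * formMatC p q * (mx y)ᴴ) * (mx x * mx x⁻¹)ᴴ := by
            rw [Matrix.conjTranspose_mul]; simp only [mul_assoc]
      _ = _ := by rw [mx_mul_inv]; simp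
  · intro h
    calc _ = mx x⁻¹ * (mx y * formMatC p q * (mx y)ᴴ) * (mx x⁻¹)ᴴ := by simp only [mul_assoc]
      _ = (mx x⁻¹ * mx x) * formMatC p q * (mx x⁻¹ * mx x)ᴴ := by
            rw [← h, Matrix.conjTranspose_mul]; simp only [mul_assoc]
      _ = _ := by rw [mx_inv_mul]; simp

/-- the embedding of the homogeneous space into Hermitian matrices -/
def Qm (p q : ℕ) : XX p q → (Fin (p+q) × Fin (p+q) → ℝ) :=
  Quotient.lift (fun x : SLC (p+q) => rh (mx x * formMatC p q * (mx x)ᴴ)) (by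
    intro x y h
    have h2 : (QuotientGroup.mk x : XX p q) = QuotientGroup.mk y := Quotient.sound h
    rw [mk_eq_iff] at h2
    simp only [h2])

theorem Qm_mk (p q : ℕ) (x : SLC (p+q)) :
    Qm p q (QuotientGroup.mk x) = rh (mx x * formMatC p q * (mx x)ᴴ) := rfl

theorem Hm_Qm (p q : ℕ) (x : SLC (p+q)) :
    Hm (Qm p q (QuotientGroup.mk x)) = mx x * formMatC p q * (mx x)ᴴ := by
  rw [Qm_mk]
  apply Hm_rh
  simp only [Matrix.conjTranspose_mul, formMatC_herm, Matrix.conjTranspose_conjTranspose, mul_assoc]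

theorem Qm_continuous (p q : ℕ) : Continuous (Qm p q) := by
  apply Continuous.quotient_lift
  exact rh_continuous.comp ((mx_continuous.mul continuous_const).mul mx_continuous.matrix_conjTranspose)

theorem Qm_smul (p q : ℕ) (g : SLC (p+q)) (x : XX p q) : Qm p q (g • x) = Cop (mx g) (Qm p q x) := by
  induction x using QuotientGroup.induction_on with
  | H x =>
    apply Hm_inj
    rw [MulAction.Quotient.smul_mk, smul_eq_mul, Hm_Cop, Hm_Qm, Hm_Qm, mx_mul, Matrix.conjTranspose_mul]
    simp only [mul_assoc]

theorem Qm_proper (p q : ℕ) (hp : 1 ≤ p) (R : ℝ) : IsCompact {x : XX p q | ‖Qm p q x‖ ≤ R} := by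
  obtain ⟨C, hC⟩ := nf_bounded p q hp R
  have h1 : IsCompact ((QuotientGroup.mk : SLC (p+q) → XX p q) '' {g | ∀ i j, ‖mx g i j‖ ≤ C}) :=
    (compact_bdd (p+q) C).image QuotientGroup.continuous_mk
  apply h1.of_isClosed_subset
  · exact isClosed_le (Qm_continuous p q).norm continuous_const
  · intro x
    induction x using QuotientGroup.induction_on with
    | H x =>
      intro hx
      obtain ⟨y, hy1, hy2, hy3⟩ := hC (mx x) (mx_det x) hx
      refine ⟨mkSL y hy1, hy3, ?_⟩
      rw [mk_eq_iff, mx_mkSL, hy2]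

theorem cocompact_bound (p q : ℕ) (Γ : Subgroup (SLC (p+q)))
    (hc : CompactSpace (Quotient (MulAction.orbitRel Γ (XX p q)))) :
    ∃ R : ℝ, 0 < R ∧ ∀ x : XX p q, ∃ γ : Γ, ‖Qm p q (γ⁻¹ • x)‖ < R := by
  have : ContinuousConstSMul Γ (XX p q) := ⟨fun γ => continuous_const_smul (γ : SLC (p+q))⟩
  let U : ℕ → Set (Quotient (MulAction.orbitRel Γ (XX p q))) := fun k =>
    @Quotient.mk' _ (MulAction.orbitRel Γ (XX p q)) '' {x : XX p q | ‖Qm p q x‖ < k}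
  obtain ⟨k, hk⟩ := isCompact_univ.elim_directed_cover U
    (fun k => isOpenMap_quotient_mk'_mul _ (isOpen_lt (Qm_continuous p q).norm continuous_const))
    (by
      intro y _
      induction y using Quotient.inductionOn with
      | h x =>
        obtain ⟨k, hk⟩ := exists_nat_gt ‖Qm p q x‖
        exact Set.mem_iUnion.2 ⟨k, x, hk, rfl⟩)
    (by
      apply directed_of_isDirected_le
      intro a b hab
      apply Set.image_mono
      intro x hx
      have : (a:ℝ) ≤ b := by exact_mod_cast hab
      exact lt_of_lt_of_le hx this)
  refine ⟨k + 1, by positivity, fun x => ?_⟩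
  obtain ⟨u, hu, hux⟩ := hk (Set.mem_univ (@Quotient.mk' _ (MulAction.orbitRel Γ (XX p q)) x))
  have h1 : (MulAction.orbitRel Γ (XX p q)) u x := Quotient.exact hux
  rw [MulAction.orbitRel_apply] at h1
  obtain ⟨γ, hγ⟩ := h1
  refine ⟨γ⁻¹, ?_⟩
  have hγ' : γ • x = u := hγ
  have hu' : ‖Qm p q u‖ < k := hu
  rw [inv_inv, hγ']
  linarith

theorem entry_bound {n : ℕ} (M : Matrix (Fin n) (Fin n) ℂ) : ∃ K : ℝ, 0 ≤ K ∧ ∀ i j, ‖M i j‖ ≤ K := by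
  refine ⟨∑ i, ∑ j, ‖M i j‖, Finset.sum_nonneg fun i _ => Finset.sum_nonneg fun j _ => norm_nonneg _, ?_⟩
  intro i j
  refine le_trans ?_ (Finset.single_le_sum (f := fun i => ∑ j, ‖M i j‖)
    (fun i _ => Finset.sum_nonneg fun j _ => norm_nonneg _) (Finset.mem_univ i))
  exact Finset.single_le_sum (f := fun j => ‖M i j‖) (fun j _ => norm_nonneg _) (Finset.mem_univ j)

theorem key_bound (p q : ℕ) (hp : 1 ≤ p) (Γ : Subgroup (SLC (p+q)))
    (hpd : ProperlyDiscontinuousSMul Γ (XX p q)) (R : ℝ) (hR0 : 0 < R)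
    (hR : ∀ x : XX p q, ∃ γ : Γ, ‖Qm p q (γ⁻¹ • x)‖ < R) :
    ∃ M : ℝ, ∀ g : SLC (p+q), ∃ γ : Γ, ∀ i j, Complex.normSq (mx ((γ : SLC (p+q))⁻¹ * g) i j) ≤ M := by
  classical
  have hL := Qm_proper p q hp (2 * R)
  have hΔ := hpd.finite_disjoint_inter_image hL hL
  choose K hK0 hK using fun δ : Γ => entry_bound (mx (δ : SLC (p+q)) * (mx (δ : SLC (p+q)))ᴴ)
  refine ⟨((2 * R) * (p+q : ℕ)) * ∑ δ ∈ hΔ.toFinset, K δ * (p+q : ℕ), fun g => ?_⟩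
  have hcop : ∀ U : Matrix (Fin (p+q)) (Fin (p+q)) ℂ, Continuous (Cop U) :=
    fun U => LinearMap.continuous_of_finiteDimensional _
  obtain ⟨Rg, hRg⟩ := (Grass_compact (p+q) ((p:ℂ) - q)).exists_bound_of_continuousOn (hcop (mx g)).continuousOn
  have hSf := hpd.finite_disjoint_inter_image hL (Qm_proper p q hp Rg)
  let φ : ContDiffBump (0 : Fin (p+q) × Fin (p+q) → ℝ) := ⟨R, 2 * R, hR0, by linarith⟩
  let m : Γ → Matrix (Fin (p+q)) (Fin (p+q)) ℂ := fun γ => mx (g⁻¹ * (γ : SLC (p+q))) * (mx (g⁻¹ * (γ : SLC (p+q))))ᴴ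
  have hm : ∀ γ, Hm (rh (m γ)) = m γ := fun γ => Hm_rh _ (by simp [m, Matrix.conjTranspose_mul])
  let w : Γ → (Fin (p+q) × Fin (p+q) → ℝ) → ℝ := fun γ A => φ (Cop (mx ((γ : SLC (p+q))⁻¹ * g)) A)
  let F : (Fin (p+q) × Fin (p+q) → ℝ) → (Fin (p+q) × Fin (p+q) → ℝ) := fun A =>
    ∑ γ ∈ hSf.toFinset, w γ A • rh (m γ)
  have hF : ContDiff ℝ 1 F := by
    apply ContDiff.sum
    intro γ _
    have hw : ContDiff ℝ 1 (w γ) :=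
      φ.contDiff.comp (LinearMap.toContinuousLinearMap (Cop (mx ((γ : SLC (p+q))⁻¹ * g)))).contDiff
    exact hw.smul contDiff_const
  obtain ⟨A, hA, hcomm⟩ := commute_exists p q hp F hF
  obtain ⟨k, hk1, hk2⟩ := nf_grass p q hp A hA
  let x : XX p q := QuotientGroup.mk (mkSL k hk1)
  have hx : Qm p q x = A := by
    apply Hm_inj
    rw [Hm_Qm, mx_mkSL, hk2]
  have hv : ∀ γ : Γ, Qm p q (γ⁻¹ • g • x) = Cop (mx ((γ : SLC (p+q))⁻¹ * g)) A := by
    intro γ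
    have : γ⁻¹ • g • x = ((γ : SLC (p+q))⁻¹ * g) • x := by
      rw [mul_smul]; rfl
    rw [this, Qm_smul, hx]
  have hgx : ‖Qm p q (g • x)‖ ≤ Rg := by
    rw [Qm_smul, hx]
    exact hRg A hA
  have hw0 : ∀ γ, 0 ≤ w γ A := fun γ => φ.nonneg
  have hw1 : ∀ γ, w γ A ≤ 1 := fun γ => φ.le_one
  have hwne : ∀ γ, w γ A ≠ 0 → ‖Qm p q (γ⁻¹ • g • x)‖ ≤ 2 * R := by
    intro γ h
    by_contra hcon
    apply h
    apply φ.zero_of_le_dist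
    rw [dist_zero_right, ← hv]
    exact (not_le.1 hcon).le
  obtain ⟨γ0, hγ0⟩ := hR (g • x)
  refine ⟨γ0, ?_⟩
  have hw01 : w γ0 A = 1 := by
    apply φ.one_of_mem_closedBall
    rw [mem_closedBall_zero_iff, ← hv]
    exact hγ0.le
  have hmemS : γ0 ∈ hSf.toFinset := by
    rw [Set.Finite.mem_toFinset]
    refine ⟨g • x, ⟨γ0⁻¹ • g • x, ?_, smul_inv_smul γ0 (g • x)⟩, hgx⟩
    exact (hγ0.trans (by linarith)).le
  have hqf : ∀ y, qf (Hm (F A)) y = ∑ γ ∈ hSf.toFinset, w γ A * qf (m γ) y := by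
    intro y
    rw [map_sum, qf_sum]
    apply Finset.sum_congr rfl
    intro γ _
    rw [map_smul, hm γ, qf_smul]
  have hm0 : ∀ γ y, 0 ≤ qf (m γ) y := by
    intro γ y
    rw [qf_mul_self]
    exact qf_one_nonneg _
  apply alg_bound (mx (g⁻¹ * (γ0 : SLC (p+q)))) (mx ((γ0 : SLC (p+q))⁻¹ * g)) (Hm A) (Hm (F A))
  · rw [← mx_mul]
    have : g⁻¹ * (γ0 : SLC (p+q)) * ((γ0 : SLC (p+q))⁻¹ * g) = 1 := by group
    rw [this, mx_one]
  · rw [← mx_mul]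
    have : ((γ0 : SLC (p+q))⁻¹ * g) * (g⁻¹ * (γ0 : SLC (p+q))) = 1 := by group
    rw [this, mx_one]
  · exact Hm_herm A
  · exact hA.1
  · exact hcomm
  · positivity
  · intro y
    rw [hqf]
    calc qf (m γ0) y = w γ0 A * qf (m γ0) y := by rw [hw01, one_mul]
      _ ≤ _ := Finset.single_le_sum (f := fun γ => w γ A * qf (m γ) y)
        (fun γ _ => mul_nonneg (hw0 γ) (hm0 γ y)) hmemS
  · intro y
    rw [hqf]
    have h1 : ∀ γ ∈ hSf.toFinset, w γ A * qf (m γ) y ≤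
        (if γ0⁻¹ * γ ∈ hΔ.toFinset then K (γ0⁻¹ * γ) * (p+q : ℕ) else 0) * qf (m γ0) y := by
      intro γ _
      by_cases hw : w γ A = 0
      · rw [hw, zero_mul]
        refine mul_nonneg ?_ (hm0 _ _)
        split_ifs
        · exact mul_nonneg (hK0 _) (Nat.cast_nonneg _)
        · exact le_rfl
      · have hmem : γ0⁻¹ * γ ∈ hΔ.toFinset := by
          rw [Set.Finite.mem_toFinset]
          refine ⟨γ0⁻¹ • g • x, ⟨γ⁻¹ • g • x, hwne γ hw, ?_⟩, (hγ0.trans (by linarith)).le⟩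
          change (γ0⁻¹ * γ) • γ⁻¹ • g • x = _
          rw [mul_smul, smul_inv_smul]
        rw [if_pos hmem]
        have e : m γ = mx (g⁻¹ * (γ0 : SLC (p+q))) * (mx ((γ0⁻¹ * γ : Γ) : SLC (p+q)) *
            (mx ((γ0⁻¹ * γ : Γ) : SLC (p+q)))ᴴ) * (mx (g⁻¹ * (γ0 : SLC (p+q))))ᴴ := by
          have e1 : g⁻¹ * (γ : SLC (p+q)) = (g⁻¹ * (γ0 : SLC (p+q))) * ((γ0⁻¹ * γ : Γ) : SLC (p+q)) := by
            push_cast; group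
          simp only [m]
          rw [e1, mx_mul, Matrix.conjTranspose_mul]
          simp only [mul_assoc]
        calc w γ A * qf (m γ) y ≤ 1 * qf (m γ) y := mul_le_mul_of_nonneg_right (hw1 γ) (hm0 _ _)
          _ = qf (m γ) y := one_mul _
          _ ≤ K (γ0⁻¹ * γ) * (p+q : ℕ) * qf 1 ((mx (g⁻¹ * (γ0 : SLC (p+q))))ᴴ *ᵥ y) := by
            rw [e, qf_conj]
            exact (le_abs_self _).trans (qf_bound _ _ (hK _) _)
          _ = _ := by rw [← qf_mul_self]
    refine (Finset.sum_le_sum h1).trans ?_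
    rw [← Finset.sum_mul]
    refine mul_le_mul_of_nonneg_right ?_ (hm0 _ _)
    rw [← Finset.sum_image (s := hSf.toFinset) (g := fun γ => γ0⁻¹ * γ)
      (f := fun δ => if δ ∈ hΔ.toFinset then K δ * ((p+q : ℕ) : ℝ) else 0)
      (fun a _ b _ h => mul_left_cancel h), Finset.sum_ite_mem]
    exact Finset.sum_le_sum_of_subset_of_nonneg Finset.inter_subset_right
      (fun δ _ _ => mul_nonneg (hK0 δ) (Nat.cast_nonneg _))
  · intro y
    rw [← Hm_Cop]
    apply qf_bound
    intro i j
    refine (Hm_norm_le _ i j).trans ?_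
    rw [← hv]
    linarith

theorem unipotent (p q : ℕ) (hp : 1 ≤ p) (hq : 1 ≤ q) (t : ℝ) :
    ∃ a : SLC (p+q), (QuotientGroup.mk a : XX p q) = QuotientGroup.mk 1 ∧
      t ≤ ‖mx a ⟨0, by omega⟩ ⟨0, by omega⟩‖ := by
  let i0 : Fin (p+q) := ⟨0, by omega⟩
  let i1 : Fin (p+q) := ⟨p, by omega⟩
  have h01 : i0 ≠ i1 := by
    intro h
    have := congrArg Fin.val h
    simp only [i0, i1] at this
    omega
  -- an isotropic vector as a column, and its dual row
  let v : Matrix (Fin (p+q)) (Fin 1) ℂ := Matrix.of fun i _ => if i = i0 ∨ i = i1 then 1 else 0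
  have hiso : vᴴ * formMatC p q * v = 0 := by
    ext a b
    have hf : formMatC p q * v = Matrix.of fun i _ => if i = i0 then 1 else if i = i1 then -1 else 0 := by
      ext i c
      rw [formMatC, Matrix.diagonal_mul]
      by_cases h0 : i = i0
      · subst h0
        have : 0 < p := by omega
        simp [v, i0, this]
      · by_cases h1 : i = i1
        · subst h1
          simp [v, h01.symm, i1]
        · simp [v, h0, h1]
    rw [Matrix.mul_assoc, hf, Matrix.mul_apply]
    have hterm : ∀ i, vᴴ a i * (Matrix.of fun (i : Fin (p+q)) (_ : Fin 1) =>
        if i = i0 then (1:ℂ) else if i = i1 then -1 else 0) i b =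
        (if i = i0 then 1 else 0) - (if i = i1 then 1 else 0) := by
      intro i
      by_cases h0 : i = i0
      · subst h0; simp [v, h01]
      · by_cases h1 : i = i1
        · subst h1; simp [v, h01.symm]
        · simp [v, h0, h1]
    rw [Finset.sum_congr rfl (fun i _ => hterm i), Finset.sum_sub_distrib]
    simp
  let N : Matrix (Fin (p+q)) (Fin (p+q)) ℂ := v * (vᴴ * formMatC p q)
  let c : ℂ := Complex.I * t
  have hdet : (1 + c • N).det = 1 := by
    have : c • N = (c • v) * (vᴴ * formMatC p q) := by rw [Matrix.smul_mul]
    rw [this, Matrix.det_one_add_mul_comm, Matrix.mul_smul, hiso]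
    simp
  have hform : (1 + c • N) * formMatC p q * (1 + c • N)ᴴ = formMatC p q := by
    have hc : star c = -c := by
      simp [c]
    have hNh : Nᴴ = formMatC p q * v * vᴴ := by
      simp only [N, Matrix.conjTranspose_mul, Matrix.conjTranspose_conjTranspose, formMatC_herm]
    have h1 : N * formMatC p q = v * vᴴ := by
      simp only [N]
      rw [Matrix.mul_assoc, Matrix.mul_assoc, formMatC_sq, Matrix.mul_one]
    have h2 : formMatC p q * Nᴴ = v * vᴴ := by
      rw [hNh, ← Matrix.mul_assoc, ← Matrix.mul_assoc, formMatC_sq, Matrix.one_mul]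
    have h3 : N * formMatC p q * Nᴴ = 0 := by
      rw [mul_assoc, h2]
      simp only [N]
      calc v * (vᴴ * formMatC p q) * (v * vᴴ) = v * (vᴴ * formMatC p q * v) * vᴴ := by
            simp only [Matrix.mul_assoc]
        _ = 0 := by rw [hiso]; simp
    rw [Matrix.conjTranspose_add, Matrix.conjTranspose_one, Matrix.conjTranspose_smul, hc]
    calc (1 + c • N) * formMatC p q * (1 + (-c) • Nᴴ) = formMatC p q + (-c) • (formMatC p q * Nᴴ) +
          c • (N * formMatC p q) + (c * -c) • (N * formMatC p q * Nᴴ) := by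
            simp only [add_mul, mul_add, one_mul, mul_one, smul_mul_assoc, mul_smul_comm]
            module
      _ = _ := by rw [h3, h2, h1]; simp
  refine ⟨mkSL (1 + c • N) hdet, ?_, ?_⟩
  · rw [mk_eq_iff, mx_mkSL, hform, mx_one]
    simp
  · rw [mx_mkSL]
    have hN : N i0 i0 = 1 := by
      have : 0 < p := by omega
      have e : (vᴴ * formMatC p q) 0 i0 = 1 := by
        rw [formMatC, Matrix.mul_diagonal]
        simp [v, i0, this]
      simp only [N]
      rw [Matrix.mul_apply, Finset.univ_unique, Finset.sum_singleton]
      change v i0 0 * (vᴴ * formMatC p q) 0 i0 = 1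
      rw [e]
      simp [v]
    have : (1 + c • N) i0 i0 = 1 + c := by
      rw [Matrix.add_apply, Matrix.smul_apply, hN]; simp
    change t ≤ ‖(1 + c • N) i0 i0‖
    rw [this]
    refine le_trans ?_ (Complex.abs_im_le_norm _)
    simp [c, le_abs_self]

/-- For all integers `p, q ≥ 1`, the irreducible symmetric space
`SL(p+q,ℂ)/SU(p,q)` does not admit a compact Clifford–Klein form. -/
theorem statement4 (p q : ℕ) (hp : 1 ≤ p) (hq : 1 ≤ q) :
    ¬ AdmitsCompactCliffordKleinForm ((SU p q).subgroupOf (SLC (p + q))) := by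
  rintro ⟨Γ, -, hpd, -, hcc⟩
  obtain ⟨R, hR0, hR⟩ := cocompact_bound p q Γ hcc
  obtain ⟨M, hM⟩ := key_bound p q hp Γ hpd R hR0 hR
  have hB := compact_bdd (p+q) (√M)
  have hfin := hpd.finite_disjoint_inter_image
    (hB.image (QuotientGroup.continuous_mk : Continuous (QuotientGroup.mk : SLC (p+q) → XX p q)))
    (isCompact_singleton (x := (QuotientGroup.mk 1 : XX p q)))
  have hcomp := hfin.isCompact_biUnion (f := fun γ : Γ =>
    (fun b : SLC (p+q) => (γ : SLC (p+q)) * b) '' {g : SLC (p+q) | ∀ i j, ‖mx g i j‖ ≤ √M})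
    (fun γ _ => hB.image (continuous_const.mul continuous_id))
  have hcont : Continuous (fun a : SLC (p+q) => mx a ⟨0, by omega⟩ ⟨0, by omega⟩) :=
    mx_continuous.matrix_elem _ _
  obtain ⟨C, hC⟩ := hcomp.exists_bound_of_continuousOn hcont.continuousOn
  obtain ⟨a, ha1, ha2⟩ := unipotent p q hp hq (C + 1)
  obtain ⟨γ, hγ⟩ := hM a
  have hb : (γ : SLC (p+q))⁻¹ * a ∈ {g : SLC (p+q) | ∀ i j, ‖mx g i j‖ ≤ √M} := by
    intro i j
    apply Real.le_sqrt_of_sq_le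
    rw [← Complex.normSq_eq_norm_sq]
    exact hγ i j
  have hmem := hC a (by
    refine Set.mem_biUnion (x := γ) ?_ ⟨_, hb, by simp⟩
    refine ⟨QuotientGroup.mk a, ⟨_, ⟨_, hb, rfl⟩, ?_⟩, ha1⟩
    change QuotientGroup.mk ((γ : SLC (p+q)) * ((γ : SLC (p+q))⁻¹ * a)) = QuotientGroup.mk a
    rw [mul_inv_cancel_left])
  linarith

end
end

section
/- For all integers p, q ≥ 1, the irreducible symmetric space SL(p+q,ℝ)/SO₀(p,q) does not admit a compact Clifford–Klein form; that is, there is no discrete subgroup Γ of SL(p+q,ℝ) whose left-translation action on SL(p+q,ℝ)/SO₀(p,q) is properly discontinuous and free and has compact quotient. -/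
/-! Statement 5: For all integers `p, q ≥ 1`, the irreducible symmetric space
`SL(p+q,ℝ)/SO₀(p,q)` does not admit a compact Clifford–Klein form. -/

open Matrix

noncomputable section

/-- The matrix `I_{p,q} = diag(1,…,1,−1,…,−1)` (`p` ones, `q` minus ones). -/
def formMat (p q : ℕ) : Matrix (Fin (p + q)) (Fin (p + q)) ℝ :=
  Matrix.diagonal fun i => if (i : ℕ) < p then (1 : ℝ) else -1

/-- The indefinite orthogonal group `O(p,q)`, as a subgroup of `GL(p+q, ℝ)`:
the group of matrices `A` with `Aᵀ I_{p,q} A = I_{p,q}`. -/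
def indefO (p q : ℕ) : Subgroup (GL (Fin (p + q)) ℝ) where
  carrier := {A | (A : Matrix (Fin (p + q)) (Fin (p + q)) ℝ)ᵀ * formMat p q * A = formMat p q}
  one_mem' := by simp
  mul_mem' := by
    intro a b ha hb
    have h : ((a * b : GL (Fin (p + q)) ℝ) : Matrix (Fin (p + q)) (Fin (p + q)) ℝ)ᵀ *
        formMat p q * ((a * b : GL (Fin (p + q)) ℝ) : Matrix (Fin (p + q)) (Fin (p + q)) ℝ) =
        (b : Matrix (Fin (p + q)) (Fin (p + q)) ℝ)ᵀ *
          ((a : Matrix (Fin (p + q)) (Fin (p + q)) ℝ)ᵀ * formMat p q *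
            (a : Matrix (Fin (p + q)) (Fin (p + q)) ℝ)) *
          (b : Matrix (Fin (p + q)) (Fin (p + q)) ℝ) := by
      rw [Units.val_mul, Matrix.transpose_mul]
      simp only [mul_assoc]
    show _ = _
    rw [h, ha, hb]
  inv_mem' := by
    intro a ha
    have h1 : (a : Matrix (Fin (p + q)) (Fin (p + q)) ℝ) *
        ((a⁻¹ : GL (Fin (p + q)) ℝ) : Matrix (Fin (p + q)) (Fin (p + q)) ℝ) = 1 := by
      rw [← Units.val_mul, mul_inv_cancel, Units.val_one]
    have key : ((a⁻¹ : GL (Fin (p + q)) ℝ) : Matrix (Fin (p + q)) (Fin (p + q)) ℝ)ᵀ *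
        ((a : Matrix (Fin (p + q)) (Fin (p + q)) ℝ)ᵀ * formMat p q *
          (a : Matrix (Fin (p + q)) (Fin (p + q)) ℝ)) *
        ((a⁻¹ : GL (Fin (p + q)) ℝ) : Matrix (Fin (p + q)) (Fin (p + q)) ℝ) = formMat p q := by
      have h2 : ((a⁻¹ : GL (Fin (p + q)) ℝ) : Matrix (Fin (p + q)) (Fin (p + q)) ℝ)ᵀ *
          ((a : Matrix (Fin (p + q)) (Fin (p + q)) ℝ)ᵀ * formMat p q *
            (a : Matrix (Fin (p + q)) (Fin (p + q)) ℝ)) *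
          ((a⁻¹ : GL (Fin (p + q)) ℝ) : Matrix (Fin (p + q)) (Fin (p + q)) ℝ) =
          ((a : Matrix (Fin (p + q)) (Fin (p + q)) ℝ) *
            ((a⁻¹ : GL (Fin (p + q)) ℝ) : Matrix (Fin (p + q)) (Fin (p + q)) ℝ))ᵀ *
            formMat p q *
            ((a : Matrix (Fin (p + q)) (Fin (p + q)) ℝ) *
              ((a⁻¹ : GL (Fin (p + q)) ℝ) : Matrix (Fin (p + q)) (Fin (p + q)) ℝ)) := by
        rw [Matrix.transpose_mul]
        simp only [mul_assoc]
      rw [h2, h1]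
      simp
    replace ha : (a : Matrix (Fin (p + q)) (Fin (p + q)) ℝ)ᵀ * formMat p q *
        (a : Matrix (Fin (p + q)) (Fin (p + q)) ℝ) = formMat p q := ha
    rw [ha] at key
    exact key
  
/-- `SO₀(p,q)`: the identity component of `O(p,q)`, as a subgroup of `GL(p+q,ℝ)`. -/
def SOZero (p q : ℕ) : Subgroup (GL (Fin (p + q)) ℝ) :=
  Subgroup.map (indefO p q).subtype
    (Subgroup.connectedComponentOfOne (indefO p q))

/-- The special linear group `SL(n,ℝ)`, as a subgroup of `GL(n,ℝ)`. -/
def SLR (n : ℕ) : Subgroup (GL (Fin n) ℝ) where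
  carrier := {A | (A : Matrix (Fin n) (Fin n) ℝ).det = 1}
  one_mem' := by simp
  mul_mem' := by
    intro a b ha hb
    replace ha : (a : Matrix (Fin n) (Fin n) ℝ).det = 1 := ha
    replace hb : (b : Matrix (Fin n) (Fin n) ℝ).det = 1 := hb
    show ((a * b : GL (Fin n) ℝ) : Matrix (Fin n) (Fin n) ℝ).det = 1
    rw [Units.val_mul, Matrix.det_mul, ha, hb, mul_one]
  inv_mem' := by
    intro a ha
    replace ha : (a : Matrix (Fin n) (Fin n) ℝ).det = 1 := ha
    have h1 : (a : Matrix (Fin n) (Fin n) ℝ).det *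
        ((a⁻¹ : GL (Fin n) ℝ) : Matrix (Fin n) (Fin n) ℝ).det = 1 := by
      rw [← Matrix.det_mul, ← Units.val_mul, mul_inv_cancel, Units.val_one, Matrix.det_one]
    show ((a⁻¹ : GL (Fin n) ℝ) : Matrix (Fin n) (Fin n) ℝ).det = 1
    rw [ha, one_mul] at h1
    exact h1

section
variable {ι : Type*} [Fintype ι] [DecidableEq ι]
open scoped MatrixOrder in
theorem sqrt_ex (P : Matrix ι ι ℝ) (hP : P.PosDef) :
    ∃ S : Matrix ι ι ℝ, S.PosDef ∧ S * S = P ∧ ∀ T, Commute P T → Commute S T := by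
  have h0 : 0 ≤ P := hP.posSemidef.nonneg
  refine ⟨CFC.sqrt P, ?_, CFC.sqrt_mul_sqrt_self P h0, ?_⟩
  · have h1 : (CFC.sqrt P).PosSemidef := (CFC.sqrt_nonneg P).posSemidef
    have h2 : IsUnit (CFC.sqrt P) := by
      have h3 : IsUnit (CFC.sqrt P * CFC.sqrt P) := by
        rw [CFC.sqrt_mul_sqrt_self P h0]; exact hP.isUnit
      exact isUnit_of_mul_isUnit_left h3
    exact h1.posDef_iff_isUnit.2 h2
  · intro T hT
    exact hT.cfcₙ_nnreal _

open scoped MatrixOrder in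
theorem sqrt_uniq (S T : Matrix ι ι ℝ) (hS : S.PosDef) (hT : T.PosDef) (h : S * S = T * T) : S = T := by
  have h1 := CFC.sqrt_unique h hS.posSemidef.nonneg
  have h2 := CFC.sqrt_unique (rfl : T * T = T * T) hT.posSemidef.nonneg
  exact h1.symm.trans h2
theorem posDef_conj_orth (P k : Matrix ι ι ℝ) (hP : P.PosDef) (hk : IsUnit k) : (kᵀ * P * k).PosDef := by
  have h := hP.conjTranspose_mul_mul_same (B := k) (Matrix.mulVec_injective_of_isUnit hk)
  rwa [conjTranspose_eq_transpose_of_trivial] at h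

theorem posDef_gram (h : Matrix ι ι ℝ) (hh : IsUnit h) : (hᵀ * h).PosDef := by
  have := posDef_conj_orth 1 h Matrix.PosDef.one hh
  simpa using this

theorem posDef_transpose {P : Matrix ι ι ℝ} (hP : P.PosDef) : Pᵀ = P := by
  have := hP.isHermitian
  rwa [Matrix.IsHermitian, conjTranspose_eq_transpose_of_trivial] at this

theorem posDef_inv_ex {P : Matrix ι ι ℝ} (hP : P.PosDef) :
    ∃ P' : Matrix ι ι ℝ, P'.PosDef ∧ P * P' = 1 ∧ P' * P = 1 := by
  have hu := (Matrix.isUnit_iff_isUnit_det _).1 hP.isUnit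
  exact ⟨P⁻¹, hP.inv, Matrix.mul_nonsing_inv _ hu, Matrix.nonsing_inv_mul _ hu⟩

theorem polar (J h : Matrix ι ι ℝ) (hJT : Jᵀ = J) (hJ : J * J = 1) (hh : h * J * hᵀ = J) :
    ∃ k S : Matrix ι ι ℝ, kᵀ * k = 1 ∧ S.PosDef ∧ S * J * S = J ∧ h = k * S ∧ k * J = J * k := by
  have h1 : h * (J * hᵀ * J) = 1 := by
    rw [← mul_assoc, ← mul_assoc, hh, hJ]
  have h2 : (J * hᵀ * J) * h = 1 := mul_eq_one_comm.1 h1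
  have h3 : hᵀ * J * h = J := by
    have : J * ((J * hᵀ * J) * h) = J := by rw [h2, mul_one]
    rw [← mul_assoc, ← mul_assoc, ← mul_assoc, hJ, one_mul] at this
    exact this
  have hu : IsUnit h := IsUnit.of_mul_eq_one _ h1
  have hJu : IsUnit J := IsUnit.of_mul_eq_one _ hJ
  obtain ⟨S, hS, hSS, -⟩ := sqrt_ex _ (posDef_gram h hu)
  obtain ⟨S', hS', hSS', hS'S⟩ := posDef_inv_ex hS
  have hT : (J * S' * J).PosDef := by
    have := posDef_conj_orth S' J hS' hJu
    rwa [hJT] at this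
  have hPP : S * S * (J * (S * S) * J) = 1 := by
    rw [hSS]
    calc hᵀ * h * (J * (hᵀ * h) * J) = hᵀ * (h * J * hᵀ) * h * J := by simp only [mul_assoc]
      _ = 1 := by rw [hh, h3, hJ]
  have hTT : (J * S' * J) * (J * S' * J) = S * S := by
    have e : ((J * S' * J) * (J * S' * J)) * (J * (S * S) * J) = 1 := by
      calc ((J * S' * J) * (J * S' * J)) * (J * (S * S) * J)
          = J * S' * (J * J) * S' * (J * J) * S * S * J := by simp only [mul_assoc]
        _ = J * (S' * (S' * S) * S) * J := by rw [hJ]; simp only [mul_assoc, mul_one, one_mul]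
        _ = 1 := by rw [hS'S, mul_one, hS'S, mul_one, hJ]
    have e2 := mul_eq_one_comm.1 hPP
    calc _ = ((J * S' * J) * (J * S' * J)) * ((J * (S * S) * J) * (S * S)) := by rw [e2, mul_one]
      _ = (((J * S' * J) * (J * S' * J)) * (J * (S * S) * J)) * (S * S) := by simp only [mul_assoc]
      _ = _ := by rw [e, one_mul]
  have hTS := sqrt_uniq _ _ hT hS hTT
  have hSJS : S * J * S = J := by
    calc S * J * S = (J * S' * J) * J * S := by rw [hTS]
      _ = J * S' * (J * J) * S := by simp only [mul_assoc]
      _ = J := by rw [hJ, mul_one, mul_assoc, hS'S, mul_one]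
  refine ⟨h * S', S, ?_, hS, hSJS, ?_, ?_⟩
  · rw [transpose_mul, posDef_transpose hS']
    calc S' * hᵀ * (h * S') = S' * (hᵀ * h) * S' := by simp only [mul_assoc]
      _ = (S' * S) * (S * S') := by rw [← hSS]; simp only [mul_assoc]
      _ = 1 := by rw [hSS', hS'S, mul_one]
  · rw [mul_assoc, hS'S, mul_one]
  · have e1 : S' * J = J * S := by
      calc S' * J = S' * (S * J * S) := by rw [hSJS]
        _ = (S' * S) * J * S := by simp only [mul_assoc]
        _ = _ := by rw [hS'S, one_mul]
    calc h * S' * J = h * J * S := by rw [mul_assoc, e1, mul_assoc]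
      _ = h * J * (S * S) * S' := by
          rw [mul_assoc (h * J), mul_assoc S, hSS', mul_one]
      _ = (h * J * hᵀ) * h * S' := by rw [hSS]; simp only [mul_assoc]
      _ = J * (h * S') := by rw [hh, mul_assoc]

theorem khk_sym (J S : Matrix ι ι ℝ) (hJT : Jᵀ = J) (hJ : J * J = 1) (hS : S.PosDef)
    (hSJS : S * J * S = J) (u v c d : ℝ) (hac : (u • 1 + v • J) * (c • 1 + d • J) = 1)
    (hcd : c ^ 2 - d ^ 2 ≠ 0) :
    ∃ k : Matrix ι ι ℝ, kᵀ * k = 1 ∧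
      ((u • 1 + v • J) * S * (c • 1 + d • J)) * (k * J * kᵀ) * ((u • 1 + v • J) * S * (c • 1 + d • J))ᵀ
        = J * (k * J * kᵀ) * J := by
  obtain ⟨S', hS', hSS', hS'S⟩ := posDef_inv_ex hS
  have hST := posDef_transpose hS
  have hST' := posDef_transpose hS'
  have hS'J : S' * J = J * S := by
    calc S' * J = S' * (S * J * S) := by rw [hSJS]
      _ = (S' * S) * J * S := by simp only [mul_assoc]
      _ = _ := by rw [hS'S, one_mul]
  have hSJ : S * J = J * S' := by
    calc S * J = (S * J) * (S * S') := by rw [hSS', mul_one]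
      _ = (S * J * S) * S' := by simp only [mul_assoc]
      _ = _ := by rw [hSJS]
  obtain ⟨κ, hκ⟩ : ∃ κ : ℝ, κ * (c ^ 2 - d ^ 2) = -(2 * c * d) := ⟨-(2 * c * d) / (c ^ 2 - d ^ 2), by field_simp⟩
  obtain ⟨E, hE⟩ : ∃ E : Matrix ι ι ℝ, E = (1 / 2 : ℝ) • (S + S') := ⟨_, rfl⟩
  obtain ⟨O, hO⟩ : ∃ O : Matrix ι ι ℝ, O = (1 / 2 : ℝ) • (S - S') := ⟨_, rfl⟩
  have hEP : E.PosDef := by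
    rw [hE]; exact (hS.add hS').smul (by norm_num)
  have hET := posDef_transpose hEP
  have hOT : Oᵀ = O := by rw [hO]; simp [hST, hST']
  have hEJ : E * J = J * E := by rw [hE]; simp [add_mul, mul_add, hSJ, hS'J, add_comm]
  have hOJ : O * J = -(J * O) := by rw [hO]; simp [sub_mul, mul_sub, hSJ, hS'J, ← smul_neg]
  have hEO : E * O = O * E := by
    rw [hE, hO]; simp [sub_mul, mul_sub, add_mul, mul_add, hSS', hS'S]; module
  have hES : E + O = S := by rw [hE, hO]; module
  have hES' : E - O = S' := by rw [hE, hO]; module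
  have hEEP : (E * E).PosDef := by
    have := posDef_gram E hEP.isUnit; rwa [hET] at this
  have hOOP : (κ ^ 2 • (O * O)).PosSemidef := by
    have := Matrix.posSemidef_conjTranspose_mul_self O
    rw [conjTranspose_eq_transpose_of_trivial, hOT] at this
    exact this.smul (sq_nonneg κ)
  obtain ⟨R, hRP, hRR, hRc⟩ := sqrt_ex _ (hEEP.add_posSemidef hOOP)
  have hRT := posDef_transpose hRP
  have hOOJ : (O * O) * J = J * (O * O) := by
    rw [mul_assoc, hOJ, mul_neg, ← mul_assoc, hOJ, neg_mul, neg_neg, mul_assoc]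
  have hEEJ : (E * E) * J = J * (E * E) := by
    rw [mul_assoc, hEJ, ← mul_assoc, hEJ, mul_assoc]
  have hRJ : R * J = J * R := hRc J (by
    show _ * _ = _ * _
    rw [add_mul, mul_add, smul_mul_assoc, mul_smul_comm, hEEJ, hOOJ])
  have hRE : R * E = E * R := hRc E (by
    show _ * _ = _ * _
    rw [add_mul, mul_add, smul_mul_assoc, mul_smul_comm, mul_assoc, mul_assoc, ← hEO, ← mul_assoc O, ← hEO, mul_assoc E O O])
  have hRO : R * O = O * R := hRc O (by
    show _ * _ = _ * _
    rw [add_mul, mul_add, smul_mul_assoc, mul_smul_comm, mul_assoc E, hEO, ← mul_assoc E, hEO, mul_assoc O E, mul_assoc O O O])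
  obtain ⟨R', hRP', hRR', hR'R⟩ := posDef_inv_ex hRP
  obtain ⟨W, hW⟩ : ∃ W : Matrix ι ι ℝ, W = J * E + κ • O := ⟨_, rfl⟩
  have hWT : Wᵀ = W := by rw [hW]; simp [transpose_mul, hET, hOT, hJT, hEJ]
  have hWW : W * W = R * R := by
    rw [hRR, hW]
    have e1 : J * E * (J * E) = E * E := by
      calc J * E * (J * E) = E * (J * J) * E := by rw [← hEJ]; simp only [mul_assoc]; rw [hEJ]
        _ = _ := by rw [hJ, mul_one]
    have e2 : J * E * O + O * (J * E) = 0 := by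
      rw [← mul_assoc O, hOJ, mul_assoc, hEO, neg_mul, mul_assoc]; simp
    calc (J * E + κ • O) * (J * E + κ • O)
        = J * E * (J * E) + κ • (J * E * O + O * (J * E)) + κ ^ 2 • (O * O) := by
          simp only [add_mul, mul_add, smul_mul_assoc, mul_smul_comm, smul_add, smul_smul, pow_two]
          abel
      _ = _ := by rw [e1, e2, smul_zero, add_zero]
  have hRW : R * W = W * R := by
    rw [hW, mul_add, add_mul, ← mul_assoc, hRJ, mul_assoc, hRE, mul_smul_comm, hRO, smul_mul_assoc, mul_assoc]
  obtain ⟨M, hM⟩ : ∃ M : Matrix ι ι ℝ, M = R + W * J := ⟨_, rfl⟩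
  have hMT : Mᵀ = R + J * W := by rw [hM]; simp [transpose_mul, hRT, hWT, hJT]
  have hWJ : W * J = E + κ • (O * J) := by
    rw [hW, add_mul, smul_mul_assoc, mul_assoc, hEJ, ← mul_assoc, hJ, one_mul]
  have hJW : J * W = E - κ • (O * J) := by
    rw [hW, mul_add, ← mul_assoc, hJ, one_mul, mul_smul_comm, hOJ]; simp
  have hWMJ : W * M = R * M * J := by
    rw [hM, mul_add, ← mul_assoc, hWW, mul_add, add_mul, ← hRW, mul_assoc R (W * J) J, mul_assoc W, hJ, mul_one,
      add_comm]
  have hMM : M * Mᵀ = R * R + (R * E + R * E) + R * R := by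
    rw [hMT, hM]
    have e1 : R * (J * W) + W * J * R = R * E + R * E := by
      rw [hJW, hWJ, mul_sub, add_mul, ← hRE, smul_mul_assoc, mul_smul_comm, mul_assoc O, ← hRJ, ← mul_assoc, hRO, mul_assoc]
      abel
    have e2 : W * J * (J * W) = R * R := by
      rw [mul_assoc, ← mul_assoc J, hJ, one_mul, hWW]
    calc (R + W * J) * (R + J * W) = R * R + (R * (J * W) + W * J * R) + W * J * (J * W) := by
          simp only [add_mul, mul_add]; abel
      _ = _ := by rw [e1, e2]
  have hMMP : (M * Mᵀ).PosDef := by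
    have hRRP : (R * R).PosDef := by
      have := posDef_gram R hRP.isUnit; rwa [hRT] at this
    -- R * E is positive definite as a product of commuting ones
    obtain ⟨F, hFP, hFF, hFc⟩ := sqrt_ex R hRP
    have hFE : F * E = E * F := hFc E hRE
    have hREP : (R * E).PosDef := by
      have := posDef_conj_orth E F hEP hFP.isUnit
      rw [posDef_transpose hFP, mul_assoc, ← hFE, ← mul_assoc, hFF] at this
      exact this
    rw [hMM]
    exact (hRRP.add (hREP.add hREP)).add hRRP
  obtain ⟨Q, hQP, hQQ, hQc⟩ := sqrt_ex _ hMMP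
  obtain ⟨Q', hQP', hQQ', hQ'Q⟩ := posDef_inv_ex hQP
  have hQT' := posDef_transpose hQP'
  have hEW : E * W = W * E := by
    rw [hW, mul_add, add_mul, ← mul_assoc, hEJ, mul_smul_comm, hEO, smul_mul_assoc]
  have hQW : Q * W = W * Q := hQc W (by
    show _ * _ = _ * _
    have e1 : R * R * W = W * (R * R) := by rw [mul_assoc, hRW, ← mul_assoc, hRW, mul_assoc]
    have e2 : R * E * W = W * (R * E) := by rw [mul_assoc, hEW, ← mul_assoc, hRW, mul_assoc]
    rw [hMM]; simp only [add_mul, mul_add, e1, e2])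
  have hQR : Q * R = R * Q := hQc R (by
    show _ * _ = _ * _
    have e2 : R * E * R = R * (R * E) := by rw [mul_assoc, ← hRE]
    rw [hMM]; simp only [add_mul, mul_add, e2, mul_assoc])
  have inv_comm : ∀ {X X' Y : Matrix ι ι ℝ}, X * X' = 1 → X' * X = 1 → X * Y = Y * X → X' * Y = Y * X' := by
    intro X X' Y h1 h2 h3
    calc X' * Y = X' * Y * (X * X') := by rw [h1, mul_one]
      _ = X' * (Y * X) * X' := by simp only [mul_assoc]
      _ = (X' * X) * Y * X' := by rw [← h3]; simp only [mul_assoc]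
      _ = _ := by rw [h2, one_mul]
  have hQ'W := inv_comm hQQ' hQ'Q hQW
  have hQ'R := inv_comm hQQ' hQ'Q hQR
  have hR'W := inv_comm hRR' hR'R hRW
  have hR'J := inv_comm hRR' hR'R hRJ
  have hRS : R * S = S * R := by rw [← hES, mul_add, add_mul, hRE, hRO]
  have hR'S := inv_comm hRR' hR'R hRS
  have hQ'R' := inv_comm hRR' hR'R hQ'R.symm
  have hkJk : (Q' * M) * J * (Q' * M)ᵀ = R' * W := by
    have e : M * J = R' * W * M := by
      rw [mul_assoc, hWMJ, mul_assoc, ← mul_assoc, hR'R, one_mul]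
    rw [transpose_mul, hQT']
    calc Q' * M * J * (Mᵀ * Q') = Q' * (M * J) * Mᵀ * Q' := by simp only [mul_assoc]
      _ = Q' * (R' * W) * (M * Mᵀ) * Q' := by rw [e]; simp only [mul_assoc]
      _ = Q' * (R' * W) * Q * (Q * Q') := by rw [← hQQ]; simp only [mul_assoc]
      _ = R' * W * (Q' * Q) := by
          rw [hQQ', mul_one, ← mul_assoc Q', ← hQ'R', mul_assoc R', hQ'W]; simp only [mul_assoc]
      _ = R' * W := by rw [hQ'Q, mul_one]
  refine ⟨Q' * M, ?_, ?_⟩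
  · apply mul_eq_one_comm.1
    rw [transpose_mul, hQT']
    calc Q' * M * (Mᵀ * Q') = Q' * (M * Mᵀ) * Q' := by simp only [mul_assoc]
      _ = (Q' * Q) * (Q * Q') := by rw [← hQQ]; simp only [mul_assoc]
      _ = 1 := by rw [hQQ', hQ'Q, mul_one]
  · rw [hkJk]
    set a : Matrix ι ι ℝ := u • 1 + v • J with ha
    set a' : Matrix ι ι ℝ := c • 1 + d • J with ha'
    have haT : aᵀ = a := by rw [ha]; simp [hJT]
    have haT' : a'ᵀ = a' := by rw [ha']; simp [hJT]
    have hca := mul_eq_one_comm.1 hac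
    have haR : R' * a = a * R' := by rw [ha]; simp [mul_add, add_mul, hR'J]
    have haR' : R' * a' = a' * R' := by rw [ha']; simp [mul_add, add_mul, hR'J]
    have haJ : a * J = J * a := by rw [ha]; simp [mul_add, add_mul]
    have haJ' : a' * J = J * a' := by rw [ha']; simp [mul_add, add_mul]
    have hX : a' * W * a' = (c ^ 2 + d ^ 2) • (J * E) + (2 * c * d) • S' := by
      have e1 : J * E * J = E := by rw [← hEJ, mul_assoc, hJ, mul_one]
      have e2 : J * (J * E) = E := by rw [← mul_assoc, hJ, one_mul]
      have e3 : J * O * J = -O := by rw [mul_assoc, hOJ, mul_neg, ← mul_assoc, hJ, one_mul]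
      have e4 : J * E * J = E := e1
      have : a' * W * a' = (c ^ 2 + d ^ 2) • (J * E) + (2 * c * d) • E + (κ * (c ^ 2 - d ^ 2)) • O := by
        rw [ha', hW]
        simp only [add_mul, mul_add, smul_mul_assoc, mul_smul_comm, one_mul, mul_one, e1, e2, e3, hOJ, hEJ]
        module
      rw [this, hκ, ← hES']
      module
    have key : S * (a' * W * a') * S = J * (a' * W * a') * J := by
      have e1 : S * (J * E) * S = J * E := by
        have : E * S = S * E := by rw [← hES, mul_add, add_mul, hEO]
        rw [← mul_assoc, mul_assoc, this, ← mul_assoc, hSJS]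
      have e2 : J * (J * E) * J = J * E := by
        rw [← mul_assoc, hJ, one_mul, hEJ]
      have e3 : S * S' * S = S := by rw [hSS', one_mul]
      have e4 : J * S' * J = S := by rw [mul_assoc, hS'J, ← mul_assoc, hJ, one_mul]
      rw [hX]
      simp only [mul_add, add_mul, smul_mul_assoc, mul_smul_comm, e1, e2, e3, e4]
    have hT : (a * S * a')ᵀ = a' * S * a := by
      simp only [transpose_mul, haT, haT', hST, mul_assoc]
    rw [hT]
    calc a * S * a' * (R' * W) * (a' * S * a)
        = a * S * (a' * R') * W * a' * S * a := by simp only [mul_assoc]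
      _ = a * (S * R') * a' * W * a' * S * a := by rw [← haR']; simp only [mul_assoc]
      _ = (a * R') * S * a' * W * a' * S * a := by rw [← hR'S]; simp only [mul_assoc]
      _ = R' * a * (S * (a' * W * a') * S) * a := by rw [← haR]; simp only [mul_assoc]
      _ = R' * (a * J) * a' * W * a' * (J * a) := by rw [key]; simp only [mul_assoc]
      _ = R' * J * (a * a') * W * (a' * a) * J := by rw [← haJ]; rw [haJ]; simp only [mul_assoc]; rw [haJ]
      _ = R' * J * W * J := by rw [hac, hca]; simp only [mul_assoc, mul_one, one_mul]
      _ = J * (R' * W) * J := by rw [hR'J]; simp only [mul_assoc]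

end

section
variable {ι : Type*} [Fintype ι] [DecidableEq ι]
theorem khk (J h : Matrix ι ι ℝ) (hJT : Jᵀ = J) (hJ : J * J = 1) (hh : h * J * hᵀ = J)
    (u v c d : ℝ) (hac : (u • 1 + v • J) * (c • 1 + d • J) = 1)
    (hcd : c ^ 2 - d ^ 2 ≠ 0) :
    ∃ k₁ S k₂ : Matrix ι ι ℝ, k₁ᵀ * k₁ = 1 ∧ k₂ᵀ * k₂ = 1 ∧ S.PosDef ∧ S * J * S = J ∧
      (u • 1 + v • J) * h * (c • 1 + d • J) = k₁ * S * k₂ := by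
  obtain ⟨k, S, hk, hS, hSJ, hkS, hkJ⟩ := polar J h hJT hJ hh
  obtain ⟨κ, hκ, hg⟩ := khk_sym J S hJT hJ hS hSJ u v c d hac hcd
  obtain ⟨g, hgdef⟩ : ∃ g, g = (u • 1 + v • J) * S * (c • 1 + d • J) := ⟨_, rfl⟩
  rw [← hgdef] at hg
  have hκ' : κ * κᵀ = 1 := mul_eq_one_comm.1 hκ
  obtain ⟨k', S', hk', hS', hSJ', hkS', -⟩ := polar J (κᵀ * J * g * κ) hJT hJ (by
    have : κᵀ * J * g * κ * J * (κᵀ * J * g * κ)ᵀ = κᵀ * J * (g * (κ * J * κᵀ) * gᵀ) * (J * κ) := by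
      simp only [transpose_mul, hJT, transpose_transpose, mul_assoc]
    rw [this, hg]
    calc κᵀ * J * (J * (κ * J * κᵀ) * J) * (J * κ) = κᵀ * (J * J) * κ * J * κᵀ * (J * J) * κ := by
          simp only [mul_assoc]
      _ = J := by rw [hJ, mul_one, mul_one, hκ, one_mul, mul_assoc, hκ, mul_one])
  refine ⟨k * J * κ * k', S', κᵀ, ?_, by rw [transpose_transpose, hκ'], hS', hSJ', ?_⟩
  · calc (k * J * κ * k')ᵀ * (k * J * κ * k') = k'ᵀ * κᵀ * J * (kᵀ * k) * J * κ * k' := by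
          simp only [transpose_mul, hJT, mul_assoc]
      _ = 1 := by rw [hk, mul_one, mul_assoc (k'ᵀ * κᵀ), hJ, mul_one, mul_assoc k'ᵀ, hκ, mul_one, hk']
  · have hka : (u • 1 + v • J) * k = k * (u • 1 + v • J) := by
      simp [add_mul, mul_add, hkJ]
    calc (u • 1 + v • J) * h * (c • 1 + d • J) = k * g := by
          rw [hgdef, hkS, ← mul_assoc, hka]; simp only [mul_assoc]
      _ = k * (J * J) * (κ * κᵀ) * g * (κ * κᵀ) := by rw [hJ, hκ', mul_one, mul_one, mul_one]
      _ = k * J * (J * (κ * κᵀ)) * g * (κ * κᵀ) := by simp only [mul_assoc]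
      _ = k * J * ((κ * κᵀ) * J) * g * (κ * κᵀ) := by rw [hκ']; simp only [mul_one, one_mul, mul_assoc]
      _ = k * J * κ * (κᵀ * J * g * κ) * κᵀ := by simp only [mul_assoc]
      _ = _ := by rw [hkS']; simp only [mul_assoc]
end

section
theorem formMat_T (p q : ℕ) : (formMat p q)ᵀ = formMat p q := by simp [formMat]
theorem formMat_sq (p q : ℕ) : formMat p q * formMat p q = 1 := by
  rw [formMat, diagonal_mul_diagonal, ← diagonal_one]
  congr 1; ext i; split_ifs <;> simp

theorem inv_eq_smul_adj {ι : Type*} [Fintype ι] [DecidableEq ι] (B : Matrix ι ι ℝ) : 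
    B⁻¹ = (B.det)⁻¹ • B.adjugate := by rw [inv_def, Ring.inverse_eq_inv']

theorem soZero_of_posDef (p q : ℕ) (S : Matrix (Fin (p + q)) (Fin (p + q)) ℝ) (hS : S.PosDef)
    (hSJ : S * formMat p q * S = formMat p q) :
    ∃ s : GL (Fin (p + q)) ℝ, s ∈ SOZero p q ∧ (s : Matrix (Fin (p + q)) (Fin (p + q)) ℝ) = S := by
  have pd : ∀ x y : ℝ, 0 ≤ x → 0 ≤ y → 0 < x + y → (x • S + y • (1 : Matrix (Fin (p + q)) (Fin (p + q)) ℝ)).PosDef := by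
    intro x y hx hy hxy
    rcases hx.eq_or_lt with h | h
    · subst h
      rw [zero_smul, zero_add]
      exact Matrix.PosDef.one.smul (by linarith)
    · exact (hS.smul h).add_posSemidef (Matrix.PosSemidef.one.smul hy)
  obtain ⟨A, hA⟩ : ∃ A : unitInterval → Matrix (Fin (p + q)) (Fin (p + q)) ℝ,
    A = fun t : unitInterval => (1 + (t:ℝ)) • S + (1 - (t:ℝ)) • (1 : Matrix (Fin (p + q)) (Fin (p + q)) ℝ) := ⟨_, rfl⟩
  obtain ⟨B, hB⟩ : ∃ A : unitInterval → Matrix (Fin (p + q)) (Fin (p + q)) ℝ,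
    A = fun t : unitInterval => (1 - (t:ℝ)) • S + (1 + (t:ℝ)) • (1 : Matrix (Fin (p + q)) (Fin (p + q)) ℝ) := ⟨_, rfl⟩
  have hAP : ∀ t, (A t).PosDef := fun t => by
    rw [hA]; exact pd _ _ (by linarith [t.2.1]) (by linarith [t.2.2]) (by linarith)
  have hBP : ∀ t, (B t).PosDef := fun t => by
    rw [hB]; exact pd _ _ (by linarith [t.2.2]) (by linarith [t.2.1]) (by linarith)
  have hAu : ∀ t, IsUnit (A t).det := fun t => (Matrix.isUnit_iff_isUnit_det _).1 (hAP t).isUnit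
  have hBu : ∀ t, IsUnit (B t).det := fun t => (Matrix.isUnit_iff_isUnit_det _).1 (hBP t).isUnit
  have hAc : Continuous A := by rw [hA]; fun_prop
  have hBc : Continuous B := by rw [hB]; fun_prop
  have hAi : Continuous fun t => (A t)⁻¹ := by
    simp only [inv_eq_smul_adj]
    exact (hAc.matrix_det.inv₀ fun t => (hAu t).ne_zero).smul hAc.matrix_adjugate
  have hBi : Continuous fun t => (B t)⁻¹ := by
    simp only [inv_eq_smul_adj]
    exact (hBc.matrix_det.inv₀ fun t => (hBu t).ne_zero).smul hBc.matrix_adjugate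
  have hrel : ∀ t, A t * formMat p q * A t = B t * formMat p q * B t := by
    intro t
    rw [hA, hB]
    simp only [add_mul, mul_add, smul_mul_assoc, mul_smul_comm, one_mul, mul_one, hSJ]
    module
  obtain ⟨f, hf⟩ : ∃ f : unitInterval → GL (Fin (p + q)) ℝ, f = fun t =>
    ⟨A t * (B t)⁻¹, B t * (A t)⁻¹, by
      rw [mul_assoc, ← mul_assoc (B t)⁻¹, nonsing_inv_mul _ (hBu t), one_mul, mul_nonsing_inv _ (hAu t)], by
      rw [mul_assoc, ← mul_assoc (A t)⁻¹, nonsing_inv_mul _ (hAu t), one_mul, mul_nonsing_inv _ (hBu t)]⟩ := ⟨_, rfl⟩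
  have hfv : ∀ t, (f t : Matrix (Fin (p + q)) (Fin (p + q)) ℝ) = A t * (B t)⁻¹ := fun t => by rw [hf]
  have hfc : Continuous f := by
    rw [Units.continuous_iff]
    constructor
    · have : Units.val ∘ f = fun t => A t * (B t)⁻¹ := funext hfv
      rw [this]; exact hAc.mul hBi
    · have : (fun t => ((f t)⁻¹ : GL (Fin (p + q)) ℝ).val) = fun t => B t * (A t)⁻¹ := by rw [hf]; rfl
      rw [this]; exact hBc.mul hAi
  have hfm : ∀ t, f t ∈ indefO p q := by
    intro t
    show (f t : Matrix (Fin (p + q)) (Fin (p + q)) ℝ)ᵀ * formMat p q * (f t : Matrix (Fin (p + q)) (Fin (p + q)) ℝ) = formMat p q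
    have h1 : ((B t)⁻¹)ᵀ = (B t)⁻¹ := posDef_transpose (hBP t).inv
    rw [hfv, transpose_mul, h1, posDef_transpose (hAP t)]
    calc (B t)⁻¹ * A t * formMat p q * (A t * (B t)⁻¹) = (B t)⁻¹ * (A t * formMat p q * A t) * (B t)⁻¹ := by
          simp only [mul_assoc]
      _ = ((B t)⁻¹ * B t) * formMat p q * (B t * (B t)⁻¹) := by rw [hrel]; simp only [mul_assoc]
      _ = _ := by rw [nonsing_inv_mul _ (hBu t), mul_nonsing_inv _ (hBu t), one_mul, mul_one]
  obtain ⟨F, hF⟩ : ∃ F : unitInterval → indefO p q, F = fun t => ⟨f t, hfm t⟩ := ⟨_, rfl⟩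
  have hFc : Continuous F := by rw [hF]; exact hfc.subtype_mk _
  have hF0 : F 0 = 1 := by
    rw [hF]
    apply Subtype.ext; apply Units.ext
    show (f 0 : Matrix (Fin (p + q)) (Fin (p + q)) ℝ) = 1
    have : A 0 = B 0 := by rw [hA, hB]; simp
    rw [hfv, this, mul_nonsing_inv _ (hBu 0)]
  have hF1 : (f 1 : Matrix (Fin (p + q)) (Fin (p + q)) ℝ) = S := by
    have h1 : A 1 = S * B 1 := by rw [hA, hB]; simp
    rw [hfv, h1, mul_assoc, mul_nonsing_inv _ (hBu 1), mul_one]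
  refine ⟨f 1, ?_, hF1⟩
  refine Subgroup.mem_map.2 ⟨F 1, ?_, by rw [hF]; rfl⟩
  have hpre : IsPreconnected (Set.range F) := isPreconnected_range hFc
  exact hpre.subset_connectedComponent ⟨0, hF0⟩ ⟨1, rfl⟩
end

section
theorem orth_entry {ι : Type*} [Fintype ι] [DecidableEq ι] (k : Matrix ι ι ℝ) (hk : kᵀ * k = 1) (i j : ι) :
    |k i j| ≤ 1 := by
  have h := congrFun (congrFun hk j) j
  rw [mul_apply, one_apply_eq] at h
  simp only [transpose_apply] at h
  rw [← sq_le_one_iff_abs_le_one, ← h, sq]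
  exact Finset.single_le_sum (f := fun i => k i j * k i j) (fun i _ => mul_self_nonneg _) (Finset.mem_univ i)

theorem mul_orth_entry {n : ℕ} (b k : Matrix (Fin n) (Fin n) ℝ) (R : ℝ) (hb : ∀ i j, |b i j| ≤ R) (hk : kᵀ * k = 1)
    (i j : Fin n) : |(b * k) i j| ≤ n * R := by
  rw [mul_apply]
  calc |∑ l, b i l * k l j| ≤ ∑ l, |b i l * k l j| := Finset.abs_sum_le_sum_abs _ _
    _ ≤ ∑ l : Fin n, R := by
        apply Finset.sum_le_sum
        intro l _
        rw [abs_mul]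
        have h1 := orth_entry k hk l j
        have h2 := hb i l
        nlinarith [abs_nonneg (b i l), abs_nonneg (k l j)]
    _ = n * R := by simp

theorem orb_mat (p q : ℕ) (hp : 1 ≤ p) (γ β₁ β₂ h : Matrix (Fin (p + q)) (Fin (p + q)) ℝ) (R : ℝ)
    (hγ : γ.det = 1) (hd₁ : β₁.det = 1) (hd₂ : β₂.det = 1) (hR₁ : ∀ i j, |β₁ i j| ≤ R) (hR₂ : ∀ i j, |β₂ i j| ≤ R)
    (hh : h * formMat p q * hᵀ = formMat p q) (u v c d : ℝ)
    (hac : (u • 1 + v • formMat p q) * (c • 1 + d • formMat p q) = 1)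
    (hcd : c ^ 2 - d ^ 2 ≠ 0)
    (hrel : γ * β₂ * (u • 1 + v • formMat p q) = β₁ * (u • 1 + v • formMat p q) * h) :
    ∃ c₁ c₂ S : Matrix (Fin (p + q)) (Fin (p + q)) ℝ, c₁.det = 1 ∧ c₂.det = 1 ∧
      (∀ i j, |c₁ i j| ≤ ((p + q : ℕ) : ℝ) * R) ∧ (∀ i j, |c₂ i j| ≤ ((p + q : ℕ) : ℝ) * R) ∧ S.PosDef ∧ S * formMat p q * S = formMat p q ∧
      γ * c₂ = c₁ * S := by
  obtain ⟨k₁, S, k₂, hk₁, hk₂, hS, hSJ, heq⟩ := khk _ h (formMat_T p q) (formMat_sq p q) hh u v c d hac hcd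
  have hrel' : γ * β₂ = β₁ * (k₁ * S * k₂) := by
    calc γ * β₂ = γ * β₂ * ((u • 1 + v • formMat p q) * (c • 1 + d • formMat p q)) := by rw [hac, mul_one]
      _ = (γ * β₂ * (u • 1 + v • formMat p q)) * (c • 1 + d • formMat p q) := by simp only [mul_assoc]
      _ = β₁ * ((u • 1 + v • formMat p q) * h * (c • 1 + d • formMat p q)) := by rw [hrel]; simp only [mul_assoc]
      _ = _ := by rw [heq]
  have hdJ : (formMat p q).det ≠ 0 := by
    intro h0
    have := congrArg det (formMat_sq p q)
    rw [det_mul, h0, det_one] at this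
    norm_num at this
  have hdS : S.det = 1 := by
    have h1 := congrArg det hSJ
    rw [det_mul, det_mul] at h1
    have h2 := hS.det_pos
    have h3 : S.det * S.det = 1 := by
      apply mul_left_cancel₀ hdJ; linarith
    nlinarith
  have hdk : k₁.det * k₂.det = 1 := by
    have h1 := congrArg det hrel'
    simp only [det_mul, hγ, hd₁, hd₂, hdS] at h1
    linarith
  have hdk₁ : k₁.det * k₁.det = 1 := by
    have h1 := congrArg det hk₁
    rwa [det_mul, det_transpose, det_one] at h1
  have hdk₂ : k₂.det = k₁.det := by
    have h0 : k₁.det ≠ 0 := by intro h0; rw [h0] at hdk₁; norm_num at hdk₁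
    apply mul_left_cancel₀ h0; rw [hdk, hdk₁]
  obtain ⟨e, heT, hee, heJ, hed⟩ : ∃ e : Matrix (Fin (p + q)) (Fin (p + q)) ℝ, eᵀ = e ∧ e * e = 1 ∧ e * formMat p q = formMat p q * e ∧ e.det = k₁.det := by
    refine ⟨diagonal (fun i => if (i : ℕ) = 0 then k₁.det else 1), by simp, ?_, ?_, ?_⟩
    · rw [diagonal_mul_diagonal, ← diagonal_one]
      congr 1; ext i; split_ifs <;> simp [hdk₁]
    · rw [formMat, diagonal_mul_diagonal, diagonal_mul_diagonal]
      congr 1; ext i; ring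
    · rw [det_diagonal, Finset.prod_eq_single (⟨0, by omega⟩ : Fin (p + q))]
      · simp
      · intro b _ hb
        rw [if_neg]
        intro h0; exact hb (Fin.ext h0)
      · simp
  have hk₂' : k₂ * k₂ᵀ = 1 := mul_eq_one_comm.1 hk₂
  have heu : IsUnit e := IsUnit.of_mul_eq_one _ hee
  refine ⟨β₁ * (k₁ * e), β₂ * (e * k₂)ᵀ, e * S * e, ?_, ?_, ?_, ?_, ?_, ?_, ?_⟩
  · rw [det_mul, det_mul, hed, hd₁, hdk₁, one_mul]
  · rw [det_mul, det_transpose, det_mul, hed, hd₂, hdk₂, hdk₁, one_mul]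
  · apply mul_orth_entry _ _ _ hR₁
    rw [transpose_mul, heT, mul_assoc, ← mul_assoc k₁ᵀ, hk₁, one_mul, hee]
  · apply mul_orth_entry _ _ _ hR₂
    rw [transpose_transpose, transpose_mul, heT, mul_assoc, ← mul_assoc k₂, hk₂', one_mul, hee]
  · have := posDef_conj_orth S e hS heu
    rwa [heT] at this
  · calc e * S * e * formMat p q * (e * S * e) = e * S * (e * formMat p q) * e * S * e := by simp only [mul_assoc]
      _ = e * S * formMat p q * (e * e) * S * e := by rw [heJ]; simp only [mul_assoc]
      _ = e * (S * formMat p q * S) * e := by rw [hee]; simp only [mul_assoc, mul_one, one_mul]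
      _ = _ := by rw [hSJ, heJ, mul_assoc, hee, mul_one]
  · rw [transpose_mul, heT]
    calc γ * (β₂ * (k₂ᵀ * e)) = (γ * β₂) * k₂ᵀ * e := by simp only [mul_assoc]
      _ = β₁ * k₁ * S * (k₂ * k₂ᵀ) * e := by rw [hrel']; simp only [mul_assoc]
      _ = β₁ * k₁ * (e * e) * S * e := by rw [hk₂', hee, mul_one, mul_one]
      _ = _ := by simp only [mul_assoc]
end

section
theorem SLR_det {n : ℕ} (g : SLR n) : ((g : GL (Fin n) ℝ) : Matrix (Fin n) (Fin n) ℝ).det = 1 := g.2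

/-- Elements of `SL` with entries bounded by `R`. -/
def boxSL (n : ℕ) (R : ℝ) : Set (SLR n) :=
  {g | ∀ i j, |((g : GL (Fin n) ℝ) : Matrix (Fin n) (Fin n) ℝ) i j| ≤ R}

/-- The element of `SLR n` attached to a matrix of determinant one. -/
def toSLR {n : ℕ} (M : Matrix (Fin n) (Fin n) ℝ) (hM : M.det = 1) : SLR n :=
  ⟨⟨M, M.adjugate, by rw [mul_adjugate, hM, one_smul], by rw [adjugate_mul, hM, one_smul]⟩, hM⟩

theorem toSLR_val {n : ℕ} (M : Matrix (Fin n) (Fin n) ℝ) (hM : M.det = 1) :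
    ((toSLR M hM : GL (Fin n) ℝ) : Matrix (Fin n) (Fin n) ℝ) = M := rfl

theorem SLR_ext {n : ℕ} {g h : SLR n} (hgh : ((g : GL (Fin n) ℝ) : Matrix (Fin n) (Fin n) ℝ) = ((h : GL (Fin n) ℝ) : Matrix (Fin n) (Fin n) ℝ)) : g = h :=
  Subtype.ext (Units.ext hgh)

theorem SLR_val_mul {n : ℕ} (g h : SLR n) : (((g * h : SLR n) : GL (Fin n) ℝ) : Matrix (Fin n) (Fin n) ℝ) = ((g : GL (Fin n) ℝ) : Matrix (Fin n) (Fin n) ℝ) * ((h : GL (Fin n) ℝ) : Matrix (Fin n) (Fin n) ℝ) := rfl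

theorem SLR_cont (n : ℕ) : Continuous fun g : SLR n => ((g : GL (Fin n) ℝ) : Matrix (Fin n) (Fin n) ℝ) :=
  Units.continuous_val.comp continuous_subtype_val

theorem boxMat_compact (n : ℕ) (R : ℝ) : IsCompact {M : Matrix (Fin n) (Fin n) ℝ | ∀ i j, |M i j| ≤ R} := by
  have h : IsCompact (Set.univ.pi fun _ : Fin n => Set.univ.pi fun _ : Fin n => Set.Icc (-R) R) :=
    isCompact_univ_pi fun _ => isCompact_univ_pi fun _ => isCompact_Icc
  have e : (Set.univ.pi fun _ : Fin n => Set.univ.pi fun _ : Fin n => Set.Icc (-R) R) = {M : Matrix (Fin n) (Fin n) ℝ | ∀ i j, |M i j| ≤ R} := by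
    ext M; simp only [Set.mem_pi, Set.mem_univ, true_imp_iff, Set.mem_Icc, Set.mem_setOf_eq, abs_le]; rfl
  rw [← e]; exact h

theorem boxSL_compact (n : ℕ) (R : ℝ) : IsCompact (boxSL n R) := by
  have hcl : IsClosed {M : Matrix (Fin n) (Fin n) ℝ | M.det = 1} :=
    isClosed_eq (continuous_id.matrix_det) continuous_const
  have hK := (boxMat_compact n R).inter_left hcl
  obtain ⟨φ, hφ⟩ : ∃ φ : {M : Matrix (Fin n) (Fin n) ℝ // M.det = 1} → SLR n, φ = fun M => toSLR M.1 M.2 := ⟨_, rfl⟩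
  have hφc : Continuous φ := by
    rw [hφ]
    refine Continuous.subtype_mk ?_ _
    rw [Units.continuous_iff]
    exact ⟨continuous_subtype_val, continuous_subtype_val.matrix_adjugate⟩
  have hs : IsCompact {M : {M : Matrix (Fin n) (Fin n) ℝ // M.det = 1} | ∀ i j, |M.1 i j| ≤ R} := by
    rw [Subtype.isCompact_iff]
    convert hK using 1
    ext M
    simp
    exact ⟨fun h => ⟨h.2, h.1⟩, fun h => ⟨h.2, h.1⟩⟩
  convert hs.image hφc using 1
  ext g
  simp only [Set.mem_image, boxSL, Set.mem_setOf_eq]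
  constructor
  · intro h
    exact ⟨⟨_, g.2⟩, h, by rw [hφ]; exact SLR_ext rfl⟩
  · rintro ⟨M, hM, rfl⟩
    rw [hφ]; exact hM

theorem CK_extract {n : ℕ} (H Γ : Subgroup (SLR n)) (hc : CompactSpace (Quotient (MulAction.orbitRel Γ (SLR n ⧸ H)))) :
    ∃ R : ℝ, ∀ g : SLR n, ∃ γ : Γ, ∃ c ∈ boxSL n R, ∃ h ∈ H, g = γ * c * h := by
  obtain ⟨U, hU⟩ : ∃ U : ℕ → Set (SLR n), U = fun (m : ℕ) => {g : SLR n | ∀ i j, |((g : GL (Fin n) ℝ) : Matrix (Fin n) (Fin n) ℝ) i j| < m} := ⟨_, rfl⟩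
  have hUo : ∀ m, IsOpen (U m) := by
    intro m
    rw [hU]
    simp only [Set.setOf_forall]
    refine isOpen_iInter_of_finite fun i => isOpen_iInter_of_finite fun j => ?_
    exact isOpen_lt ((SLR_cont n).matrix_elem i j).abs continuous_const
  obtain ⟨π, hπ⟩ : ∃ π : SLR n → Quotient (MulAction.orbitRel Γ (SLR n ⧸ H)), π = fun g => Quotient.mk _ (QuotientGroup.mk g) := ⟨_, rfl⟩
  have hπo : IsOpenMap π := by
    rw [hπ]
    haveI : ContinuousConstSMul Γ (SLR n ⧸ H) := ⟨fun γ => continuous_const_smul (γ : SLR n)⟩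
    exact (isOpenMap_quotient_mk'_mul (Γ := Γ) (T := SLR n ⧸ H)).comp QuotientGroup.isOpenMap_coe
  have hπs : Function.Surjective π := by
    rw [hπ]
    intro x
    induction x using Quotient.inductionOn with
    | h y => 
      obtain ⟨g, rfl⟩ := QuotientGroup.mk_surjective y
      exact ⟨g, rfl⟩
  have hUm : Monotone U := by
    intro a b hab g hg
    rw [hU] at hg ⊢
    intro i j
    exact (hg i j).trans_le (by exact_mod_cast hab)
  have hUc : ∀ g, ∃ m, g ∈ U m := by
    intro g
    obtain ⟨m, hm⟩ := exists_nat_gt (∑ i, ∑ j, |((g : GL (Fin n) ℝ) : Matrix (Fin n) (Fin n) ℝ) i j|)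
    refine ⟨m, ?_⟩
    rw [hU]
    intro i j
    refine lt_of_le_of_lt ?_ hm
    refine le_trans ?_ (Finset.single_le_sum (f := fun i => ∑ j, |((g : GL (Fin n) ℝ) : Matrix (Fin n) (Fin n) ℝ) i j|) (fun i _ => Finset.sum_nonneg fun j _ => abs_nonneg _) (Finset.mem_univ i))
    exact Finset.single_le_sum (f := fun j => |((g : GL (Fin n) ℝ) : Matrix (Fin n) (Fin n) ℝ) i j|) (fun i _ => abs_nonneg _) (Finset.mem_univ j)
  obtain ⟨m, hm⟩ := isCompact_univ.elim_directed_cover (fun m => π '' U m) (fun m => hπo _ (hUo m)) (by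
    intro x _
    obtain ⟨g, rfl⟩ := hπs x
    obtain ⟨m, hm⟩ := hUc g
    exact Set.mem_iUnion.2 ⟨m, g, hm, rfl⟩)
    (Monotone.directed_le fun a b hab => Set.image_mono (hUm hab))
  refine ⟨m, fun g => ?_⟩
  obtain ⟨c, hc, hcg⟩ := hm (Set.mem_univ (π g))
  rw [hπ] at hcg
  have h1 := Quotient.exact hcg
  obtain ⟨γ, hγ⟩ := (MulAction.orbitRel_apply.1 h1)
  rw [hU] at hc
  refine ⟨γ⁻¹, c, fun i j => (hc i j).le, c⁻¹ * (γ : SLR n) * g, ?_, by simp [mul_assoc]⟩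
  have h2 : QuotientGroup.mk (s := H) ((γ : SLR n) * g) = QuotientGroup.mk c := hγ
  rw [QuotientGroup.eq] at h2
  have h3 := H.inv_mem h2
  convert h3 using 1
  simp [mul_assoc]

theorem CK_finite {n : ℕ} (H Γ : Subgroup (SLR n)) (hc : ProperlyDiscontinuousSMul Γ (SLR n ⧸ H)) (R : ℝ) :
    {γ : Γ | ∃ c₁ ∈ boxSL n R, ∃ c₂ ∈ boxSL n R, ∃ s ∈ H, (γ : SLR n) * c₂ = c₁ * s}.Finite := by
  have hK := (boxSL_compact n R).image (QuotientGroup.continuous_mk (N := H))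
  refine (hc.finite_disjoint_inter_image hK hK).subset ?_
  rintro γ ⟨c₁, h₁, c₂, h₂, s, hs, h⟩
  have : γ • (QuotientGroup.mk c₂ : SLR n ⧸ H) = QuotientGroup.mk c₁ := by
    show (QuotientGroup.mk ((γ : SLR n) * c₂) : SLR n ⧸ H) = QuotientGroup.mk c₁
    rw [h]; exact (QuotientGroup.mk_mul_of_mem _ hs)
  exact ⟨_, ⟨_, ⟨c₂, h₂, rfl⟩, rfl⟩, ⟨c₁, h₁, this.symm⟩⟩
end

section
open MeasureTheory
open scoped ENNReal Pointwise
theorem abstract_contra {E : Type*} [NormedAddCommGroup E] [NormedSpace ℝ E] [FiniteDimensional ℝ E]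
    {Γ : Type*} [Group Γ] [Countable Γ] (L : Γ → (E →ₗ[ℝ] E)) (hL : ∀ γ, |LinearMap.det (L γ)| = 1)
    (C : Set E) (hC : IsCompact C) (Y : Set E) (hY : IsOpen Y) (hne : Y.Nonempty) (F : Finset Γ)
    (hM : ∀ M : ℕ, ∃ A : ℕ → (E →ₗ[ℝ] E), (∀ k, |LinearMap.det (A k)| = 1) ∧
      (∀ k l, k ≠ l → Disjoint (A k '' Y) (A l '' Y)) ∧
      (∀ k < M, ∀ y ∈ Y, ∃ γ, ∃ x ∈ C, L γ x = A k y) ∧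
      (∀ x γ₁ γ₂, ∀ k₁ < M, ∀ k₂ < M, ∀ y₁ ∈ Y, ∀ y₂ ∈ Y, L γ₁ x = A k₁ y₁ → L γ₂ x = A k₂ y₂ →
        γ₁ * γ₂⁻¹ ∈ F)) : False := by
  classical
  letI : MeasurableSpace E := borel E
  haveI : BorelSpace E := ⟨rfl⟩
  obtain ⟨μ, hμ⟩ : ∃ μ : Measure E, μ = Measure.addHaar := ⟨_, rfl⟩
  haveI : Measure.IsAddHaarMeasure μ := by rw [hμ]; infer_instance
  have key : ∀ M : ℕ, (M : ℝ≥0∞) * μ Y ≤ (F.card : ℝ≥0∞) * μ C := by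
    intro M
    obtain ⟨A, hA, hdis, hcov, hmul⟩ := hM M
    have him : ∀ (B : E →ₗ[ℝ] E), |LinearMap.det B| = 1 → ∀ s, μ (B '' s) = μ s := by
      intro B hB s
      rw [Measure.addHaar_image_linearMap, hB, ENNReal.ofReal_one, one_mul]
    have hopen : ∀ k, IsOpen (A k '' Y) := by
      intro k
      have hu : IsUnit (LinearMap.det (A k)) := by
        rw [isUnit_iff_ne_zero]; intro h0; have := hA k; rw [h0] at this; norm_num at this
      have := (LinearEquiv.ofIsUnitDet (f := A k) (v := Module.finBasis ℝ E) (v' := Module.finBasis ℝ E) (by rwa [LinearMap.det_toMatrix])).toContinuousLinearEquiv.isOpenMap Y hY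
      exact this
    obtain ⟨T, hT⟩ : ∃ T : Set E, T = ⋃ k ∈ Finset.range M, A k '' Y := ⟨_, rfl⟩
    have hTm : MeasurableSet T := by
      rw [hT]
      exact Finset.measurableSet_biUnion _ fun k _ => (hopen k).measurableSet
    have hTμ : μ T = M * μ Y := by
      rw [hT, measure_biUnion_finset (fun k _ l _ hkl => hdis k l hkl) (fun k _ => (hopen k).measurableSet)]
      simp [him _ (hA _)]
    have hTmem : ∀ x, x ∈ T ↔ ∃ k < M, ∃ y ∈ Y, A k y = x := by
      intro x; rw [hT]; simp
    rw [← hTμ]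
    have hLm : ∀ γ, MeasurableSet (L γ ⁻¹' T) := fun γ => by
      have : Continuous (L γ) := LinearMap.continuous_of_finiteDimensional _
      exact this.measurable hTm
    calc μ T ≤ μ (⋃ γ, T ∩ L γ '' C) := by
          apply measure_mono
          intro x hx
          obtain ⟨k, hk, y, hy, rfl⟩ := (hTmem x).1 hx
          obtain ⟨γ, z, hz, h⟩ := hcov k hk y hy
          exact Set.mem_iUnion.2 ⟨γ, hx, z, hz, h⟩
      _ ≤ ∑' γ, μ (T ∩ L γ '' C) := measure_iUnion_le _
      _ = ∑' γ, ∫⁻ x in C, (L γ ⁻¹' T).indicator 1 x ∂μ := by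
          congr 1; ext γ
          rw [← Set.image_preimage_inter, him _ (hL γ), lintegral_indicator_one (hLm γ), Measure.restrict_apply (hLm γ)]
      _ = ∫⁻ x in C, ∑' γ, (L γ ⁻¹' T).indicator 1 x ∂μ := by
          rw [lintegral_tsum]
          intro γ
          exact (measurable_one.indicator (hLm γ)).aemeasurable
      _ ≤ ∫⁻ x in C, (F.card : ℝ≥0∞) ∂μ := by
          apply lintegral_mono
          intro x
          by_cases hex : ∃ γ, L γ x ∈ T
          · obtain ⟨γ₂, h₂⟩ := hex
            obtain ⟨k₂, hk₂, y₂, hy₂, he₂⟩ := (hTmem _).1 h₂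
            show ∑' γ, (L γ ⁻¹' T).indicator 1 x ≤ (F.card : ℝ≥0∞)
            rw [tsum_eq_sum (s := F.image (· * γ₂))]
            · calc ∑ γ ∈ F.image (· * γ₂), (L γ ⁻¹' T).indicator (1 : E → ℝ≥0∞) x ≤ ∑ γ ∈ F.image (· * γ₂), 1 := by
                    apply Finset.sum_le_sum
                    intro γ _
                    exact Set.indicator_le_self' (fun _ _ => zero_le) x
                _ ≤ (F.card : ℝ≥0∞) := by
                    simp only [Finset.sum_const, nsmul_eq_mul, mul_one]
                    exact_mod_cast Finset.card_image_le
            · intro γ hγ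
              apply Set.indicator_of_notMem
              intro h₁
              obtain ⟨k₁, hk₁, y₁, hy₁, he₁⟩ := (hTmem _).1 h₁
              apply hγ
              rw [Finset.mem_image]
              exact ⟨_, hmul x γ γ₂ k₁ hk₁ k₂ hk₂ y₁ hy₁ y₂ hy₂ he₁.symm he₂.symm, by simp⟩
          · push Not at hex
            show ∑' γ, (L γ ⁻¹' T).indicator 1 x ≤ (F.card : ℝ≥0∞)
            have : ∀ γ, (L γ ⁻¹' T).indicator (1 : E → ℝ≥0∞) x = 0 := fun γ => Set.indicator_of_notMem (show x ∉ L γ ⁻¹' T from hex γ) _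
            simp [this]
      _ = F.card * μ C := by simp
  have hY0 : μ Y ≠ 0 := (hY.measure_pos μ hne).ne'
  have hC0 : (F.card : ℝ≥0∞) * μ C ≠ ⊤ := ENNReal.mul_ne_top (by simp) hC.measure_lt_top.ne
  obtain ⟨M, hM'⟩ := ENNReal.exists_nat_mul_gt hY0 hC0
  exact absurd (key M) (not_le.2 hM')
end

section
variable {ι : Type*} [Fintype ι] [DecidableEq ι]
theorem hom_transvection (φ : Matrix ι ι ℝ →* ℝ) (i j : ι) (hij : i ≠ j) (c : ℝ) : φ (transvection i j c) = 1 := by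
  have h1 : transvection i j c * transvection i j c = transvection i j (2 * c) := by
    rw [transvection_mul_transvection_same _ _ hij, two_mul]
  have h0 : φ (transvection i j c) ≠ 0 := by
    intro h0
    have h2 : transvection i j c * transvection i j (-c) = 1 := by
      rw [transvection_mul_transvection_same _ _ hij, add_neg_cancel, transvection_zero]
    have := congrArg φ h2
    rw [map_mul, h0, map_one] at this
    norm_num at this
  have h3 : diagonal (Function.update (1 : ι → ℝ) i 2) * transvection i j c * diagonal (Function.update (1 : ι → ℝ) i (1/2)) = transvection i j (2 * c) := by
    ext a b
    rw [mul_diagonal, diagonal_mul]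
    simp only [transvection, Matrix.add_apply, single_apply, one_apply, Function.update_apply]
    by_cases hai : a = i <;> by_cases hbi : b = i <;> by_cases hbj : b = j <;> by_cases hab : a = b <;>
      simp_all <;> grind
  have h4 : diagonal (Function.update (1 : ι → ℝ) i 2) * diagonal (Function.update (1 : ι → ℝ) i (1/2)) = 1 := by
    rw [diagonal_mul_diagonal, ← diagonal_one]
    congr 1; ext a; by_cases h : a = i <;> simp [Function.update_apply, h]
  have h5 := congrArg φ h3
  have h6 := congrArg φ h4
  rw [← h1] at h5
  simp only [map_mul, map_one] at h5 h6
  apply mul_left_cancel₀ h0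
  rw [← h5, mul_one]
  linear_combination (φ (transvection i j c)) * h6

theorem hom_submatrix (φ : Matrix ι ι ℝ →* ℝ) (σ : Equiv.Perm ι) (M : Matrix ι ι ℝ) : φ (M.submatrix σ σ) = φ M := by
  have h1 : (1 : Matrix ι ι ℝ).submatrix σ id * M * (1 : Matrix ι ι ℝ).submatrix id σ = M.submatrix σ σ := by
    ext a b
    simp [mul_apply, one_apply]
  have h2 : (1 : Matrix ι ι ℝ).submatrix id σ * (1 : Matrix ι ι ℝ).submatrix σ id = 1 := by
    rw [submatrix_mul_equiv, mul_one, submatrix_id_id]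
  have h3 := congrArg φ h1
  have h4 := congrArg φ h2
  simp only [map_mul, map_one] at h3 h4
  rw [← h3]
  linear_combination (φ M) * h4

theorem hom_det (φ : Matrix ι ι ℝ →* ℝ) (i₀ : ι) (g : Matrix ι ι ℝ) : 
    φ g = φ (diagonal (Function.update (1 : ι → ℝ) i₀ g.det)) := by
  have hone : φ (diagonal (Function.update (1 : ι → ℝ) i₀ 1)) = 1 := by
    rw [← map_one φ, ← diagonal_one]; congr 2; ext a; simp [Function.update_apply]
  have hmul : ∀ x y : ℝ, φ (diagonal (Function.update (1 : ι → ℝ) i₀ (x * y))) = φ (diagonal (Function.update (1 : ι → ℝ) i₀ x)) * φ (diagonal (Function.update (1 : ι → ℝ) i₀ y)) := by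
    intro x y
    rw [← map_mul, diagonal_mul_diagonal]
    congr 2; ext a; by_cases h : a = i₀ <;> simp [Function.update_apply, h]
  have hi : ∀ (i : ι) (x : ℝ), φ (diagonal (Function.update (1 : ι → ℝ) i x)) = φ (diagonal (Function.update (1 : ι → ℝ) i₀ x)) := by
    intro i x
    rw [← hom_submatrix φ (Equiv.swap i i₀)]
    congr 1
    rw [submatrix_diagonal_equiv]
    congr 1; ext a
    by_cases h : a = i₀
    · simp [h]
    · by_cases h' : a = i
      · have : i₀ ≠ i := by rintro rfl; exact h h'
        subst h'; simp [Function.update_apply, h, this]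
      · simp [Function.update_apply, Equiv.swap_apply_of_ne_of_ne h' h, h, h']
  refine diagonal_transvection_induction (fun g => φ g = φ (diagonal (Function.update (1 : ι → ℝ) i₀ g.det))) g ?_ ?_ ?_
  · intro D _
    rw [det_diagonal]
    have : ∀ s : Finset ι, φ (diagonal fun i => if i ∈ s then D i else 1) = φ (diagonal (Function.update (1 : ι → ℝ) i₀ (∏ i ∈ s, D i))) := by
      intro s
      induction s using Finset.induction_on with
      | empty => simp only [Finset.prod_empty, hone, Finset.notMem_empty, if_false]; rw [diagonal_one, map_one]
      | insert a s ha ih =>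
        rw [Finset.prod_insert ha, hmul, ← ih, ← hi a, ← map_mul, diagonal_mul_diagonal]
        congr 2; ext i
        by_cases h : i = a
        · subst h; simp [ha]
        · simp [h, Function.update_apply]
    have h := this Finset.univ
    simpa using h
  · intro t
    rw [TransvectionStruct.toMatrix, hom_transvection φ _ _ t.hij, det_transvection_of_ne _ _ t.hij, hone]
  · intro A B hA hB
    rw [map_mul, hA, hB, det_mul, hmul]

theorem hom_det_one (φ : Matrix ι ι ℝ →* ℝ) (i₀ : ι) (g : Matrix ι ι ℝ) (hg : g.det = 1) : φ g = 1 := by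
  rw [hom_det φ i₀, hg, ← map_one φ, ← diagonal_one]; congr 2; ext a; simp [Function.update_apply]

/-- The space of symmetric matrices. -/
def SymE (n : ℕ) : Submodule ℝ (Matrix (Fin n) (Fin n) ℝ) where
  carrier := {X | Xᵀ = X}
  zero_mem' := transpose_zero
  add_mem' := by
    intro a b ha hb
    show (a + b)ᵀ = a + b
    rw [transpose_add, show aᵀ = a from ha, show bᵀ = b from hb]
  smul_mem' := by
    intro c a ha
    show (c • a)ᵀ = c • a
    rw [transpose_smul, show aᵀ = a from ha]

/-- The congruence action on symmetric matrices. -/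
def symAct (n : ℕ) : Matrix (Fin n) (Fin n) ℝ →* (SymE n →ₗ[ℝ] SymE n) where
  toFun g :=
    { toFun := fun X => ⟨g * X.1 * gᵀ, by
        show (g * X.1 * gᵀ)ᵀ = _
        rw [transpose_mul, transpose_mul, transpose_transpose, show (X.1)ᵀ = X.1 from X.2, mul_assoc]⟩
      map_add' := fun X Y => Subtype.ext (by simp [mul_add, add_mul])
      map_smul' := fun c X => Subtype.ext (by simp) }
  map_one' := by ext X; simp
  map_mul' := fun g h => by
    refine LinearMap.ext fun X => Subtype.ext ?_
    show g * h * X.1 * (g * h)ᵀ = g * (h * X.1 * hᵀ) * gᵀ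
    rw [transpose_mul]; simp only [mul_assoc]

theorem symAct_val {n : ℕ} (g : Matrix (Fin n) (Fin n) ℝ) (X : SymE n) : (symAct n g X : Matrix (Fin n) (Fin n) ℝ) = g * X.1 * gᵀ := rfl

theorem symAct_det {n : ℕ} (hn : 0 < n) (g : Matrix (Fin n) (Fin n) ℝ) (hg : g.det = 1) : |LinearMap.det (symAct n g)| = 1 := by
  have := hom_det_one (LinearMap.det.comp (symAct n)) ⟨0, hn⟩ g hg
  rw [MonoidHom.comp_apply] at this
  rw [this, abs_one]
end

noncomputable section
open scoped Topology
theorem quad_open {E F : Type*} [NormedAddCommGroup E] [NormedSpace ℝ E] [FiniteDimensional ℝ E]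
    [NormedAddCommGroup F] [NormedSpace ℝ F] [FiniteDimensional ℝ F] (B : E →ₗ[ℝ] E →ₗ[ℝ] F) (a : E)
    (hB : ∀ y, ∃ x, B a x + B x a = y) (W : Set E) (hW : W ∈ 𝓝 a) : (fun x => B x x) '' W ∈ 𝓝 (B a a) := by
  haveI : CompleteSpace E := FiniteDimensional.complete ℝ E
  haveI : CompleteSpace F := FiniteDimensional.complete ℝ F
  have h1 := (B.toContinuousBilinearMap).hasStrictFDerivAt_of_bilinear (hasStrictFDerivAt_id a) (hasStrictFDerivAt_id a)
  have h2 := h1.map_nhds_eq_of_surj (by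
    rw [LinearMap.range_eq_top]
    intro y
    obtain ⟨x, hx⟩ := hB y
    exact ⟨x, by simpa using hx⟩)
  have h3 := Filter.image_mem_map (m := fun y => (B.toContinuousBilinearMap (id y)) (id y)) hW
  rw [h2] at h3
  exact h3

attribute [local instance] Matrix.normedAddCommGroup Matrix.normedSpace

/-- Projection to lower block matrices. -/
def lowP (p n : ℕ) : Matrix (Fin n) (Fin n) ℝ →ₗ[ℝ] Matrix (Fin n) (Fin n) ℝ where
  toFun x := Matrix.of fun i j => if (i : ℕ) < p ∧ p ≤ (j : ℕ) then 0 else x i j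
  map_add' x y := by ext i j; simp only [of_apply, Matrix.add_apply]; split_ifs <;> simp
  map_smul' c x := by ext i j; simp

/-- Symmetrization. -/
def symP (n : ℕ) : Matrix (Fin n) (Fin n) ℝ →ₗ[ℝ] SymE n where
  toFun x := ⟨(1 / 2 : ℝ) • (x + xᵀ), by
    show ((1 / 2 : ℝ) • (x + xᵀ))ᵀ = _
    rw [transpose_smul, transpose_add, transpose_transpose, add_comm]⟩
  map_add' x y := Subtype.ext (by simp only [transpose_add, Submodule.coe_add]; module)
  map_smul' c x := Subtype.ext (by simp only [transpose_smul, Submodule.coe_smul, RingHom.id_apply]; module)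

theorem nbhd_lemma (p q : ℕ) (hp : 1 ≤ p) (hq : 1 ≤ q) (i₀ j₀ : Fin (p + q)) (hij : i₀ ≠ j₀) (hj₀ : (j₀ : ℕ) < p) :
    ∃ Y : Set (SymE (p + q)), IsOpen Y ∧ Y.Nonempty ∧ ∀ X ∈ Y,
      0 < X.1 j₀ j₀ ∧ |X.1 i₀ j₀| < X.1 j₀ j₀ / 2 ∧
      ∃ (ρ : ℝ) (b : Matrix (Fin (p + q)) (Fin (p + q)) ℝ), 1 / 4 ≤ ρ ∧ ρ ≤ 4 ∧ b.det = 1 ∧ (∀ i j, |b i j| ≤ 4) ∧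
        (∀ i j : Fin (p + q), (i : ℕ) < p → p ≤ (j : ℕ) → b i j = 0) ∧ X.1 = ρ • (b * formMat p q * bᵀ) := by
  obtain ⟨B, hB⟩ : ∃ B : Matrix (Fin (p + q)) (Fin (p + q)) ℝ →ₗ[ℝ] Matrix (Fin (p + q)) (Fin (p + q)) ℝ →ₗ[ℝ] SymE (p + q),
      ∀ x y, B x y = symP _ (lowP p _ x * formMat p q * (lowP p _ y)ᵀ) :=
    ⟨LinearMap.mk₂ ℝ (fun x y => symP _ (lowP p _ x * formMat p q * (lowP p _ y)ᵀ))
      (by intro x y z; simp only [map_add, add_mul]) (by intro c x y; simp only [map_smul, smul_mul_assoc])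
      (by intro x y z; simp only [map_add, mul_add, transpose_add]) (by intro c x y; simp only [map_smul, mul_smul_comm, transpose_smul]),
      fun x y => rfl⟩
  have hP1 : lowP p (p + q) 1 = 1 := by
    ext i j
    simp only [lowP, LinearMap.coe_mk, AddHom.coe_mk, of_apply, one_apply]
    split_ifs with h1 h2 <;> first | rfl | (subst h2; omega)
  have hJs : ∀ x : Matrix (Fin (p + q)) (Fin (p + q)) ℝ, (symP _ (lowP p _ x * formMat p q * (lowP p _ x)ᵀ)).1 = lowP p _ x * formMat p q * (lowP p _ x)ᵀ := by
    intro x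
    show (1 / 2 : ℝ) • (_ + _ᵀ) = _
    rw [transpose_mul, transpose_mul, transpose_transpose, formMat_T, ← mul_assoc]
    module
  have hsurj : ∀ y : SymE (p + q), ∃ x, B 1 x + B x 1 = y := by
    intro y
    obtain ⟨x, hx⟩ : ∃ x : Matrix (Fin (p + q)) (Fin (p + q)) ℝ, x = Matrix.of fun i j : Fin (p + q) =>
      (if (i : ℕ) < p ∧ p ≤ (j : ℕ) then 0 else if (j : ℕ) < p ∧ p ≤ (i : ℕ) then 1 else (1/2 : ℝ)) * y.1 i j * (if (j : ℕ) < p then 1 else -1) := ⟨_, rfl⟩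
    refine ⟨x, ?_⟩
    have hPx : lowP p _ x = x := by
      ext i j
      simp only [lowP, LinearMap.coe_mk, AddHom.coe_mk, of_apply, hx]
      split_ifs <;> simp
    rw [hB, hB, hP1, hPx, ← map_add]
    have hy : ∀ i j, y.1 i j = y.1 j i := fun i j => by
      have := congrFun (congrFun (show (y.1)ᵀ = y.1 from y.2) j) i
      simpa using this
    have e : 1 * formMat p q * xᵀ + x * formMat p q * (1 : Matrix (Fin (p + q)) (Fin (p + q)) ℝ)ᵀ = y.1 := by
      ext i j
      rw [one_mul, transpose_one, mul_one, Matrix.add_apply, formMat, diagonal_mul, mul_diagonal, transpose_apply, hx]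
      simp only [of_apply, hy j i]
      split_ifs <;> first | (exfalso; omega) | ring
    rw [e]
    apply Subtype.ext
    show (1 / 2 : ℝ) • (y.1 + (y.1)ᵀ) = y.1
    rw [show (y.1)ᵀ = y.1 from y.2]
    module
  have hPc : Continuous (lowP p (p + q)) := LinearMap.continuous_of_finiteDimensional _
  obtain ⟨W, hW⟩ : ∃ W : Set (Matrix (Fin (p + q)) (Fin (p + q)) ℝ), W = {x | (∀ i j, |lowP p (p + q) x i j| < 2) ∧ 1 / 2 < (lowP p (p + q) x).det ∧ (lowP p (p + q) x).det < 2} := ⟨_, rfl⟩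
  have hWo : IsOpen W := by
    rw [hW]
    refine IsOpen.inter ?_ (IsOpen.inter ?_ ?_)
    · have e : {x : Matrix (Fin (p + q)) (Fin (p + q)) ℝ | ∀ i j, |lowP p (p + q) x i j| < 2} = ⋂ i, ⋂ j, {x | |lowP p (p + q) x i j| < 2} := by
        ext x; simp
      show IsOpen {x : Matrix (Fin (p + q)) (Fin (p + q)) ℝ | ∀ i j, |lowP p (p + q) x i j| < 2}
      rw [e]
      refine isOpen_iInter_of_finite fun i => isOpen_iInter_of_finite fun j => ?_
      exact isOpen_lt (hPc.matrix_elem i j).abs continuous_const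
    · exact isOpen_lt continuous_const hPc.matrix_det
    · exact isOpen_lt hPc.matrix_det continuous_const
  have hW1 : (1 : Matrix (Fin (p + q)) (Fin (p + q)) ℝ) ∈ W := by
    rw [hW]
    simp only [Set.mem_setOf_eq, hP1, det_one]
    refine ⟨fun i j => ?_, by norm_num, by norm_num⟩
    rw [one_apply]; split_ifs <;> norm_num
  have hN := quad_open B 1 hsurj W (hWo.mem_nhds hW1)
  have hB1 : (B 1 1).1 = formMat p q := by rw [hB, hJs, hP1]; simp
  have hent : ∀ i j, Continuous fun X : SymE (p + q) => X.1 i j := fun i j => continuous_subtype_val.matrix_elem i j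
  obtain ⟨Z, hZ⟩ : ∃ Z : Set (SymE (p + q)), Z = {X | 0 < X.1 j₀ j₀ ∧ |X.1 i₀ j₀| < X.1 j₀ j₀ / 2} := ⟨_, rfl⟩
  have hZo : IsOpen Z := by
    rw [hZ]
    exact (isOpen_lt continuous_const (hent _ _)).inter (isOpen_lt (hent _ _).abs ((hent _ _).div_const _))
  have hZ1 : B 1 1 ∈ Z := by
    rw [hZ]
    simp only [Set.mem_setOf_eq, hB1, formMat, diagonal_apply_eq, diagonal_apply_ne _ hij, if_pos hj₀]
    norm_num
  refine ⟨interior ((fun x => B x x) '' W) ∩ Z, isOpen_interior.inter hZo, ⟨B 1 1, mem_interior_iff_mem_nhds.2 hN, hZ1⟩, ?_⟩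
  rintro X ⟨hX1, hX2⟩
  rw [hZ] at hX2
  obtain ⟨x, hx, hxX⟩ := interior_subset hX1
  rw [hW] at hx
  obtain ⟨hx1, hx2, hx3⟩ := hx
  refine ⟨hX2.1, hX2.2, ?_⟩
  have hn0 : p + q ≠ 0 := by omega
  obtain ⟨r, hr0, hr⟩ : ∃ r : ℝ, 0 < r ∧ r ^ (p + q) = (lowP p (p + q) x).det :=
    ⟨(lowP p (p + q) x).det ^ (((p + q : ℕ) : ℝ)⁻¹), Real.rpow_pos_of_pos (by linarith) _, Real.rpow_inv_natCast_pow (by linarith) hn0⟩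
  have hr2 : r ≤ 2 := by
    by_contra h
    push Not at h
    have : r ^ 1 ≤ r ^ (p + q) := pow_le_pow_right₀ (by linarith) (by omega)
    rw [pow_one] at this; linarith
  have hr1 : 1 / 2 ≤ r := by
    by_contra h
    push Not at h
    have : r ^ (p + q) ≤ r ^ 1 := pow_le_pow_of_le_one hr0.le (by linarith) (by omega)
    rw [pow_one] at this; linarith
  refine ⟨r ^ 2, r⁻¹ • lowP p (p + q) x, by nlinarith, by nlinarith, ?_, ?_, ?_, ?_⟩
  · rw [det_smul, Fintype.card_fin, ← hr, ← mul_pow, inv_mul_cancel₀ hr0.ne', one_pow]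
  · intro i j
    rw [Matrix.smul_apply, smul_eq_mul, abs_mul, abs_of_pos (inv_pos.2 hr0)]
    have h1 : r⁻¹ ≤ 2 := by rw [inv_le_comm₀ hr0 (by norm_num)]; linarith
    have h2 := (hx1 i j).le
    have h3 : 0 < r⁻¹ := inv_pos.2 hr0
    nlinarith [abs_nonneg (lowP p (p + q) x i j)]
  · intro i j hi hj
    rw [Matrix.smul_apply, lowP]
    simp [hi, hj]
  · have : X.1 = lowP p (p + q) x * formMat p q * (lowP p (p + q) x)ᵀ := by
      rw [← hJs, ← hB]; exact congrArg Subtype.val hxX.symm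
    rw [this, transpose_smul, smul_mul_assoc, smul_mul_assoc, mul_smul_comm, smul_smul, smul_smul]
    have e : r ^ 2 * r⁻¹ * r⁻¹ = 1 := by field_simp
    rw [e, one_smul]
end

noncomputable section
/-- The diagonal matrix with `s` on the positive and `t` on the negative block. -/
def diagA (p q : ℕ) (s t : ℝ) : Matrix (Fin (p + q)) (Fin (p + q)) ℝ :=
  diagonal fun i => if (i : ℕ) < p then s else t

theorem diagA_eq (p q : ℕ) (s t : ℝ) :
    diagA p q s t = ((s + t) / 2) • 1 + ((s - t) / 2) • formMat p q := by
  rw [diagA, formMat, smul_one_eq_diagonal, ← diagonal_smul, diagonal_add]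
  congr 1; ext i
  simp only [Pi.smul_apply, smul_eq_mul]
  split_ifs <;> ring

theorem diagA_mul (p q : ℕ) (s t : ℝ) (hs : s ≠ 0) (ht : t ≠ 0) : diagA p q s t * diagA p q s⁻¹ t⁻¹ = 1 := by
  rw [diagA, diagA, diagonal_mul_diagonal, ← diagonal_one]
  congr 1; ext i; split_ifs <;> field_simp

theorem diagA_det (p q : ℕ) (s t : ℝ) : (diagA p q s t).det = s ^ p * t ^ q := by
  rw [diagA, det_diagonal, Fin.prod_univ_add]
  simp

theorem exists_st (p q M : ℕ) (hp : 1 ≤ p) : ∃ s t : ℝ, 0 < s ∧ 0 < t ∧ s ^ p * t ^ q = 1 ∧ t * (1 + M) ≤ s := by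
  have h1 : (1 : ℝ) ≤ 1 + M := by linarith [(Nat.cast_nonneg M : (0:ℝ) ≤ M)]
  have h0 : (0 : ℝ) < 1 + M := by linarith
  refine ⟨(1 + M) ^ q, ((1 + (M : ℝ)) ^ p)⁻¹, by positivity, by positivity, ?_, ?_⟩
  · rw [inv_pow, ← pow_mul, ← pow_mul, mul_comm q p]
    exact mul_inv_cancel₀ (by positivity)
  · have h2 : (1 : ℝ) ≤ (1 + M) ^ q := one_le_pow₀ h1
    have h3 : (1 + (M : ℝ)) ^ 1 ≤ (1 + M) ^ p := pow_le_pow_right₀ h1 hp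
    rw [pow_one] at h3
    refine le_trans ?_ h2
    rw [inv_mul_le_iff₀ (by positivity), mul_one]
    exact h3

theorem beta_entry (p q M k : ℕ) (hk : k < M) (s t : ℝ) (hs : 0 < s) (ht : 0 < t) (hst : t * (1 + M) ≤ s)
    (i₀ j₀ : Fin (p + q)) (hi₀ : p ≤ (i₀ : ℕ)) (hj₀ : (j₀ : ℕ) < p) (b : Matrix (Fin (p + q)) (Fin (p + q)) ℝ)
    (hb : ∀ i j, |b i j| ≤ 4) (hb0 : ∀ i j : Fin (p + q), (i : ℕ) < p → p ≤ (j : ℕ) → b i j = 0) (i j : Fin (p + q)) :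
    |(diagA p q s t * transvection i₀ j₀ (k : ℝ) * b * diagA p q s⁻¹ t⁻¹) i j| ≤ 4 := by
  have e : (transvection i₀ j₀ (k : ℝ) * b) i j = b i j + if i = i₀ then (k : ℝ) * b j₀ j else 0 := by
    by_cases h : i = i₀
    · subst h; simp
    · simp [h]
  rw [mul_assoc (diagA p q s t), diagA, diagA, mul_diagonal, diagonal_mul, e]
  have hbj := hb j₀ j
  have hbij := hb i j
  by_cases hi : (i : ℕ) < p
  · have hne : i ≠ i₀ := by rintro rfl; omega
    by_cases hj : (j : ℕ) < p
    · rw [if_pos hi, if_pos hj, if_neg hne, add_zero]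
      have : s * b i j * s⁻¹ = b i j := by field_simp
      rw [this]; exact hb i j
    · rw [if_neg hne, hb0 i j hi (by omega)]; simp
  · by_cases hj : (j : ℕ) < p
    · rw [if_neg hi, if_pos hj]
      have h1 : |b i j + if i = i₀ then (k : ℝ) * b j₀ j else 0| ≤ 4 * (1 + M) := by
        have hkM : (k : ℝ) ≤ M := by exact_mod_cast hk.le
        have hk0 : (0 : ℝ) ≤ k := Nat.cast_nonneg k
        refine (abs_add_le _ _).trans ?_
        have : |if i = i₀ then (k : ℝ) * b j₀ j else 0| ≤ M * 4 := by
          split_ifs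
          · rw [abs_mul, abs_of_nonneg hk0]
            exact mul_le_mul hkM hbj (abs_nonneg _) (by linarith)
          · rw [abs_zero]; linarith
        linarith
      rw [abs_mul, abs_mul, abs_of_pos ht, abs_of_pos (inv_pos.2 hs), ← div_eq_mul_inv, div_le_iff₀ hs]
      nlinarith
    · have h0 : b j₀ j = 0 := hb0 j₀ j hj₀ (by omega)
      rw [if_neg hi, if_neg hj, h0, mul_zero, ite_self, add_zero]
      have : t * b i j * t⁻¹ = b i j := by field_simp
      rw [this]; exact hb i j

theorem trans_entries {n : ℕ} (i₀ j₀ : Fin n) (hij : i₀ ≠ j₀) (k : ℝ) (X : Matrix (Fin n) (Fin n) ℝ) :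
    (transvection i₀ j₀ k * X * (transvection i₀ j₀ k)ᵀ) j₀ j₀ = X j₀ j₀ ∧
    (transvection i₀ j₀ k * X * (transvection i₀ j₀ k)ᵀ) i₀ j₀ = X i₀ j₀ + k * X j₀ j₀ := by
  have hT : (transvection i₀ j₀ k)ᵀ = transvection j₀ i₀ k := by
    simp [transvection, transpose_add, transpose_single]
  rw [hT]
  constructor
  · rw [mul_transvection_apply_of_ne _ _ _ _ hij.symm, transvection_mul_apply_of_ne _ _ _ _ hij.symm]
  · rw [mul_transvection_apply_of_ne _ _ _ _ hij.symm]; simp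

theorem SOZero_mat {p q : ℕ} (h : GL (Fin (p + q)) ℝ) (hh : h ∈ SOZero p q) :
    (h : Matrix (Fin (p + q)) (Fin (p + q)) ℝ) * formMat p q * (h : Matrix (Fin (p + q)) (Fin (p + q)) ℝ)ᵀ = formMat p q := by
  obtain ⟨x, -, rfl⟩ := Subgroup.mem_map.1 hh
  have h1 : (x.1 : Matrix (Fin (p + q)) (Fin (p + q)) ℝ)ᵀ * formMat p q * x.1 = formMat p q := x.2
  obtain ⟨A, hA⟩ : ∃ A : Matrix (Fin (p + q)) (Fin (p + q)) ℝ, A = x.1 := ⟨_, rfl⟩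
  show (x.1 : Matrix (Fin (p + q)) (Fin (p + q)) ℝ) * formMat p q * (x.1 : Matrix (Fin (p + q)) (Fin (p + q)) ℝ)ᵀ = formMat p q
  rw [← hA] at h1 ⊢
  have h2 : (formMat p q * Aᵀ * formMat p q) * A = 1 := by
    rw [mul_assoc, mul_assoc, ← mul_assoc Aᵀ, h1, formMat_sq]
  have h3 := mul_eq_one_comm.1 h2
  calc A * formMat p q * Aᵀ = A * (formMat p q * Aᵀ * formMat p q) * formMat p q := by
        simp only [mul_assoc, formMat_sq, mul_one]
    _ = _ := by rw [h3, one_mul]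

/-- Multiplicity statement in terms of matrices. -/
theorem mult_mat (p q M : ℕ) (hp : 1 ≤ p) (k₁ k₂ : ℕ) (hk₁ : k₁ < M) (hk₂ : k₂ < M) (s t : ℝ) (hs : 0 < s) (ht : 0 < t)
    (hst1 : s ^ p * t ^ q = 1) (hst : t * (1 + M) ≤ s)
    (i₀ j₀ : Fin (p + q)) (hi₀ : p ≤ (i₀ : ℕ)) (hj₀ : (j₀ : ℕ) < p) (b₁ b₂ γ : Matrix (Fin (p + q)) (Fin (p + q)) ℝ)
    (hγ : γ.det = 1) (hd₁ : b₁.det = 1) (hd₂ : b₂.det = 1)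
    (hb₁ : ∀ i j, |b₁ i j| ≤ 4) (hb0₁ : ∀ i j : Fin (p + q), (i : ℕ) < p → p ≤ (j : ℕ) → b₁ i j = 0)
    (hb₂ : ∀ i j, |b₂ i j| ≤ 4) (hb0₂ : ∀ i j : Fin (p + q), (i : ℕ) < p → p ≤ (j : ℕ) → b₂ i j = 0)
    (ρ₁ ρ₂ : ℝ) (hρ₁ : 0 < ρ₁) (hρ₂ : 0 < ρ₂)
    (heq : γ * (diagA p q s t * transvection i₀ j₀ (k₂ : ℝ) * (ρ₂ • (b₂ * formMat p q * b₂ᵀ)) * (diagA p q s t * transvection i₀ j₀ (k₂ : ℝ))ᵀ) * γᵀ =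
      diagA p q s t * transvection i₀ j₀ (k₁ : ℝ) * (ρ₁ • (b₁ * formMat p q * b₁ᵀ)) * (diagA p q s t * transvection i₀ j₀ (k₁ : ℝ))ᵀ) :
    ∃ c₁ c₂ S : Matrix (Fin (p + q)) (Fin (p + q)) ℝ, c₁.det = 1 ∧ c₂.det = 1 ∧
      (∀ i j, |c₁ i j| ≤ ((p + q : ℕ) : ℝ) * 4) ∧ (∀ i j, |c₂ i j| ≤ ((p + q : ℕ) : ℝ) * 4) ∧ S.PosDef ∧ S * formMat p q * S = formMat p q ∧
      γ * c₂ = c₁ * S := by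
  have hij : i₀ ≠ j₀ := by rintro rfl; omega
  obtain ⟨g₁, hg₁⟩ : ∃ g, g = diagA p q s t * transvection i₀ j₀ (k₁ : ℝ) * b₁ := ⟨_, rfl⟩
  obtain ⟨g₂, hg₂⟩ : ∃ g, g = diagA p q s t * transvection i₀ j₀ (k₂ : ℝ) * b₂ := ⟨_, rfl⟩
  have hdg₁ : g₁.det = 1 := by rw [hg₁, det_mul, det_mul, diagA_det, hst1, det_transvection_of_ne _ _ hij, hd₁]; norm_num
  have hdg₂ : g₂.det = 1 := by rw [hg₂, det_mul, det_mul, diagA_det, hst1, det_transvection_of_ne _ _ hij, hd₂]; norm_num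
  have heq' : ρ₂ • ((γ * g₂) * formMat p q * (γ * g₂)ᵀ) = ρ₁ • (g₁ * formMat p q * g₁ᵀ) := by
    rw [hg₁, hg₂]
    simp only [transpose_mul, mul_assoc, smul_mul_assoc, mul_smul_comm] at heq ⊢
    exact heq
  have hdJ : (formMat p q).det ≠ 0 := by
    intro h0
    have := congrArg det (formMat_sq p q)
    rw [det_mul, h0, det_one] at this
    norm_num at this
  have hρ : ρ₂ = ρ₁ := by
    have h1 := congrArg det heq'
    simp only [det_smul, det_mul, det_transpose, hγ, hdg₁, hdg₂, one_mul, mul_one, Fintype.card_fin] at h1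
    have h2 := mul_right_cancel₀ hdJ h1
    exact (pow_left_inj₀ hρ₂.le hρ₁.le (by omega)).1 h2
  have heq2 : (γ * g₂) * formMat p q * (γ * g₂)ᵀ = g₁ * formMat p q * g₁ᵀ := by
    rw [hρ] at heq'
    exact smul_right_injective _ hρ₁.ne' heq'
  have hu₁ : IsUnit g₁.det := by rw [hdg₁]; exact isUnit_one
  have ha1 := diagA_mul p q s t hs.ne' ht.ne'
  have ha2 := mul_eq_one_comm.1 ha1
  have hβ : ∀ g : Matrix (Fin (p + q)) (Fin (p + q)) ℝ, g * diagA p q s⁻¹ t⁻¹ * diagA p q s t = g := by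
    intro g; rw [mul_assoc, ha2, mul_one]
  have hda : (diagA p q s⁻¹ t⁻¹).det = 1 := by rw [diagA_det, inv_pow, inv_pow, ← mul_inv, hst1, inv_one]
  refine orb_mat p q hp γ (g₁ * diagA p q s⁻¹ t⁻¹) (g₂ * diagA p q s⁻¹ t⁻¹) (g₁⁻¹ * γ * g₂) 4 hγ (by rw [det_mul, hdg₁, hda, one_mul]) (by rw [det_mul, hdg₂, hda, one_mul])
    ?_ ?_ ?_ ((s + t) / 2) ((s - t) / 2) ((s⁻¹ + t⁻¹) / 2) ((s⁻¹ - t⁻¹) / 2) ?_ ?_ ?_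
  · rw [hg₁]; exact beta_entry p q M k₁ hk₁ s t hs ht hst i₀ j₀ hi₀ hj₀ b₁ hb₁ hb0₁
  · rw [hg₂]; exact beta_entry p q M k₂ hk₂ s t hs ht hst i₀ j₀ hi₀ hj₀ b₂ hb₂ hb0₂
  · calc g₁⁻¹ * γ * g₂ * formMat p q * (g₁⁻¹ * γ * g₂)ᵀ = g₁⁻¹ * ((γ * g₂) * formMat p q * (γ * g₂)ᵀ) * (g₁⁻¹)ᵀ := by
          simp only [transpose_mul, mul_assoc]
      _ = (g₁⁻¹ * g₁) * formMat p q * (g₁⁻¹ * g₁)ᵀ := by rw [heq2]; simp only [transpose_mul, mul_assoc]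
      _ = _ := by rw [nonsing_inv_mul _ hu₁]; simp
  · rw [← diagA_eq, ← diagA_eq, ha1]
  · have : ((s⁻¹ + t⁻¹) / 2) ^ 2 - ((s⁻¹ - t⁻¹) / 2) ^ 2 = s⁻¹ * t⁻¹ := by ring
    rw [this]; positivity
  · rw [← diagA_eq, ← mul_assoc, hβ, hβ, ← mul_assoc, ← mul_assoc, mul_nonsing_inv _ hu₁, one_mul]
end

attribute [local instance] Matrix.normedAddCommGroup Matrix.normedSpace

/-- For all integers `p, q ≥ 1`, the irreducible symmetric space
`SL(p+q,ℝ)/SO₀(p,q)` does not admit a compact Clifford–Klein form. -/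
theorem statement5 (p q : ℕ) (hp : 1 ≤ p) (hq : 1 ≤ q) :
    ¬ AdmitsCompactCliffordKleinForm ((SOZero p q).subgroupOf (SLR (p + q))) := by
  rintro ⟨Γ, -, hPD, -, hcpt⟩
  obtain ⟨H, hH⟩ : ∃ H, H = (SOZero p q).subgroupOf (SLR (p + q)) := ⟨_, rfl⟩
  have hHmem : ∀ h, h ∈ H ↔ (h : GL (Fin (p + q)) ℝ) ∈ SOZero p q := by
    intro h; rw [hH]; exact Subgroup.mem_subgroupOf
  rw [← hH] at hPD hcpt
  obtain ⟨R₀, hR₀⟩ := CK_extract H Γ hcpt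
  haveI : Countable Γ := by
    have hun : (Set.univ : Set Γ) = ⋃ m : ℕ, {γ : Γ | ∃ c₁ ∈ boxSL (p + q) m, ∃ c₂ ∈ boxSL (p + q) m, ∃ s ∈ H, (γ : SLR (p + q)) * c₂ = c₁ * s} := by
      symm
      rw [Set.eq_univ_iff_forall]
      intro γ
      have hex : ∀ g : SLR (p + q), ∃ r : ℝ, g ∈ boxSL (p + q) r := by
        intro g
        refine ⟨∑ i, ∑ j, |((g : GL (Fin (p + q)) ℝ) : Matrix (Fin (p + q)) (Fin (p + q)) ℝ) i j|, fun i j => ?_⟩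
        refine le_trans ?_ (Finset.single_le_sum (f := fun i => ∑ j, |((g : GL (Fin (p + q)) ℝ) : Matrix (Fin (p + q)) (Fin (p + q)) ℝ) i j|) (fun i _ => Finset.sum_nonneg fun j _ => abs_nonneg _) (Finset.mem_univ i))
        exact Finset.single_le_sum (f := fun j => |((g : GL (Fin (p + q)) ℝ) : Matrix (Fin (p + q)) (Fin (p + q)) ℝ) i j|) (fun i _ => abs_nonneg _) (Finset.mem_univ j)
      obtain ⟨r₁, h₁⟩ := hex γ
      obtain ⟨r₂, h₂⟩ := hex 1
      obtain ⟨m, hm⟩ := exists_nat_ge (max r₁ r₂)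
      refine Set.mem_iUnion.2 ⟨m, γ, fun i j => (h₁ i j).trans ((le_max_left _ _).trans hm), 1, fun i j => (h₂ i j).trans ((le_max_right _ _).trans hm), 1, H.one_mem, rfl⟩
    rw [← Set.countable_univ_iff, hun]
    exact Set.countable_iUnion fun m => (CK_finite H Γ hPD m).countable
  have hfin := CK_finite H Γ hPD (((p + q : ℕ) : ℝ) * 4)
  obtain ⟨i₀, hi₀⟩ : ∃ i : Fin (p + q), (i : ℕ) = p := ⟨⟨p, by omega⟩, rfl⟩
  obtain ⟨j₀, hj₀⟩ : ∃ i : Fin (p + q), (i : ℕ) = 0 := ⟨⟨0, by omega⟩, rfl⟩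
  have hij : i₀ ≠ j₀ := by rintro rfl; omega
  obtain ⟨Y, hYo, hYne, hY⟩ := nbhd_lemma p q hp hq i₀ j₀ hij (by omega)
  obtain ⟨f, hf⟩ : ∃ f : ℝ × SLR (p + q) → SymE (p + q), ∀ x, (f x).1 = x.1 • (((x.2 : GL (Fin (p + q)) ℝ) : Matrix (Fin (p + q)) (Fin (p + q)) ℝ) * formMat p q * ((x.2 : GL (Fin (p + q)) ℝ) : Matrix (Fin (p + q)) (Fin (p + q)) ℝ)ᵀ) :=
    ⟨fun x => ⟨_, by
      show (x.1 • (((x.2 : GL (Fin (p + q)) ℝ) : Matrix (Fin (p + q)) (Fin (p + q)) ℝ) * formMat p q * ((x.2 : GL (Fin (p + q)) ℝ) : Matrix (Fin (p + q)) (Fin (p + q)) ℝ)ᵀ))ᵀ = _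
      rw [transpose_smul, transpose_mul, transpose_mul, transpose_transpose, formMat_T, mul_assoc]⟩, fun x => rfl⟩
  have hfc : Continuous f := by
    rw [Topology.IsInducing.subtypeVal.continuous_iff]
    refine Continuous.congr ?_ fun x => (hf x).symm
    have hc := (SLR_cont (p + q)).comp (continuous_snd (X := ℝ) (Y := SLR (p + q)))
    exact continuous_fst.smul ((hc.matrix_mul continuous_const).matrix_mul hc.matrix_transpose)
  have hC := ((isCompact_Icc (a := (1 / 4 : ℝ)) (b := 4)).prod (boxSL_compact (p + q) R₀)).image hfc
  refine abstract_contra (E := SymE (p + q)) (Γ := Γ) (fun γ => symAct (p + q) ((γ : SLR (p + q)) : GL (Fin (p + q)) ℝ).val)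
    (fun γ => symAct_det (by omega) _ (SLR_det _)) _ hC Y hYo hYne hfin.toFinset ?_
  intro M
  obtain ⟨s, t, hs, ht, hst1, hst⟩ := exists_st p q M hp
  have ha2 := mul_eq_one_comm.1 (diagA_mul p q s t hs.ne' ht.ne')
  refine ⟨fun k => symAct (p + q) (diagA p q s t * transvection i₀ j₀ (k : ℝ)), ?_, ?_, ?_, ?_⟩
  · intro k
    apply symAct_det (by omega)
    rw [det_mul, diagA_det, hst1, det_transvection_of_ne _ _ hij, one_mul]
  · intro k l hkl
    rw [Set.disjoint_left]
    rintro _ ⟨y₁, hy₁, rfl⟩ ⟨y₂, hy₂, h⟩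
    have h1 := congrArg (symAct (p + q) (diagA p q s⁻¹ t⁻¹)) h
    rw [← Module.End.mul_apply, ← Module.End.mul_apply, ← map_mul, ← map_mul, ← mul_assoc, ← mul_assoc, ha2, one_mul, one_mul] at h1
    have h2 := congrArg Subtype.val h1
    rw [symAct_val, symAct_val] at h2
    obtain ⟨e1, e2⟩ := trans_entries i₀ j₀ hij (k : ℝ) y₁.1
    obtain ⟨e3, e4⟩ := trans_entries i₀ j₀ hij (l : ℝ) y₂.1
    rw [h2] at e3 e4
    rw [e1] at e3
    rw [e2] at e4
    obtain ⟨a1, a2, -⟩ := hY y₁ hy₁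
    obtain ⟨b1, b2, -⟩ := hY y₂ hy₂
    rw [← e3] at b2 e4
    rw [abs_lt] at a2 b2
    have hlt : ((k : ℝ) - l) * y₁.1 j₀ j₀ < y₁.1 j₀ j₀ := by nlinarith
    have hlt' : ((l : ℝ) - k) * y₁.1 j₀ j₀ < y₁.1 j₀ j₀ := by nlinarith
    have h3 : (k : ℝ) - l < 1 := by nlinarith
    have h4 : (l : ℝ) - k < 1 := by nlinarith
    have h5 : (k : ℤ) - l < 1 := by exact_mod_cast h3
    have h6 : (l : ℤ) - k < 1 := by exact_mod_cast h4
    omega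
  · intro k hk y hy
    obtain ⟨-, -, ρ, b, hρ1, hρ2, hbd, hb4, hb0, hyb⟩ := hY y hy
    have hd : (diagA p q s t * transvection i₀ j₀ (k : ℝ) * b).det = 1 := by
      rw [det_mul, det_mul, diagA_det, hst1, det_transvection_of_ne _ _ hij, one_mul, one_mul, hbd]
    obtain ⟨γ, c, hc, h, hh, hg⟩ := hR₀ (toSLR _ hd)
    refine ⟨γ, f (ρ, c), ⟨(ρ, c), ⟨⟨hρ1, hρ2⟩, hc⟩, rfl⟩, ?_⟩
    have hhJ := SOZero_mat _ ((hHmem h).1 hh)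
    have hg' := congrArg (fun g : SLR (p + q) => ((g : GL (Fin (p + q)) ℝ) : Matrix (Fin (p + q)) (Fin (p + q)) ℝ)) hg
    simp only [SLR_val_mul, toSLR_val] at hg'
    apply Subtype.ext
    rw [symAct_val, symAct_val, hf, hyb]
    obtain ⟨gm, hgm⟩ : ∃ m : Matrix (Fin (p + q)) (Fin (p + q)) ℝ, m = ((γ : SLR (p + q)) : GL (Fin (p + q)) ℝ).val := ⟨_, rfl⟩
    obtain ⟨cm, hcm⟩ : ∃ m : Matrix (Fin (p + q)) (Fin (p + q)) ℝ, m = (c : GL (Fin (p + q)) ℝ).val := ⟨_, rfl⟩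
    obtain ⟨hm, hhm⟩ : ∃ m : Matrix (Fin (p + q)) (Fin (p + q)) ℝ, m = (h : GL (Fin (p + q)) ℝ).val := ⟨_, rfl⟩
    simp only [← hgm, ← hcm, ← hhm] at hg' hhJ ⊢
    calc gm * ρ • (cm * formMat p q * cmᵀ) * gmᵀ = ρ • ((gm * cm) * (hm * formMat p q * hmᵀ) * (gm * cm)ᵀ) := by
          rw [hhJ]; simp only [transpose_mul, mul_assoc, smul_mul_assoc, mul_smul_comm]
      _ = ρ • ((gm * cm * hm) * formMat p q * (gm * cm * hm)ᵀ) := by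
          simp only [transpose_mul, mul_assoc]
      _ = _ := by
          rw [← hg']; simp only [transpose_mul, mul_assoc, smul_mul_assoc, mul_smul_comm]
  · intro x γ₁ γ₂ k₁ hk₁ k₂ hk₂ y₁ hy₁ y₂ hy₂ e₁ e₂
    obtain ⟨-, -, ρ₁, b₁, hρ1, -, hbd₁, hb4₁, hb0₁, hyb₁⟩ := hY y₁ hy₁
    obtain ⟨-, -, ρ₂, b₂, hρ2, -, hbd₂, hb4₂, hb0₂, hyb₂⟩ := hY y₂ hy₂
    have hγ : γ₁ * γ₂⁻¹ * γ₂ = γ₁ := by simp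
    obtain ⟨γ, hγd⟩ : ∃ γ, γ = γ₁ * γ₂⁻¹ := ⟨_, rfl⟩
    rw [← hγd] at hγ ⊢
    have e3 : symAct (p + q) ((γ : SLR (p + q)) : GL (Fin (p + q)) ℝ).val (symAct (p + q) (diagA p q s t * transvection i₀ j₀ (k₂ : ℝ)) y₂) = symAct (p + q) (diagA p q s t * transvection i₀ j₀ (k₁ : ℝ)) y₁ := by
      rw [← e₁, ← e₂, ← Module.End.mul_apply, ← map_mul, ← hγ]
      rfl
    have e4 := congrArg Subtype.val e3
    rw [symAct_val, symAct_val, symAct_val, hyb₁, hyb₂] at e4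
    obtain ⟨c₁, c₂, S, hc₁, hc₂, hB₁, hB₂, hS, hSJ, hrel⟩ := mult_mat p q M hp k₁ k₂ hk₁ hk₂ s t hs ht hst1 hst i₀ j₀ (by omega) (by omega) b₁ b₂ _ (SLR_det _) hbd₁ hbd₂ hb4₁ hb0₁ hb4₂ hb0₂ ρ₁ ρ₂ (by linarith) (by linarith) e4
    obtain ⟨σ, hσ, hσS⟩ := soZero_of_posDef p q S hS hSJ
    have hdS : S.det = 1 := by
      have := congrArg det hrel
      rw [det_mul, det_mul, hc₁, hc₂, SLR_det, one_mul, one_mul] at this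
      exact this.symm
    rw [Set.Finite.mem_toFinset]
    refine ⟨toSLR c₁ hc₁, hB₁, toSLR c₂ hc₂, hB₂, ⟨σ, by show (σ : Matrix (Fin (p + q)) (Fin (p + q)) ℝ).det = 1; rw [hσS, hdS]⟩, (hHmem _).2 hσ, ?_⟩
    apply SLR_ext
    rw [SLR_val_mul, SLR_val_mul, toSLR_val, toSLR_val, hrel, hσS]

end
end
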